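/- Let k ≥ 4 be an integer and let G be a 3-connected k-regular graph whose set of proper k-colourings is not a Kempe class. Let u, v be vertices and let w1, w2 be non-adjacent neighbours of v, neither adjacent to u. Then there exist non-adjacent neighbours t1, t2 of u such that G contains an induced subgraph isomorphic to K_{k−1} each of whose vertices is adjacent to exactly one of t1, t2 and to exactly one of w1, w2. -/

import Mathlib

open SimpleGraph
open scoped Classical

variable {V : Type*}

/-- A proper `k`-colouring of `G`. -/
def IsProperColoring (G : SimpleGraph V) (k : ℕ) (c : V → Fin k) : Prop :=
  ∀ ⦃u v : V⦄, G.Adj u v → c u ≠ c v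

/-- `c'` is obtained from `c` by a single Kempe change: the colours `a` and `b` are
swapped on the connected component (of the subgraph induced by the vertices coloured
`a` or `b`) containing `v0`, and all other vertices keep their colour. -/

def KempeStep (G : SimpleGraph V) (k : ℕ) (c c' : V → Fin k) : Prop :=
  ∃ a b : Fin k, ∃ v0 : {x : V | c x = a ∨ c x = b},
    ∀ v : V, c' v =
      if h : c v = a ∨ c v = b then
        if (G.induce {x : V | c x = a ∨ c x = b}).Reachable v0 ⟨v, h⟩
          then Equiv.swap a b (c v) else c v
      else c v

/-- Two colourings are Kempe equivalent if one is obtained from the other by a finite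
sequence of Kempe changes. -/
def KempeEquiv (G : SimpleGraph V) (k : ℕ) (c c' : V → Fin k) : Prop :=
  Relation.ReflTransGen (KempeStep G k) c c'

/-- The set of all proper `k`-colourings of `G` forms a single Kempe class. -/
def KempeClass (G : SimpleGraph V) (k : ℕ) : Prop :=
  ∀ c c' : V → Fin k, IsProperColoring G k c → IsProperColoring G k c' →
    KempeEquiv G k c c'

/-- `G` is `d`-degenerate: every nonempty set of vertices contains a vertex with at
most `d` neighbours inside the set. -/
def Degenerate (G : SimpleGraph V) (d : ℕ) : Prop :=
  ∀ S : Set V, S.Nonempty → ∃ v ∈ S, (S ∩ G.neighborSet v).ncard ≤ d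

/-- `G` is 3-connected: more than 3 vertices, and deleting any at most 2 vertices
leaves it connected. -/
def ThreeConnected [Fintype V] (G : SimpleGraph V) : Prop :=
  3 < Fintype.card V ∧ ∀ S : Set V, S.ncard ≤ 2 → (G.induce Sᶜ).Connected


namespace KJ

section basics
variable (G : SimpleGraph V)

/-- number of neighbours of `y` inside `Y` -/
noncomputable def dg (Y : Finset V) (y : V) : ℕ := (Y.filter (fun z => G.Adj y z)).card

/-- cut-based connectivity of a finite vertex set -/
def Conn (Y : Finset V) : Prop :=
  Y.Nonempty ∧ ∀ T ⊆ Y, T.Nonempty → (Y \ T).Nonempty →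
    ∃ a ∈ T, ∃ b ∈ Y \ T, G.Adj a b

/-- list colourability of a finite vertex set -/
def Col {k : ℕ} (Y : Finset V) (L : V → Finset (Fin k)) : Prop :=
  ∃ f : V → Fin k, (∀ y ∈ Y, f y ∈ L y) ∧ ∀ y ∈ Y, ∀ z ∈ Y, G.Adj y z → f y ≠ f z

def ClosedIn (E Y : Finset V) : Prop :=
  E ⊆ Y ∧ ∀ a ∈ E, ∀ b ∈ Y, G.Adj a b → b ∈ E

variable {G}

lemma exists_conn_closed (Y : Finset V) (hY : Y.Nonempty) :
    ∃ E, Conn G E ∧ ClosedIn G E Y := by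
  have hex : ∃ n, ∃ E : Finset V, E.Nonempty ∧ ClosedIn G E Y ∧ E.card = n :=
    ⟨_, Y, hY, ⟨subset_rfl, fun a _ b hb _ => hb⟩, rfl⟩
  obtain ⟨E, hE, hc, hn⟩ := Nat.find_spec hex
  refine ⟨E, ⟨hE, ?_⟩, hc⟩
  intro T hT hTn hd
  by_contra hcon
  push Not at hcon
  have hlt : T.card < E.card := by
    apply Finset.card_lt_card
    refine ⟨hT, fun h => ?_⟩
    obtain ⟨x, hx⟩ := hd
    have := Finset.mem_sdiff.1 hx
    exact this.2 (h this.1)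
  refine Nat.find_min hex (m := T.card) (by omega) ⟨T, hTn, ⟨hT.trans hc.1, ?_⟩, rfl⟩
  intro a ha b hb hab
  by_contra hbT
  have := hc.2 a (hT ha) b hb hab
  exact hcon a ha b (by simp [this, hbT]) hab

lemma col_of_pieces {k : ℕ} (L : V → Finset (Fin k)) (hk : 0 < k) :
    ∀ n, ∀ Y : Finset V, Y.card = n →
    (∀ E, Conn G E → ClosedIn G E Y → Col G E L) → Col G Y L := by
  intro n
  induction n using Nat.strong_induction_on with
  | _ n ih =>
  intro Y hYn hp
  rcases Y.eq_empty_or_nonempty with rfl | hY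
  · exact ⟨fun _ => ⟨0, hk⟩, by simp, by simp⟩
  obtain ⟨E, hE, hc⟩ := exists_conn_closed (G := G) Y hY
  obtain ⟨f, hf1, hf2⟩ := hp E hE hc
  have hcard : (Y \ E).card < n := by
    rw [← hYn]
    apply Finset.card_lt_card
    refine ⟨Finset.sdiff_subset, fun h => ?_⟩
    obtain ⟨x, hx⟩ := hE.1
    exact (Finset.mem_sdiff.1 (h (hc.1 hx))).2 hx
  have hno : ∀ a ∈ E, ∀ b ∈ Y \ E, ¬ G.Adj a b := by
    intro a ha b hb hab
    rw [Finset.mem_sdiff] at hb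
    exact hb.2 (hc.2 a ha b hb.1 hab)
  obtain ⟨g, hg1, hg2⟩ := ih _ hcard (Y \ E) rfl (by
    intro E' hE' hc'
    refine hp E' hE' ⟨hc'.1.trans Finset.sdiff_subset, ?_⟩
    intro a ha b hb hab
    refine hc'.2 a ha b ?_ hab
    rw [Finset.mem_sdiff]
    refine ⟨hb, fun hbE => hno b hbE a (hc'.1 ha) hab.symm⟩)
  refine ⟨fun y => if y ∈ E then f y else g y, ?_, ?_⟩
  · intro y hy
    by_cases h : y ∈ E
    · simpa [h] using hf1 y h
    · simpa [h] using hg1 y (by simp [hy, h])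
  · intro y hy z hz hyz
    by_cases h : y ∈ E <;> by_cases h' : z ∈ E
    · simpa [h, h'] using hf2 y h z h' hyz
    · exact absurd hyz (hno y h z (by simp [hz, h']))
    · exact absurd hyz.symm (hno z h' y (by simp [hy, h]))
    · simpa [h, h'] using hg2 y (by simp [hy, h]) z (by simp [hz, h']) hyz

lemma conn_sub_closed {N E Y : Finset V} (hN : Conn G N) (hNY : N ⊆ Y)
    (hE : ClosedIn G E Y) {a : V} (ha : a ∈ E) (ha' : a ∈ N) : N ⊆ E := by
  by_contra hcon
  obtain ⟨b, hb, hbE⟩ := Finset.not_subset.1 hcon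
  obtain ⟨p, hp, q, hq, hpq⟩ := hN.2 (N ∩ E) Finset.inter_subset_left
    ⟨a, by simp [ha, ha']⟩ ⟨b, by simp [hb, hbE]⟩
  simp only [Finset.mem_inter, Finset.mem_sdiff, not_and] at hp hq
  exact hq.2 hq.1 (hE.2 p hp.2 q (hNY hq.1) hpq)

lemma dg_mono {Y Z : Finset V} (h : Y ⊆ Z) (y : V) : dg G Y y ≤ dg G Z y :=
  Finset.card_le_card (Finset.filter_subset_filter _ h)

lemma dg_erase {Y : Finset V} {x y : V} (hx : x ∈ Y) :
    dg G (Y.erase x) y + (if G.Adj y x then 1 else 0) = dg G Y y := by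
  unfold dg
  rw [show (Y.erase x).filter (fun z => G.Adj y z) = (Y.filter (fun z => G.Adj y z)).erase x by ext; simp; tauto]
  by_cases h : G.Adj y x
  · simp only [h, if_true]; exact Finset.card_erase_add_one (by simp [h, hx])
  · rw [Finset.erase_eq_of_notMem] <;> simp [h]

end basics
end KJ

namespace KJ
section lists
variable {G : SimpleGraph V} {k : ℕ}

/-- remove colour `c` from the lists of the neighbours of `x` -/
noncomputable def rem (G : SimpleGraph V) (L : V → Finset (Fin k)) (x : V) (c : Fin k) : V → Finset (Fin k) :=
  fun z => if G.Adj z x then (L z).erase c else L z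

lemma rem_card (L : V → Finset (Fin k)) (x : V) (c : Fin k) (Y : Finset V) (hx : x ∈ Y) (z : V)
    (h : dg G Y z ≤ (L z).card) : dg G (Y.erase x) z ≤ (rem G L x c z).card := by
  have := dg_erase (G := G) (y := z) hx
  unfold rem
  split_ifs at * with h1
  · have := Finset.pred_card_le_card_erase (s := L z) (a := c)
    omega
  · omega

lemma col_of_rem {L : V → Finset (Fin k)} {Y : Finset V} {x : V} {c : Fin k}
    (hc : c ∈ L x) (h : Col G (Y.erase x) (rem G L x c)) : Col G Y L := by
  obtain ⟨f, hf1, hf2⟩ := h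
  have key : ∀ z ∈ Y.erase x, G.Adj z x → f z ≠ c := by
    intro z hz hzx
    have := hf1 z hz
    simp only [rem, hzx, if_true] at this
    exact Finset.ne_of_mem_erase this
  refine ⟨fun y => if y = x then c else f y, ?_, ?_⟩
  · intro y hy
    by_cases h : y = x
    · simpa [h] using hc
    · have := hf1 y (by simp [h, hy])
      simp only [h, if_false]
      unfold rem at this
      split_ifs at this
      · exact Finset.mem_of_mem_erase this
      · exact this
  · intro y hy z hz hyz
    by_cases h : y = x <;> by_cases h' : z = x
    · subst h; subst h'; exact absurd hyz (G.loopless.irrefl _)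
    · subst h; simp only [h', if_true, if_false]
      exact (key z (by simp [h', hz]) hyz.symm).symm
    · subst h'; simp only [h, if_true, if_false]
      exact (key y (by simp [h, hy]) hyz)
    · simp only [h, h', if_false]
      exact hf2 y (by simp [h, hy]) z (by simp [h', hz]) hyz

lemma greedy (hk : 0 < k) : ∀ n, ∀ (Y : Finset V) (L : V → Finset (Fin k)), Y.card = n → Conn G Y →
    (∀ y ∈ Y, dg G Y y ≤ (L y).card) → (∃ y ∈ Y, dg G Y y < (L y).card) → Col G Y L := by
  intro n
  induction n using Nat.strong_induction_on with
  | _ n ih =>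
  intro Y L hn hY hd ⟨y0, hy0, hs⟩
  have h1 : Col G (Y.erase y0) L := by
    refine col_of_pieces L hk _ _ rfl ?_
    intro E hE hc
    have hEY : E ⊆ Y := hc.1.trans (Finset.erase_subset _ _)
    have hlt : E.card < n := by
      have := Finset.card_le_card hc.1
      have := Finset.card_erase_lt_of_mem hy0
      omega
    have hy0E : y0 ∉ E := fun h => by simpa using hc.1 h
    refine ih _ hlt E L rfl hE (fun y hy => (dg_mono hEY y).trans (hd y (hEY hy))) ?_
    obtain ⟨a, ha, b, hb, hab⟩ := hY.2 E hEY hE.1 ⟨y0, by simp [hy0, hy0E]⟩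
    rw [Finset.mem_sdiff] at hb
    have hby : b = y0 := by
      by_contra hne
      exact hb.2 (hc.2 a ha b (by simp [hne, hb.1]) hab)
    subst hby
    refine ⟨a, ha, ?_⟩
    have e1 := dg_mono hc.1 a (G := G)
    have e2 := dg_erase (G := G) (y := a) hy0
    rw [if_pos hab] at e2
    have := hd a (hEY ha)
    omega
  obtain ⟨f, hf1, hf2⟩ := h1
  -- choose a colour for y0
  have : ∃ c ∈ L y0, c ∉ (Y.filter (fun z => G.Adj y0 z)).image f := by
    by_contra hcon
    push Not at hcon
    have h2 := Finset.card_le_card (s := L y0) (fun c hc => hcon c hc)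
    have h3 := Finset.card_image_le (s := Y.filter (fun z => G.Adj y0 z)) (f := f)
    unfold dg at hs
    omega
  obtain ⟨c, hc, hc'⟩ := this
  refine col_of_rem (x := y0) hc ⟨f, ?_, hf2⟩
  intro y hy
  have := hf1 y hy
  unfold rem
  split_ifs with h
  · refine Finset.mem_erase.2 ⟨?_, this⟩
    rintro rfl
    exact hc' (Finset.mem_image.2 ⟨y, by simp [Finset.mem_of_mem_erase hy, h.symm], rfl⟩)
  · exact this

lemma greedy' (hk : 0 < k) {Y : Finset V} {L : V → Finset (Fin k)} (hY : Conn G Y)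
    (hd : ∀ y ∈ Y, dg G Y y ≤ (L y).card) {y : V} (hy : y ∈ Y) (hs : dg G Y y < (L y).card) :
    Col G Y L := greedy hk _ Y L rfl hY hd ⟨y, hy, hs⟩

lemma edge_sub (hk : 0 < k) {Y : Finset V} {L : V → Finset (Fin k)}
    (hd : ∀ y ∈ Y, dg G Y y ≤ (L y).card) (hn : ¬ Col G Y L) {x y : V} (hx : x ∈ Y) (hy : y ∈ Y)
    (hxy : G.Adj x y) (hcx : Conn G (Y.erase x)) : L x ⊆ L y := by
  intro c hc
  by_contra hcy
  refine hn (col_of_rem hc (greedy' hk hcx ?_ (y := y) ?_ ?_))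
  · intro z hz
    exact rem_card L x c Y hx z (hd z (Finset.mem_of_mem_erase hz))
  · simp [hy, hxy.ne.symm]
  · have := dg_erase (G := G) (y := y) hx
    rw [if_pos hxy.symm] at this
    have h2 := hd y hy
    simp only [rem, hxy.symm, if_true]
    rw [Finset.erase_eq_of_notMem hcy]
    omega

lemma const_on_conn {α : Type*} {Y : Finset V} (hY : Conn G Y) (L : V → α)
    (h : ∀ x ∈ Y, ∀ y ∈ Y, G.Adj x y → L x = L y) : ∀ x ∈ Y, ∀ y ∈ Y, L x = L y := by
  intro x hx y hy
  by_contra hne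
  obtain ⟨a, ha, b, hb, hab⟩ := hY.2 (Y.filter (fun z => L z = L x)) (Finset.filter_subset _ _)
    ⟨x, by simp [hx]⟩ ⟨y, by simp [hy, Ne.symm hne]⟩
  simp only [Finset.mem_filter, Finset.mem_sdiff, not_and] at ha hb
  exact hb.2 hb.1 ((h a ha.1 b hb.1 hab).symm.trans ha.2)

/-- a leaf of `D`: `N` hangs on `x`, and no vertex of `N` is a cut vertex of `D` -/
structure Leaf (G : SimpleGraph V) (D : Finset V) (x : V) (N : Finset V) : Prop where
  xD : x ∈ D
  ND : N ⊆ D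
  xN : x ∉ N
  conn : Conn G N
  sep : ∀ a ∈ N, ∀ b ∈ D, G.Adj a b → b ∈ N ∨ b = x
  other : ∃ b ∈ D, b ∉ N ∧ b ≠ x
  noncut : ∀ y ∈ N, Conn G (D.erase y)

lemma exists_leaf {D : Finset V} (hD : Conn G D) {x : V} (hx : x ∈ D) {M : Finset V} (hM : M ⊆ D)
    (hxM : x ∉ M) (hMn : M.Nonempty) (hsep : ∀ a ∈ M, ∀ b ∈ D, G.Adj a b → b ∈ M ∨ b = x)
    (hoth : ∃ b ∈ D, b ∉ M ∧ b ≠ x) : ∃ x' N, N ⊆ M ∧ Leaf G D x' N := by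
  have hex : ∃ n, ∃ x N, N ⊆ M ∧ x ∈ D ∧ x ∉ N ∧ N.Nonempty ∧
      (∀ a ∈ N, ∀ b ∈ D, G.Adj a b → b ∈ N ∨ b = x) ∧ (∃ b ∈ D, b ∉ N ∧ b ≠ x) ∧ N.card = n :=
    ⟨_, x, M, subset_rfl, hx, hxM, hMn, hsep, hoth, rfl⟩
  obtain ⟨x', N, hNM, hx', hxN, hNn, hs, ho, hcard⟩ := Nat.find_spec hex
  have hmin : ∀ (z : V) (T : Finset V), T ⊆ N → T ≠ N → z ∈ D → z ∉ T → T.Nonempty →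
      (∀ a ∈ T, ∀ b ∈ D, G.Adj a b → b ∈ T ∨ b = z) → (∃ b ∈ D, b ∉ T ∧ b ≠ z) → False := by
    intro z T hT hTN hz hzT hTn h1 h2
    have : T.card < N.card := Finset.card_lt_card (hT.ssubset_of_ne hTN)
    exact Nat.find_min hex (m := T.card) (by omega) ⟨z, T, hT.trans hNM, hz, hzT, hTn, h1, h2, rfl⟩
  have hND : N ⊆ D := hNM.trans hM
  refine ⟨x', N, hNM, hx', hND, hxN, ⟨hNn, ?_⟩, hs, ho, ?_⟩
  · intro T hT hTn hd
    by_contra hcon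
    push Not at hcon
    obtain ⟨e, he⟩ := hd
    have he' := Finset.mem_sdiff.1 he
    refine hmin x' T hT (fun h => he'.2 (h ▸ he'.1)) hx' (fun h => hxN (hT h)) hTn ?_ ?_
    · intro a ha b hb hab
      rcases hs a (hT ha) b hb hab with h | h
      · left
        by_contra hbT
        exact hcon a ha b (by simp [h, hbT]) hab
      · exact Or.inr h
    · exact ⟨e, hND he'.1, he'.2, fun h => hxN (h ▸ he'.1)⟩
  · intro y hy
    have hyD := hND hy
    have hxy : x' ≠ y := fun h => hxN (h ▸ hy)
    refine ⟨⟨x', by simp [hxy, hx']⟩, ?_⟩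
    -- it suffices to treat sets without x'
    have main : ∀ T ⊆ D.erase y, T.Nonempty → x' ∉ T →
        ∃ a ∈ T, ∃ b ∈ D.erase y \ T, G.Adj a b := by
      intro T hT hTn hxT
      by_contra hcon
      push Not at hcon
      have hTD : T ⊆ D := hT.trans (Finset.erase_subset _ _)
      have hyT : y ∉ T := fun h => by simpa using hT h
      have hcl : ∀ a ∈ T, ∀ b ∈ D, G.Adj a b → b ∈ T ∨ b = y := by
        intro a ha b hb hab
        by_contra hh
        push Not at hh
        exact hcon a ha b (by simp [hh, hb]) hab
      have hTN : T ⊆ N := by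
        by_contra hsub
        obtain ⟨e, heT, heN⟩ := Finset.not_subset.1 hsub
        obtain ⟨p, hp, q, hq, hpq⟩ := hD.2 (T \ N) (Finset.sdiff_subset.trans hTD)
          ⟨e, by simp [heT, heN]⟩ ⟨x', by simp [hx', hxT]⟩
        simp only [Finset.mem_sdiff, not_and, not_not] at hp hq
        have hpx : p ≠ x' := fun h => hxT (h ▸ hp.1)
        have hqN : q ∉ N := fun h => by
          rcases hs q h p (hTD hp.1) hpq.symm with h | h
          · exact hp.2 h
          · exact hpx h
        rcases hcl p hp.1 q hq.1 hpq with h | h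
        · exact hqN (hq.2 h)
        · exact hqN (h ▸ hy)
      exact hmin y T hTN (fun h => hyT (h ▸ hy)) hyD hyT hTn hcl ⟨x', hx', hxT, hxy⟩
    intro T hT hTn hd
    by_cases hxT : x' ∈ T
    · obtain ⟨a, ha, b, hb, hab⟩ := main (D.erase y \ T) Finset.sdiff_subset hd (by simp [hxT])
      refine ⟨b, ?_, a, ha, hab.symm⟩
      simp only [Finset.mem_sdiff, not_and, not_not] at hb
      exact hb.2 hb.1
    · exact main T hT hTn hxT

/-- bad list instance -/
structure Bad (G : SimpleGraph V) (D : Finset V) (L : V → Finset (Fin k)) : Prop where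
  conn : Conn G D
  deg : ∀ y ∈ D, dg G D y ≤ (L y).card
  ncol : ¬ Col G D L

lemma Bad.eq (hk : 0 < k) {D : Finset V} {L : V → Finset (Fin k)} (h : Bad G D L) :
    ∀ y ∈ D, dg G D y = (L y).card := by
  intro y hy
  by_contra hne
  have := h.deg y hy
  exact h.ncol (greedy' hk h.conn h.deg hy (by omega))

lemma Leaf.const (hk : 0 < k) {D : Finset V} {L : V → Finset (Fin k)} (h : Bad G D L) {x : V}
    {N : Finset V} (hl : Leaf G D x N) : ∀ y ∈ N, ∀ z ∈ N, L y = L z := by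
  refine const_on_conn hl.conn L ?_
  intro y hy z hz hyz
  exact (edge_sub hk h.deg h.ncol (hl.ND hy) (hl.ND hz) hyz (hl.noncut y hy)).antisymm
    (edge_sub hk h.deg h.ncol (hl.ND hz) (hl.ND hy) hyz.symm (hl.noncut z hz))

lemma structure_lemma (hk : 0 < k) {D : Finset V} {L : V → Finset (Fin k)} (h : Bad G D L)
    (h1 : 1 < D.card) :
    (∀ y ∈ D, ∀ z ∈ D, L y = L z) ∨
    ∃ x N x' N', Leaf G D x N ∧ Leaf G D x' N' ∧ Disjoint N N' := by
  by_cases hc : ∀ y ∈ D, Conn G (D.erase y)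
  · left
    refine const_on_conn h.conn L ?_
    intro y hy z hz hyz
    exact (edge_sub hk h.deg h.ncol hy hz hyz (hc y hy)).antisymm
      (edge_sub hk h.deg h.ncol hz hy hyz.symm (hc z hz))
  · right
    push Not at hc
    obtain ⟨y, hy, hcon⟩ := hc
    have hne : (D.erase y).Nonempty := by
      rw [← Finset.card_pos, Finset.card_erase_of_mem hy]; omega
    unfold Conn at hcon
    push Not at hcon
    obtain ⟨T, hT, hTn, hd, hno⟩ := hcon hne
    obtain ⟨e, he⟩ := hTn
    obtain ⟨e', he'⟩ := hd
    have hTD : T ⊆ D := hT.trans (Finset.erase_subset _ _)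
    have hyT : y ∉ T := fun h => by simpa using hT h
    have hey : e ≠ y := fun h => hyT (h ▸ he)
    simp only [Finset.mem_sdiff, Finset.mem_erase] at he' hno
    obtain ⟨x1, N1, hN1, hl1⟩ := exists_leaf h.conn hy hTD hyT ⟨e, he⟩ (by
      intro a ha b hb hab
      by_contra hh
      push Not at hh
      exact hno a ha b ⟨⟨hh.2, hb⟩, hh.1⟩ hab) ⟨e', he'.1.2, he'.2, he'.1.1⟩
    obtain ⟨x2, N2, hN2, hl2⟩ := exists_leaf h.conn hy (M := D.erase y \ T)
      (Finset.sdiff_subset.trans (Finset.erase_subset _ _)) (by simp) ⟨e', by simp [he']⟩ (by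
      intro a ha b hb hab
      simp only [Finset.mem_sdiff, Finset.mem_erase] at ha ⊢
      by_contra hh
      have : b ∈ T := by tauto
      exact hno b this a ha hab.symm) ⟨e, hTD he, by simp [he], hey⟩
    refine ⟨x1, N1, x2, N2, hl1, hl2, ?_⟩
    rw [Finset.disjoint_left]
    intro a ha ha2
    exact (Finset.mem_sdiff.1 (hN2 ha2)).2 (hN1 ha)

end lists
end KJ

namespace KJ
section reduce
variable {G : SimpleGraph V} {k : ℕ}

lemma conn_of_pivot {Y : Finset V} {x : V} (hx : x ∈ Y)
    (h : ∀ T ⊆ Y, T.Nonempty → x ∉ T → ∃ a ∈ T, ∃ b ∈ Y \ T, G.Adj a b) : Conn G Y := by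
  refine ⟨⟨x, hx⟩, ?_⟩
  intro T hT hTn hd
  by_cases hxT : x ∈ T
  · obtain ⟨a, ha, b, hb, hab⟩ := h (Y \ T) Finset.sdiff_subset hd (by simp [hxT])
    refine ⟨b, ?_, a, ha, hab.symm⟩
    simp only [Finset.mem_sdiff, not_and, not_not] at hb
    exact hb.2 hb.1
  · exact h T hT hTn hxT

lemma conn_union {A B : Finset V} (hA : Conn G A) (hB : Conn G B) {a b : V} (ha : a ∈ A) (hb : b ∈ B)
    (hab : G.Adj a b) : Conn G (A ∪ B) := by
  refine conn_of_pivot (x := a) (by simp [ha]) ?_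
  intro T hT hTn haT
  by_cases h1 : (T ∩ A).Nonempty
  · obtain ⟨p, hp, q, hq, hpq⟩ := hA.2 (T ∩ A) Finset.inter_subset_right h1 ⟨a, by simp [ha, haT]⟩
    simp only [Finset.mem_inter, Finset.mem_sdiff, not_and] at hp hq
    exact ⟨p, hp.1, q, by simp only [Finset.mem_sdiff, Finset.mem_union]; tauto, hpq⟩
  · have hTB : ∀ e ∈ T, e ∈ B := by
      intro e he
      rcases Finset.mem_union.1 (hT he) with h | h
      · exact absurd ⟨e, by simp [he, h]⟩ h1
      · exact h
    by_cases hbT : b ∈ T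
    · exact ⟨b, hbT, a, by simp [ha, haT], hab.symm⟩
    · obtain ⟨p, hp, q, hq, hpq⟩ := hB.2 T hTB hTn ⟨b, by simp [hb, hbT]⟩
      simp only [Finset.mem_sdiff] at hq
      exact ⟨p, hp, q, by simp [hq], hpq⟩

lemma conn_nbr {Y : Finset V} (hY : Conn G Y) (h1 : 1 < Y.card) {x : V} (hx : x ∈ Y) :
    ∃ y ∈ Y, y ≠ x ∧ G.Adj x y := by
  have : (Y \ {x}).Nonempty := by
    rw [← Finset.card_pos, Finset.card_sdiff_of_subset (by simpa using hx)]; simp; omega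
  obtain ⟨a, ha, b, hb, hab⟩ := hY.2 {x} (by simpa using hx) ⟨x, by simp⟩ this
  simp only [Finset.mem_singleton, Finset.mem_sdiff] at ha hb
  subst ha
  exact ⟨b, hb.1, hb.2, hab⟩

lemma conn_singleton (x : V) : Conn G {x} := by
  refine conn_of_pivot (x := x) (by simp) ?_
  intro T hT hTn hx
  obtain ⟨e, he⟩ := hTn
  have := hT he
  simp only [Finset.mem_singleton] at this
  exact absurd (this ▸ he) hx

lemma dg_union {A B : Finset V} (h : Disjoint A B) (y : V) : dg G (A ∪ B) y = dg G A y + dg G B y := by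
  unfold dg
  rw [Finset.filter_union, Finset.card_union_of_disjoint (Finset.disjoint_filter_filter h)]

lemma dg_pos {Y : Finset V} {x y : V} (hy : y ∈ Y) (h : G.Adj x y) : 0 < dg G Y x :=
  Finset.card_pos.2 ⟨y, by simp [hy, h]⟩

lemma dg_le_card (Y : Finset V) (x : V) : dg G Y x ≤ Y.card := Finset.card_filter_le _ _

lemma dg_congr {Y Z : Finset V} {x : V} (h : ∀ y, G.Adj x y → (y ∈ Y ↔ y ∈ Z)) : dg G Y x = dg G Z x := by
  unfold dg
  congr 1
  ext y
  simp only [Finset.mem_filter]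
  constructor
  · rintro ⟨h1, h2⟩; exact ⟨(h y h2).1 h1, h2⟩
  · rintro ⟨h1, h2⟩; exact ⟨(h y h2).2 h1, h2⟩

lemma dg_le_of {Y Z : Finset V} {x : V} (h : ∀ y ∈ Y, G.Adj x y → y ∈ Z) : dg G Y x ≤ Z.card := by
  unfold dg
  apply Finset.card_le_card
  intro y hy
  simp only [Finset.mem_filter] at hy
  exact h y hy.1 hy.2

lemma Col.mono {Y : Finset V} {L L' : V → Finset (Fin k)} (h : Col G Y L) (hL : ∀ y ∈ Y, L y ⊆ L' y) : Col G Y L' := by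
  obtain ⟨f, h1, h2⟩ := h
  exact ⟨f, fun y hy => hL y hy (h1 y hy), h2⟩

lemma Col.subset {Y Z : Finset V} {L : V → Finset (Fin k)} (h : Col G Y L) (hZ : Z ⊆ Y) : Col G Z L := by
  obtain ⟨f, h1, h2⟩ := h
  exact ⟨f, fun y hy => h1 y (hZ hy), fun y hy z hz => h2 y (hZ hy) z (hZ hz)⟩

lemma Leaf.card_le (hk : 0 < k) {D : Finset V} {L : V → Finset (Fin k)} (h : Bad G D L) {x : V}
    {N : Finset V} (hl : Leaf G D x N) {y : V} (hy : y ∈ N) : (L y).card ≤ N.card := by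
  rw [← h.eq hk y (hl.ND hy)]
  have : dg G D y ≤ (insert x (N.erase y)).card := by
    refine dg_le_of ?_
    intro b hb hab
    rcases hl.sep y hy b hb hab with h | h
    · simp [h, hab.ne.symm]
    · simp [h]
  rwa [Finset.card_insert_of_notMem (by simp [hl.xN]), Finset.card_erase_add_one hy] at this

lemma Leaf.nbr {D : Finset V} (hD : Conn G D) {x : V}
    {N : Finset V} (hl : Leaf G D x N) : ∃ y ∈ N, G.Adj x y := by
  obtain ⟨a, ha, b, hb, hab⟩ := hD.2 N hl.ND hl.conn.1 ⟨x, by simp [hl.xD, hl.xN]⟩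
  simp only [Finset.mem_sdiff] at hb
  rcases hl.sep a ha b hb.1 hab with h | h
  · exact absurd h hb.2
  · subst h; exact ⟨a, ha, hab.symm⟩

lemma Leaf.conn_rest {D : Finset V} (hD : Conn G D) {x : V}
    {N : Finset V} (hl : Leaf G D x N) : Conn G (D \ N) := by
  refine conn_of_pivot (x := x) (by simp [hl.xD, hl.xN]) ?_
  intro T hT hTn hxT
  obtain ⟨a, ha, b, hb, hab⟩ := hD.2 T (hT.trans Finset.sdiff_subset) hTn ⟨x, by simp [hl.xD, hxT]⟩
  have haD := Finset.mem_sdiff.1 (hT ha)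
  simp only [Finset.mem_sdiff] at hb
  have hbN : b ∉ N := fun h => by
    rcases hl.sep b h a haD.1 hab.symm with h | h
    · exact haD.2 h
    · exact hxT (h ▸ ha)
  exact ⟨a, ha, b, by simp [hb, hbN], hab⟩

lemma Leaf.conn_insert {D : Finset V} (hD : Conn G D) {x : V}
    {N : Finset V} (hl : Leaf G D x N) : Conn G (insert x N) := by
  obtain ⟨y, hy, hxy⟩ := hl.nbr hD
  have := conn_union (conn_singleton (G := G) x) hl.conn (by simp) hy hxy
  rwa [show insert x N = {x} ∪ N from rfl]

lemma Leaf.conn_insert_erase {D : Finset V} {x : V}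
    {N : Finset V} (hl : Leaf G D x N) {y : V} (hy : y ∈ N) : Conn G ((insert x N).erase y) := by
  have hxy : x ≠ y := fun h => hl.xN (h ▸ hy)
  refine conn_of_pivot (x := x) (by simp [hxy]) ?_
  intro T hT hTn hxT
  have hTN : ∀ e ∈ T, e ∈ N ∧ e ≠ y := by
    intro e he
    have := hT he
    have hex : e ≠ x := fun h => hxT (h ▸ he)
    simp only [Finset.mem_erase, Finset.mem_insert] at this
    tauto
  obtain ⟨a, ha, b, hb, hab⟩ := (hl.noncut y hy).2 T
    (fun e he => by simp [hTN e he, hl.ND (hTN e he).1]) hTn ⟨x, by simp [hl.xD, hxT, hxy]⟩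
  simp only [Finset.mem_sdiff, Finset.mem_erase] at hb
  refine ⟨a, ha, b, ?_, hab⟩
  simp only [Finset.mem_sdiff, Finset.mem_erase, Finset.mem_insert]
  have := hl.sep a (hTN a ha).1 b hb.1.2 hab
  tauto

lemma Leaf.merge {D : Finset V} {L : V → Finset (Fin k)} {x : V}
    {N : Finset V} (hl : Leaf G D x N) {f g : V → Fin k}
    (hf : ∀ y ∈ D \ N, f y ∈ L y) (hf' : ∀ y ∈ D \ N, ∀ z ∈ D \ N, G.Adj y z → f y ≠ f z)
    (hg : ∀ y ∈ N, g y ∈ L y) (hg' : ∀ y ∈ insert x N, ∀ z ∈ insert x N, G.Adj y z → g y ≠ g z)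
    (hfg : f x = g x) : Col G D L := by
  have hno : ∀ y ∈ N, ∀ z ∈ D, z ∉ N → G.Adj y z → g y ≠ f z := by
    intro y hy z hz hzN hyz
    rcases hl.sep y hy z hz hyz with h | h
    · exact absurd h hzN
    · subst h; rw [hfg]; exact hg' y (by simp [hy]) z (by simp) hyz
  refine ⟨fun z => if z ∈ N then g z else f z, ?_, ?_⟩
  · intro y hy
    by_cases h : y ∈ N
    · simpa [h] using hg y h
    · simpa [h] using hf y (by simp [h, hy])
  · intro y hy z hz hyz
    by_cases h : y ∈ N <;> by_cases h' : z ∈ N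
    · simpa [h, h'] using hg' y (by simp [h]) z (by simp [h']) hyz
    · simpa [h, h'] using hno y h z hz h' hyz
    · simpa [h, h'] using (hno z h' y hy h hyz.symm).symm
    · simpa [h, h'] using hf' y (by simp [hy, h]) z (by simp [hz, h']) hyz

lemma Leaf.reduce (hk : 0 < k) {D : Finset V} {L : V → Finset (Fin k)} (h : Bad G D L) {x : V}
    {N : Finset V} (hl : Leaf G D x N) {y0 : V} (hy0 : y0 ∈ N) :
    L y0 ⊆ L x ∧ dg G N x = (L y0).card ∧ ¬ Col G (insert x N) (fun _ => L y0) ∧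
    Bad G (D \ N) (Function.update L x (L x \ L y0)) := by
  set OK := (L x).filter (fun c => Col G (D \ N) (Function.update L x {c})) with hOK
  set F := L x \ OK with hF
  have hsum : dg G D x = dg G (D \ N) x + dg G N x := by
    rw [← dg_union Finset.sdiff_disjoint, Finset.sdiff_union_of_subset hl.ND]
  have hconn := hl.conn_rest h.conn
  have hFn : ¬ Col G (D \ N) (Function.update L x F) := by
    rintro ⟨f, h1, h2⟩
    have hx := h1 x (by simp [hl.xD, hl.xN])
    simp only [Function.update_self, hF, Finset.mem_sdiff] at hx
    refine hx.2 (Finset.mem_filter.2 ⟨hx.1, f, ?_, h2⟩)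
    intro y hy
    by_cases hyx : y = x
    · subst hyx; simp
    · simpa [Function.update_of_ne hyx] using h1 y hy
  have hFd : ∀ y ∈ D \ N, y ≠ x → dg G (D \ N) y ≤ (Function.update L x F y).card := by
    intro y hy hyx
    rw [Function.update_of_ne hyx]
    exact (dg_mono Finset.sdiff_subset y).trans (h.deg y (Finset.mem_sdiff.1 hy).1)
  have hFc : F.card ≤ dg G (D \ N) x := by
    by_contra hcon
    push Not at hcon
    refine hFn (greedy' hk hconn ?_ (y := x) (by simp [hl.xD, hl.xN]) (by simpa using hcon))
    intro y hy
    by_cases hyx : y = x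
    · subst hyx; simpa using hcon.le
    · exact hFd y hy hyx
  have hOKsub : OK ⊆ L x := Finset.filter_subset _ _
  have hcards : F.card + OK.card = (L x).card := Finset.card_sdiff_add_card_eq_card hOKsub
  have hxeq := h.eq hk x hl.xD
  have hne : ∀ y ∈ N, y ≠ x := fun y hy h => hl.xN (h ▸ hy)
  have hdN : dg G (insert x N) x = dg G N x := dg_congr (fun y hy => by simp [hy.ne.symm])
  have hB : Bad G (insert x N) (Function.update L x OK) := by
    refine ⟨hl.conn_insert h.conn, ?_, ?_⟩
    · intro y hy
      by_cases hyx : y = x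
      · subst hyx
        simp only [Function.update_self]
        omega
      · rw [Function.update_of_ne hyx]
        have hyN : y ∈ N := by simpa [hyx] using hy
        refine (dg_mono ?_ y).trans (h.deg y (hl.ND hyN))
        intro z hz
        rcases Finset.mem_insert.1 hz with h | h
        · exact h ▸ hl.xD
        · exact hl.ND h
    · rintro ⟨g, hg1, hg2⟩
      have hx := hg1 x (by simp)
      simp only [Function.update_self, hOK, Finset.mem_filter] at hx
      obtain ⟨hgx, f, hf1, hf2⟩ := hx
      have hfx := hf1 x (by simp [hl.xD, hl.xN])
      simp only [Function.update_self, Finset.mem_singleton] at hfx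
      refine h.ncol (hl.merge (f := f) (g := g) ?_ hf2 ?_ hg2 hfx)
      · intro y hy
        by_cases hyx : y = x
        · subst hyx; rwa [hfx]
        · simpa [Function.update_of_ne hyx] using hf1 y hy
      · intro y hy
        have := hg1 y (by simp [hy])
        rwa [Function.update_of_ne (hne y hy)] at this
  have hOKc := hB.eq hk x (by simp)
  simp only [Function.update_self] at hOKc
  obtain ⟨y, hy, hxy⟩ := hl.nbr h.conn
  have e1 := edge_sub hk hB.deg hB.ncol (by simp) (by simp [hy]) hxy
    (by rw [Finset.erase_insert hl.xN]; exact hl.conn)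
  have e2 := edge_sub hk hB.deg hB.ncol (by simp [hy]) (by simp) hxy.symm (hl.conn_insert_erase hy)
  simp only [Function.update_self, Function.update_of_ne (hne y hy)] at e1 e2
  have hOKeq : OK = L y0 := (e1.antisymm e2).trans (hl.const hk h y hy y0 hy0)
  rw [hdN] at hOKc
  refine ⟨hOKeq ▸ hOKsub, by rw [← hOKeq]; exact hOKc, ?_, ?_⟩
  · intro hcol
    refine hB.ncol (hcol.mono ?_)
    intro z hz
    by_cases hzx : z = x
    · subst hzx; simp [hOKeq]
    · rw [Function.update_of_ne hzx]
      have hzN : z ∈ N := by simpa [hzx] using hz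
      rw [hl.const hk h z hzN y0 hy0]
  · rw [← hOKeq]
    refine ⟨hconn, ?_, hFn⟩
    intro y hy
    by_cases hyx : y = x
    · subst hyx
      simp only [Function.update_self]
      rw [← hF]
      omega
    · exact hFd y hy hyx

/-- extending a leaf to a bigger graph -/
lemma Leaf.extend {D' M : Finset V} {z x1 : V} {N1 : Finset V} (hl : Leaf G D' x1 N1)
    (hM : Conn G M) (hz : z ∈ D') (hzN : z ∉ N1) (hdis : Disjoint D' M) (hzM : ∃ m ∈ M, G.Adj z m)
    (honly : ∀ a ∈ D', ∀ m ∈ M, G.Adj a m → a = z) : Leaf G (D' ∪ M) x1 N1 := by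
  refine ⟨by simp [hl.xD], hl.ND.trans Finset.subset_union_left, hl.xN, hl.conn, ?_, ?_, ?_⟩
  · intro a ha b hb hab
    rcases Finset.mem_union.1 hb with h | h
    · exact hl.sep a ha b h hab
    · exact absurd (honly a (hl.ND ha) b h hab ▸ ha) hzN
  · obtain ⟨b, hb, h1⟩ := hl.other
    exact ⟨b, by simp [hb], h1⟩
  · intro y hy
    have hyz : z ≠ y := fun h => hzN (h ▸ hy)
    obtain ⟨m, hm, hzm⟩ := hzM
    have hyM : y ∉ M := Finset.disjoint_left.1 hdis (hl.ND hy)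
    have := conn_union (hl.noncut y hy) hM (a := z) (b := m) (by simp [hyz, hz]) hm hzm
    rwa [show (D' ∪ M).erase y = D'.erase y ∪ M by
      rw [Finset.erase_union_distrib, Finset.erase_eq_of_notMem hyM]]

end reduce
end KJ

namespace KJ
section kempe
variable {G : SimpleGraph V} {k : ℕ}

/-- swap colours `a`, `b` on `U` -/
noncomputable def sw (a b : Fin k) (U : Set V) (c : V → Fin k) : V → Fin k :=
  fun y => if y ∈ U then Equiv.swap a b (c y) else c y

lemma sw_of_ne {a b : Fin k} {U : Set V} {c : V → Fin k} {y : V} (h1 : c y ≠ a) (h2 : c y ≠ b) :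
    sw a b U c y = c y := by
  unfold sw; split_ifs
  · exact Equiv.swap_apply_of_ne_of_ne h1 h2
  · rfl

lemma swap_mem_iff {a b e : Fin k} : (Equiv.swap a b e = a ∨ Equiv.swap a b e = b) ↔ (e = a ∨ e = b) := by
  by_cases h1 : e = a
  · subst h1; simp
  · by_cases h2 : e = b
    · subst h2; simp
    · rw [Equiv.swap_apply_of_ne_of_ne h1 h2]

lemma sw_mem_iff {a b : Fin k} {U : Set V} {c : V → Fin k} {y : V} :
    (sw a b U c y = a ∨ sw a b U c y = b) ↔ (c y = a ∨ c y = b) := by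
  unfold sw; split_ifs
  · exact swap_mem_iff
  · rfl

/-- no bichromatic edge (inside `X`) leaves `U` -/
def Clo (G : SimpleGraph V) (X : Finset V) (c : V → Fin k) (a b : Fin k) (U : Set V) : Prop :=
  ∀ y ∈ X, ∀ z ∈ X, G.Adj y z → (c y = a ∨ c y = b) → (c z = a ∨ c z = b) → y ∈ U → z ∈ U

def Prop' (G : SimpleGraph V) (X : Finset V) (c : V → Fin k) : Prop :=
  ∀ y ∈ X, ∀ z ∈ X, G.Adj y z → c y ≠ c z

lemma sw_proper {X : Finset V} {c : V → Fin k} {a b : Fin k} {U : Set V} (hc : Prop' G X c)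
    (hU : Clo G X c a b U) : Prop' G X (sw a b U c) := by
  intro y hy z hz hyz heq
  have hne := hc y hy z hz hyz
  by_cases h1 : c y = a ∨ c y = b
  · by_cases h2 : c z = a ∨ c z = b
    · have : y ∈ U ↔ z ∈ U := ⟨hU y hy z hz hyz h1 h2, hU z hz y hy hyz.symm h2 h1⟩
      unfold sw at heq
      by_cases h : y ∈ U
      · have h' := this.1 h
        simp only [h, h', if_true] at heq
        exact hne ((Equiv.swap a b).injective heq)
      · have h' : z ∉ U := fun h' => h (this.2 h')
        simp only [h, h', if_false] at heq
        exact hne heq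
    · exact h2 (sw_mem_iff.1 (heq ▸ sw_mem_iff.2 h1))
  · have h2 : ¬ (c z = a ∨ c z = b) := fun h2 => h1 (sw_mem_iff.1 (heq ▸ sw_mem_iff.2 h2))
    push Not at h1 h2
    rw [sw_of_ne h1.1 h1.2, sw_of_ne h2.1 h2.2] at heq
    exact hne heq

lemma kempe_of_sw [Fintype V] (a b : Fin k) : ∀ n, ∀ (c : V → Fin k) (U : Set V),
    (Finset.univ.filter (fun y => y ∈ U ∧ (c y = a ∨ c y = b))).card = n →
    Clo G Finset.univ c a b U → KempeEquiv G k c (sw a b U c) := by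
  intro n
  induction n using Nat.strong_induction_on with
  | _ n ih =>
  intro c U hn hU
  by_cases hemp : ∃ v, v ∈ U ∧ (c v = a ∨ c v = b)
  · obtain ⟨v, hvU, hv⟩ := hemp
    set K : Set V := {y | ∃ h : c y = a ∨ c y = b,
      (G.induce {x : V | c x = a ∨ c x = b}).Reachable ⟨v, hv⟩ ⟨y, h⟩} with hK
    have hKU : ∀ y ∈ K, y ∈ U := by
      rintro y ⟨h, hr⟩
      have : ∀ p q : {x : V | c x = a ∨ c x = b}, (G.induce {x : V | c x = a ∨ c x = b}).Reachable p q →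
          p.1 ∈ U → q.1 ∈ U := by
        rintro p q ⟨w⟩
        induction w with
        | nil => exact id
        | @cons p m q hadj _ ih =>
          intro hp
          exact ih (hU p.1 (by simp) m.1 (by simp) hadj p.2 m.2 hp)
      exact this _ _ hr hvU
    have hvK : v ∈ K := ⟨hv, Reachable.refl _⟩
    have hKclo : ∀ y z, G.Adj y z → (c y = a ∨ c y = b) → (c z = a ∨ c z = b) → y ∈ K → z ∈ K := by
      rintro y z hyz hy hz ⟨h, hr⟩
      refine ⟨hz, hr.trans (Adj.reachable ?_)⟩
      exact hyz
    have hstep : KempeStep G k c (sw a b K c) := by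
      refine ⟨a, b, ⟨v, hv⟩, ?_⟩
      intro y
      by_cases h : c y = a ∨ c y = b
      · rw [dif_pos h]
        by_cases hr : (G.induce {x : V | c x = a ∨ c x = b}).Reachable ⟨v, hv⟩ ⟨y, h⟩
        · rw [if_pos hr]
          have : y ∈ K := ⟨h, hr⟩
          simp [sw, this]
        · rw [if_neg hr]
          have : y ∉ K := fun ⟨_, h'⟩ => hr h'
          simp [sw, this]
      · rw [dif_neg h]
        push Not at h
        exact sw_of_ne h.1 h.2
    have heq : sw a b U c = sw a b (U \ K) (sw a b K c) := by
      funext y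
      by_cases h1 : y ∈ K
      · have := hKU y h1
        simp [sw, h1, this]
      · by_cases h2 : y ∈ U <;> simp [sw, h1, h2]
    refine Relation.ReflTransGen.head hstep ?_
    rw [heq]
    refine ih _ ?_ (sw a b K c) (U \ K) rfl ?_
    · rw [← hn]
      apply Finset.card_lt_card
      refine ⟨?_, fun hh => ?_⟩
      · intro y hy
        simp only [Finset.mem_filter, Finset.mem_univ, true_and, sw_mem_iff] at hy ⊢
        exact ⟨hy.1.1, hy.2⟩
      · have := hh (show v ∈ _ by simp [hvU, hv])
        simp only [Finset.mem_filter, Finset.mem_univ, true_and] at this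
        exact this.1.2 hvK
    · intro y _ z _ hyz hy hz hyU
      rw [sw_mem_iff] at hy hz
      exact ⟨hU y (by simp) z (by simp) hyz hy hz hyU.1,
        fun hzK => hyU.2 (hKclo z y hyz.symm hz hy hzK)⟩
  · have : sw a b U c = c := by
      funext y
      unfold sw
      split_ifs with h
      · have : ¬ (c y = a ∨ c y = b) := fun h' => hemp ⟨y, h, h'⟩
        push Not at this
        exact Equiv.swap_apply_of_ne_of_ne this.1 this.2
      · rfl
    rw [this]
    exact Relation.ReflTransGen.refl

/-- one swap inside `X`, treating `w1`, `w2` alike -/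
def St (G : SimpleGraph V) (w1 w2 : V) (X : Finset V) (c c' : V → Fin k) : Prop :=
  ∃ a b U, Clo G X c a b U ∧ (w1 ∈ U ↔ w2 ∈ U) ∧ c' = sw a b U c

def Rr (G : SimpleGraph V) (w1 w2 : V) (X : Finset V) : (V → Fin k) → (V → Fin k) → Prop :=
  Relation.ReflTransGen (St G w1 w2 X)

lemma St.alike {w1 w2 : V} {X : Finset V} {c c' : V → Fin k} (h : St G w1 w2 X c c')
    (hc : c w1 = c w2) : c' w1 = c' w2 := by
  obtain ⟨a, b, U, -, h2, rfl⟩ := h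
  unfold sw
  by_cases h : w1 ∈ U
  · simp [h, h2.1 h, hc]
  · have : w2 ∉ U := fun h' => h (h2.2 h')
    simp [h, this, hc]

lemma Rr.alike {w1 w2 : V} {X : Finset V} {c c' : V → Fin k} (h : Rr G w1 w2 X c c')
    (hc : c w1 = c w2) : c' w1 = c' w2 := by
  induction h with
  | refl => exact hc
  | tail _ h ih => exact h.alike ih

/-- recolouring one vertex -/
lemma recolor {w1 w2 : V} {X : Finset V} {c c' : V → Fin k} {x : V} (hx1 : x ≠ w1) (hx2 : x ≠ w2)
    (heq : ∀ y, y ≠ x → c' y = c y)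
    (hc : x ∈ X → ∀ y ∈ X, G.Adj x y → c y ≠ c x)
    (hc' : x ∈ X → ∀ y ∈ X, G.Adj x y → c y ≠ c' x) :
    St G w1 w2 X c c' := by
  refine ⟨c x, c' x, {x}, ?_, by simp [hx1.symm, hx2.symm], ?_⟩
  · intro y hy z hz hyz h1 h2 hyx
    simp only [Set.mem_singleton_iff] at hyx
    subst hyx
    rcases h2 with h2 | h2
    · exact absurd h2 (hc hy z hz hyz)
    · exact absurd h2 (hc' hy z hz hyz)
  · funext y
    by_cases h : y = x
    · subst h; simp [sw]
    · simp [sw, h, heq y h]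

lemma Rr_base [Fintype V] {w1 w2 : V} (hna : ¬ G.Adj w1 w2) {c c' : V → Fin k}
    (hc : c w1 = c w2) (hc' : c' w1 = c' w2) : Rr G w1 w2 {w1, w2} c c' := by
  have hno : ∀ y ∈ ({w1, w2} : Finset V), ∀ z ∈ ({w1, w2} : Finset V), ¬ G.Adj y z := by
    intro y hy z hz h
    simp only [Finset.mem_insert, Finset.mem_singleton] at hy hz
    rcases hy with rfl | rfl <;> rcases hz with rfl | rfl
    · exact G.loopless.irrefl _ h
    · exact hna h
    · exact hna h.symm
    · exact G.loopless.irrefl _ h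
  have key : ∀ S : Finset V, Rr G w1 w2 {w1, w2} c (fun y => if y ∈ S ∨ y = w1 ∨ y = w2 then c' y else c y) := by
    intro S
    induction S using Finset.induction_on with
    | empty =>
      refine Relation.ReflTransGen.single ⟨c w1, c' w1, {w1, w2}, ?_, by simp, ?_⟩
      · intro y hy z hz h; exact absurd h (hno y hy z hz)
      · funext y
        by_cases h1 : y = w1
        · subst h1; simp [sw]
        · by_cases h2 : y = w2
          · subst h2; simp [sw, hc, hc']
          · simp [sw, h1, h2]
    | insert x S hxS ih =>
      by_cases hxw : x = w1 ∨ x = w2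
      · have : (fun y => if y ∈ insert x S ∨ y = w1 ∨ y = w2 then c' y else c y) =
            (fun y => if y ∈ S ∨ y = w1 ∨ y = w2 then c' y else c y) := by
          funext y
          have : (y ∈ insert x S ∨ y = w1 ∨ y = w2) ↔ (y ∈ S ∨ y = w1 ∨ y = w2) := by
            simp only [Finset.mem_insert]
            constructor
            · rintro ((rfl | h) | h) <;> tauto
            · tauto
          simp only [this]
        rw [this]; exact ih
      · push Not at hxw
        refine Relation.ReflTransGen.tail ih (recolor (x := x) hxw.1 hxw.2 ?_ ?_ ?_)
        · intro y hy
          simp [Finset.mem_insert, hy]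
        · intro hx; simp [hxw] at hx
        · intro hx; simp [hxw] at hx
  have := key Finset.univ
  simpa using this

lemma swap_eq_left_or {a b p : Fin k} (h : p = a ∨ p = b) : Equiv.swap a b p ≠ p ∨ a = b := by
  by_cases hab : a = b
  · exact Or.inr hab
  · left
    rcases h with rfl | rfl
    · simpa using Ne.symm hab
    · simpa using hab

lemma free_color {M : Finset V} {e : V → Fin k} {p q : V} (hp : p ∈ M) (hq : q ∈ M) (hpq : p ≠ q)
    (he : e p = e q) (hM : M.card + 1 ≤ k) (s : Fin k) : ∃ r, r ≠ s ∧ ∀ y ∈ M, e y ≠ r := by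
  by_contra hcon
  push Not at hcon
  have h1 : (Finset.univ : Finset (Fin k)) ⊆ insert s ((M.erase p).image e) := by
    intro r _
    by_cases hr : r = s
    · simp [hr]
    · obtain ⟨y, hy, hyr⟩ := hcon r hr
      apply Finset.mem_insert_of_mem
      rw [Finset.mem_image]
      by_cases hyp : y = p
      · exact ⟨q, by simp [hq, hpq.symm], by rw [← he, ← hyp, hyr]⟩
      · exact ⟨y, by simp [hy, hyp], hyr⟩
  have h2 := Finset.card_le_card h1
  have h3 := Finset.card_insert_le s ((M.erase p).image e)
  have h4 := Finset.card_image_le (s := M.erase p) (f := e)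
  have h5 := Finset.card_erase_add_one hp
  simp at h2
  omega

/-- lifting a step from `X.erase x` to `X` -/
lemma lift_step {w1 w2 : V} {X : Finset V} {x : V} (hxX : x ∈ X) (hx1 : x ≠ w1) (hx2 : x ≠ w2)
    {M : Finset V} (hMc : M.card + 1 ≤ k)
    (hM : ∀ y ∈ X, G.Adj x y → y ∈ M ∨ (y = w2 ∧ w1 ∈ M))
    {e1 e2 e1' : V → Fin k} (hs : St G w1 w2 (X.erase x) e1 e2)
    (hp : Prop' G X e1') (hal : e1' w1 = e1' w2) (hag : ∀ y, y ≠ x → e1' y = e1 y) :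
    ∃ e2', Rr G w1 w2 X e1' e2' ∧ Prop' G X e2' ∧ (∀ y, y ≠ x → e2' y = e2 y) := by
  obtain ⟨a, b, U, hU, hw, rfl⟩ := hs
  -- basic case
  have basic : ∀ e : V → Fin k, Prop' G X e → (∀ y, y ≠ x → e y = e1 y) → ∀ U' : Set V,
      (∀ y, y ≠ x → (y ∈ U' ↔ y ∈ U)) →
      (∀ y ∈ X, G.Adj x y → (e x = a ∨ e x = b) → (e y = a ∨ e y = b) → (x ∈ U' ↔ y ∈ U)) →
      ∃ e2', St G w1 w2 X e e2' ∧ Prop' G X e2' ∧ (∀ y, y ≠ x → e2' y = sw a b U e1 y) := by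
    intro e he hag' U' h1 h2
    have hclo : Clo G X e a b U' := by
      intro y hy z hz hyz hya hza hyU
      by_cases hyx : y = x
      · subst hyx
        exact (h1 z hyz.ne.symm).2 ((h2 z hz hyz hya hza).1 hyU)
      · by_cases hzx : z = x
        · subst hzx
          exact (h2 y hy hyz.symm hza hya).2 ((h1 y hyx).1 hyU)
        · rw [hag' y hyx] at hya
          rw [hag' z hzx] at hza
          exact (h1 z hzx).2 (hU y (by simp [hy, hyx]) z (by simp [hz, hzx]) hyz hya hza ((h1 y hyx).1 hyU))
    refine ⟨sw a b U' e, ⟨a, b, U', hclo, ?_, rfl⟩, sw_proper he hclo, ?_⟩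
    · rw [h1 w1 hx1.symm, h1 w2 hx2.symm, hw]
    · intro y hy
      simp only [sw, h1 y hy, hag' y hy]
  have hUx : ∀ y, y ≠ x → (y ∈ U \ {x} ↔ y ∈ U) := by intro y hy; simp [hy]
  have hUx' : ∀ y, y ≠ x → (y ∈ U ∪ {x} ↔ y ∈ U) := by intro y hy; simp [hy]
  by_cases hx : e1' x = a ∨ e1' x = b
  · by_cases hall : ∀ y ∈ X, G.Adj x y → (e1' y = a ∨ e1' y = b) → y ∈ U
    · obtain ⟨e2', h1, h2⟩ := basic e1' hp hag (U ∪ {x}) hUx' (fun y hy hxy _ hy' => by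
        simp [hall y hy hxy hy'])
      exact ⟨e2', Relation.ReflTransGen.single h1, h2⟩
    · by_cases hnone : ∀ y ∈ X, G.Adj x y → (e1' y = a ∨ e1' y = b) → y ∉ U
      · obtain ⟨e2', h1, h2⟩ := basic e1' hp hag (U \ {x}) hUx (fun y hy hxy _ hy' => by
          simp [hnone y hy hxy hy'])
        exact ⟨e2', Relation.ReflTransGen.single h1, h2⟩
      · push Not at hall hnone
        obtain ⟨q, hqX, hxq, hqab, hqU⟩ := hall
        obtain ⟨p, hpX, hxp, hpab, hpU⟩ := hnone
        have hpx := hp x hxX p hpX hxp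
        have hqx := hp x hxX q hqX hxq
        have hpq : e1' p = e1' q := by
          rcases hx with hx | hx <;> rcases hpab with h1 | h1 <;> rcases hqab with h2 | h2 <;>
            first
            | (rw [h1, h2]; done)
            | exact absurd (hx.trans h1.symm) hpx
            | exact absurd (hx.trans h2.symm) hqx
        have hrep : ∀ y ∈ X, G.Adj x y → ∃ y' ∈ M, e1' y' = e1' y ∧ (y' ∈ U ↔ y ∈ U) := by
          intro y hy hxy
          rcases hM y hy hxy with h | ⟨rfl, h⟩
          · exact ⟨y, h, rfl, Iff.rfl⟩
          · exact ⟨w1, h, hal, hw⟩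
        obtain ⟨p', hp'M, hp'e, hp'U⟩ := hrep p hpX hxp
        obtain ⟨q', hq'M, hq'e, hq'U⟩ := hrep q hqX hxq
        have hne : p' ≠ q' := by
          rintro rfl
          exact hqU (hq'U.1 (hp'U.2 hpU))
        obtain ⟨r, hr1, hr2⟩ := free_color (e := e1') hp'M hq'M hne (by rw [hp'e, hq'e, hpq]) hMc (e1' x)
        have hr3 : ∀ y ∈ X, G.Adj x y → e1' y ≠ r := by
          intro y hy hxy
          obtain ⟨y', hy', h1, _⟩ := hrep y hy hxy
          rw [← h1]; exact hr2 y' hy'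
        have hrp : e1' p ≠ r := hr3 p hpX hxp
        set e : V → Fin k := Function.update e1' x r with he
        have hex : e x = r := by simp [he]
        have hey : ∀ y, y ≠ x → e y = e1' y := fun y hy => by simp [he, hy]
        have hst : St G w1 w2 X e1' e := by
          refine recolor hx1 hx2 hey ?_ ?_
          · intro _ y hy hxy; exact (hp x hxX y hy hxy).symm
          · intro _ y hy hxy; rw [hex]; exact hr3 y hy hxy
        have hpe : Prop' G X e := by
          intro y hy z hz hyz
          by_cases hyx : y = x
          · subst hyx
            rw [hex, hey z hyz.ne.symm]; exact (hr3 z hz hyz).symm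
          · by_cases hzx : z = x
            · subst hzx
              rw [hex, hey y hyx]; exact hr3 y hy hyz.symm
            · rw [hey y hyx, hey z hzx]; exact hp y hy z hz hyz
        have hrab : ¬ (r = a ∨ r = b) := by
          rintro (h | h) <;> rcases hx with hx | hx <;> rcases hpab with h1 | h1 <;>
            first
            | exact hr1 (h.trans hx.symm)
            | exact hrp (h1.trans h.symm)
            | exact hpx (hx.trans h1.symm)
        obtain ⟨e2', h1, h2⟩ := basic e hpe (fun y hy => (hey y hy).trans (hag y hy)) (U \ {x}) hUx
          (fun y hy hxy hx' _ => absurd (hex ▸ hx') hrab)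
        exact ⟨e2', (Relation.ReflTransGen.single hst).tail h1, h2⟩
  · obtain ⟨e2', h1, h2⟩ := basic e1' hp hag (U \ {x}) hUx (fun y hy hxy h _ => absurd h hx)
    exact ⟨e2', Relation.ReflTransGen.single h1, h2⟩

end kempe
end KJ

namespace KJ
section kone
variable {G : SimpleGraph V} {k : ℕ}

/-- the standing assumptions on the graph -/
structure Gd [Fintype V] (G : SimpleGraph V) (k : ℕ) : Prop where
  four : 4 ≤ k
  reg : ∀ y, dg G Finset.univ y = k
  conn2 : ∀ p q, Conn G (Finset.univ \ {p, q})

lemma Gd.bdry [Fintype V] (h : Gd G k) {N : Finset V} (hN : N.Nonempty) {p q : V}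
    (hb : ∀ a ∈ N, ∀ b, G.Adj a b → b ∈ N ∨ b = p ∨ b = q) (z : V) : z ∈ N ∨ z = p ∨ z = q := by
  by_contra hz
  push Not at hz
  have hNT : (N \ {p, q}).Nonempty := by
    by_contra hemp
    rw [Finset.not_nonempty_iff_eq_empty, Finset.sdiff_eq_empty_iff_subset] at hemp
    obtain ⟨a, ha⟩ := hN
    have h1 := h.reg a
    have h2 : dg G Finset.univ a ≤ ({p, q} : Finset V).card := by
      refine dg_le_of ?_
      intro b _ hab
      rcases hb a ha b hab with h | h
      · exact hemp h
      · simpa using h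
    have := Finset.card_le_two (a := p) (b := q)
    have := h.four
    omega
  obtain ⟨a, ha, b, hb', hab⟩ := (h.conn2 p q).2 (N \ {p, q}) (by gcongr; simp) hNT
    ⟨z, by simp [hz]⟩
  simp only [Finset.mem_sdiff, Finset.mem_insert, Finset.mem_singleton, Finset.mem_univ, true_and] at ha hb'
  have := hb a ha.1 b hab
  tauto

lemma Rr_all [Fintype V] (hG : Gd G k) {w1 w2 v : V} (hne : w1 ≠ w2) (hna : ¬ G.Adj w1 w2)
    (hv1 : G.Adj v w1) (hv2 : G.Adj v w2) : ∀ n, ∀ X : Finset V, X.card = n → w1 ∈ X → w2 ∈ X →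
    ∀ c c' : V → Fin k, Prop' G X c → Prop' G X c' → c w1 = c w2 → c' w1 = c' w2 → Rr G w1 w2 X c c' := by
  intro n
  induction n using Nat.strong_induction_on with
  | _ n ih =>
  intro X hn h1X h2X c c' hc hc' hal hal'
  by_cases hX : X ⊆ {w1, w2}
  · have : X = {w1, w2} := by
      refine hX.antisymm ?_
      intro y hy
      simp only [Finset.mem_insert, Finset.mem_singleton] at hy
      rcases hy with rfl | rfl <;> assumption
    rw [this]
    exact Rr_base hna hal hal'
  have hfour := hG.four
  have hex : ∃ x ∈ X, x ≠ w1 ∧ x ≠ w2 ∧ ∃ M : Finset V, M.card + 1 ≤ k ∧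
      ∀ y ∈ X, G.Adj x y → y ∈ M ∨ (y = w2 ∧ w1 ∈ M) := by
    by_cases hvX : v ∈ X
    · refine ⟨v, hvX, hv1.ne, hv2.ne, (X.filter (G.Adj v)).erase w2, ?_, ?_⟩
      · rw [Finset.card_erase_add_one (by simp [h2X, hv2])]
        exact (dg_mono (Finset.subset_univ X) v).trans (hG.reg v).le
      · intro y hy hvy
        by_cases h : y = w2
        · exact Or.inr ⟨h, by simp [h1X, hv1, hne]⟩
        · exact Or.inl (by simp [h, hy, hvy])
    · obtain ⟨x0, hx0, hx0W⟩ := Finset.not_subset.1 hX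
      obtain ⟨a, ha, b, hb, hab⟩ := (hG.conn2 w1 w2).2 (X \ {w1, w2}) (by gcongr; simp)
        ⟨x0, by simp [hx0]; simpa using hx0W⟩ ⟨v, by simp [hvX, hv1.ne, hv2.ne]⟩
      simp only [Finset.mem_sdiff, Finset.mem_insert, Finset.mem_singleton, Finset.mem_univ, true_and] at ha hb
      have hbX : b ∉ X := by tauto
      refine ⟨a, ha.1, by tauto, by tauto, X.filter (G.Adj a), ?_, ?_⟩
      · have : (insert b (X.filter (G.Adj a))).card ≤ dg G Finset.univ a := by
          apply Finset.card_le_card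
          intro y hy
          simp only [Finset.mem_insert, Finset.mem_filter] at hy
          rcases hy with rfl | hy
          · simpa using hab
          · simpa using hy.2
        rw [Finset.card_insert_of_notMem (by simp [hbX]), hG.reg] at this
        exact this
      · intro y hy hay
        exact Or.inl (by simp [hy, hay])
  obtain ⟨x, hxX, hx1, hx2, M, hMc, hM⟩ := hex
  have hsub : ∀ e : V → Fin k, Prop' G X e → Prop' G (X.erase x) e := by
    intro e he y hy z hz
    exact he y (Finset.mem_of_mem_erase hy) z (Finset.mem_of_mem_erase hz)
  have hR := ih _ (by rw [← hn]; exact Finset.card_erase_lt_of_mem hxX) (X.erase x) rfl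
    (by simp [hx1.symm, h1X]) (by simp [hx2.symm, h2X]) c c' (hsub c hc) (hsub c' hc') hal hal'
  have key : ∀ e, Rr G w1 w2 (X.erase x) c e → ∃ e', Rr G w1 w2 X c e' ∧ Prop' G X e' ∧
      (∀ y, y ≠ x → e' y = e y) := by
    intro e he
    induction he with
    | refl => exact ⟨c, Relation.ReflTransGen.refl, hc, fun _ _ => rfl⟩
    | tail _ hs ih' =>
      obtain ⟨e1', h1, h2, h3⟩ := ih'
      obtain ⟨e2', h4, h5, h6⟩ := lift_step hxX hx1 hx2 hMc hM hs h2 (h1.alike hal) h3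
      exact ⟨e2', h1.trans h4, h5, h6⟩
  obtain ⟨e', h1, h2, h3⟩ := key c' hR
  refine h1.tail (recolor hx1 hx2 (fun y hy => (h3 y hy).symm) ?_ ?_)
  · intro _ y hy hxy
    exact (h2 x hxX y hy hxy).symm
  · intro _ y hy hxy
    rw [h3 y hxy.ne.symm]
    exact (hc' x hxX y hy hxy).symm

lemma kempe_of_Rr [Fintype V] {w1 w2 : V} {c c' : V → Fin k} (h : Rr G w1 w2 Finset.univ c c') :
    KempeEquiv G k c c' := by
  induction h with
  | refl => exact Relation.ReflTransGen.refl
  | tail _ hs ih =>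
    obtain ⟨a, b, U, hU, -, rfl⟩ := hs
    exact ih.trans (kempe_of_sw a b _ _ U rfl hU)

/-- eligible pair -/
def Elig (G : SimpleGraph V) (p q : V) : Prop := p ≠ q ∧ ¬ G.Adj p q ∧ ∃ v, G.Adj v p ∧ G.Adj v q

/-- all colourings alike on `p,q` are equivalent to all colourings alike on `r,s` -/
def EqP (G : SimpleGraph V) (k : ℕ) (p q r s : V) : Prop :=
  ∀ c c' : V → Fin k, IsProperColoring G k c → IsProperColoring G k c' → c p = c q → c' r = c' s →
    KempeEquiv G k c c' ∧ KempeEquiv G k c' c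

lemma EqP.symm {p q r s : V} (h : EqP G k p q r s) : EqP G k r s p q :=
  fun c c' hc hc' h1 h2 => (h c' c hc' hc h2 h1).symm

lemma Elig.self [Fintype V] (hG : Gd G k) {p q : V} (h : Elig G p q) : EqP G k p q p q := by
  obtain ⟨h1, h2, v, h3, h4⟩ := h
  intro c c' hc hc' ha ha'
  have hp : ∀ e : V → Fin k, IsProperColoring G k e → Prop' G Finset.univ e :=
    fun e he y _ z _ hyz => he hyz
  exact ⟨kempe_of_Rr (Rr_all hG h1 h2 h3 h4 _ _ rfl (by simp) (by simp) c c' (hp c hc) (hp c' hc') ha ha'),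
    kempe_of_Rr (Rr_all hG h1 h2 h3 h4 _ _ rfl (by simp) (by simp) c' c (hp c' hc') (hp c hc) ha' ha)⟩

lemma EqP.trans {p q r s m n : V} (h1 : EqP G k p q m n) (h2 : EqP G k m n r s) {e : V → Fin k}
    (he : IsProperColoring G k e) (hee : e m = e n) : EqP G k p q r s := by
  intro c c' hc hc' ha ha'
  obtain ⟨a1, a2⟩ := h1 c e hc he ha hee
  obtain ⟨b1, b2⟩ := h2 e c' he hc' hee ha'
  exact ⟨a1.trans b1, b2.trans a2⟩

lemma EqP.of_common [Fintype V] (hG : Gd G k) {p q r s : V} (h1 : Elig G p q) (h2 : Elig G r s)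
    {e : V → Fin k} (he : IsProperColoring G k e) (hp : e p = e q) (hr : e r = e s) : EqP G k p q r s := by
  intro c c' hc hc' ha ha'
  obtain ⟨a1, a2⟩ := h1.self hG c e hc he ha hp
  obtain ⟨b1, b2⟩ := h2.self hG e c' he hc' hr ha'
  exact ⟨a1.trans b1, b2.trans a2⟩

/-- available colours after precolouring `X` by `p` -/
noncomputable def av (G : SimpleGraph V) (X : Finset V) (p : V → Fin k) (y : V) : Finset (Fin k) :=
  Finset.univ.filter (fun c => ∀ x ∈ X, G.Adj y x → p x ≠ c)

lemma extend [Fintype V] (X : Finset V) (p : V → Fin k) (hp : Prop' G X p)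
    (h : Col G (Finset.univ \ X) (av G X p)) :
    ∃ c : V → Fin k, IsProperColoring G k c ∧ ∀ x ∈ X, c x = p x := by
  obtain ⟨f, h1, h2⟩ := h
  have key : ∀ y, y ∉ X → ∀ x ∈ X, G.Adj y x → p x ≠ f y := by
    intro y hy x hx hyx
    have := h1 y (by simp [hy])
    simp only [av, Finset.mem_filter] at this
    exact this.2 x hx hyx
  refine ⟨fun y => if y ∈ X then p y else f y, ?_, fun x hx => by simp [hx]⟩
  intro y z hyz
  by_cases hy : y ∈ X <;> by_cases hz : z ∈ X <;> simp only [hy, hz, if_true, if_false]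
  · exact hp y hy z hz hyz
  · exact key z hz y hy hyz.symm
  · exact (key y hy z hz hyz).symm
  · exact h2 y (by simp [hy]) z (by simp [hz]) hyz

/-- number of colours lost at `y` is at most the number of neighbours in `X` -/
lemma av_card (X : Finset V) (p : V → Fin k) (y : V) :
    k = (av G X p y).card + ((X.filter (G.Adj y)).image p).card := by
  have h := Finset.card_add_card_compl (av G X p y)
  simp only [Fintype.card_fin] at h
  have h2 : (av G X p y)ᶜ = (X.filter (G.Adj y)).image p := ?_
  · rw [h2] at h; exact h.symm
  ext c
  simp only [av, Finset.mem_compl, Finset.mem_filter, Finset.mem_univ, true_and, Finset.mem_image]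
  push Not
  constructor
  · rintro ⟨x, a, b, c⟩; exact ⟨x, ⟨a, b⟩, c⟩
  · rintro ⟨x, ⟨a, b⟩, c⟩; exact ⟨x, a, b, c⟩

lemma av_deg [Fintype V] (hG : Gd G k) {X E : Finset V} (hE : Disjoint E X) (p : V → Fin k) (y : V) :
    dg G E y ≤ (av G X p y).card := by
  have h1 := av_card (G := G) X p y
  have h2 := Finset.card_image_le (s := X.filter (G.Adj y)) (f := p)
  have h3 := hG.reg y
  have h4 := dg_mono (G := G) (Finset.subset_univ (E ∪ X)) y
  rw [dg_union hE] at h4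
  have hX : (X.filter (G.Adj y)).card = dg G X y := rfl
  omega

lemma av_slack [Fintype V] (hG : Gd G k) {X E : Finset V} (hE : Disjoint E X) (p : V → Fin k) {y a b : V}
    (ha : a ∈ X) (hb : b ∈ X) (hya : G.Adj y a) (hyb : G.Adj y b) (hab : a ≠ b) (hp : p a = p b) :
    dg G E y < (av G X p y).card := by
  have h1 := av_card (G := G) X p y
  have h2 : ((X.filter (G.Adj y)).image p).card < (X.filter (G.Adj y)).card := by
    refine lt_of_le_of_ne Finset.card_image_le (fun h => hab ?_)
    exact Finset.card_image_iff.1 h (by simp [ha, hya]) (by simp [hb, hyb]) hp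
  have h3 := hG.reg y
  have h4 := dg_mono (G := G) (Finset.subset_univ (E ∪ X)) y
  rw [dg_union hE] at h4
  have hX : (X.filter (G.Adj y)).card = dg G X y := rfl
  omega

lemma exists_alike [Fintype V] (hG : Gd G k) {p q : V} (h : Elig G p q) (α : Fin k) :
    ∃ c : V → Fin k, IsProperColoring G k c ∧ c p = α ∧ c q = α := by
  obtain ⟨h1, h2, v, h3, h4⟩ := h
  have hk : 0 < k := by have := hG.four; omega
  obtain ⟨c, hc, hc'⟩ := extend (G := G) {p, q} (fun _ => α) (by
    intro y hy z hz hyz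
    simp only [Finset.mem_insert, Finset.mem_singleton] at hy hz
    exfalso
    rcases hy with rfl | rfl <;> rcases hz with rfl | rfl
    · exact G.loopless.irrefl _ hyz
    · exact h2 hyz
    · exact h2 hyz.symm
    · exact G.loopless.irrefl _ hyz)
    (greedy' hk (hG.conn2 p q) (fun y _ => av_deg hG Finset.sdiff_disjoint _ y) (y := v)
      (by simp [h3.ne, h4.ne]) (av_slack hG Finset.sdiff_disjoint _ (a := p) (b := q)
        (by simp) (by simp) h3 h4 h1 rfl))
  exact ⟨c, hc, hc' p (by simp), hc' q (by simp)⟩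

end kone
end KJ

namespace KJ
section cfgs
variable {G : SimpleGraph V} {k : ℕ}

/-- `y` is adjacent to `p` or `q` -/
def aw (G : SimpleGraph V) (p q y : V) : Prop := G.Adj y p ∨ G.Adj y q

/-- the lists after colouring `w1,w2` with `α` and `t1,t2` with `β` -/
noncomputable def lst (G : SimpleGraph V) (w1 w2 t1 t2 : V) (α β : Fin k) (y : V) : Finset (Fin k) :=
  Finset.univ.filter (fun c => ¬ (c = α ∧ aw G w1 w2 y) ∧ ¬ (c = β ∧ aw G t1 t2 y))

/-- closedness outside the four special vertices -/
structure Cl (G : SimpleGraph V) (w1 w2 t1 t2 : V) (Z : Finset V) : Prop where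
  nw1 : w1 ∉ Z
  nw2 : w2 ∉ Z
  nt1 : t1 ∉ Z
  nt2 : t2 ∉ Z
  clo : ∀ a ∈ Z, ∀ b, G.Adj a b → b ∈ Z ∨ b = w1 ∨ b = w2 ∨ b = t1 ∨ b = t2

/-- the bad pieces -/
structure BP (G : SimpleGraph V) (w1 w2 t1 t2 : V) (α β : Fin k) (D : Finset V) : Prop where
  cl : Cl G w1 w2 t1 t2 D
  bad : Bad G D (lst G w1 w2 t1 t2 α β)

/-- the configuration under study -/
structure Cfg [Fintype V] (G : SimpleGraph V) (k : ℕ) (w1 w2 v t1 t2 u : V) (α β : Fin k) : Prop where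
  gd : Gd G k
  wne : w1 ≠ w2
  wna : ¬ G.Adj w1 w2
  vw1 : G.Adj v w1
  vw2 : G.Adj v w2
  tne : t1 ≠ t2
  tna : ¬ G.Adj t1 t2
  ut1 : G.Adj u t1
  ut2 : G.Adj u t2
  d11 : w1 ≠ t1
  d12 : w1 ≠ t2
  d21 : w2 ≠ t1
  d22 : w2 ≠ t2
  uv : u ≠ v
  ab : α ≠ β
  neq : ¬ EqP G k w1 w2 t1 t2

variable {w1 w2 v t1 t2 u : V} {α β : Fin k}

lemma aw_comm {p q y : V} : aw G p q y ↔ aw G q p y := or_comm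

lemma lst_swap : lst G w1 w2 t1 t2 α β = lst G t1 t2 w1 w2 β α := by
  funext y; unfold lst; congr 1; funext c; rw [and_comm]

lemma lst_flipW : lst G w1 w2 t1 t2 α β = lst G w2 w1 t1 t2 α β := by
  funext y; unfold lst; congr 1; funext c; rw [aw_comm (p := w1)]

lemma Cl.swap {Z : Finset V} (h : Cl G w1 w2 t1 t2 Z) : Cl G t1 t2 w1 w2 Z :=
  ⟨h.nt1, h.nt2, h.nw1, h.nw2, fun a ha b hab => by have := h.clo a ha b hab; tauto⟩

lemma Cl.flipW {Z : Finset V} (h : Cl G w1 w2 t1 t2 Z) : Cl G w2 w1 t1 t2 Z :=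
  ⟨h.nw2, h.nw1, h.nt1, h.nt2, fun a ha b hab => by have := h.clo a ha b hab; tauto⟩

lemma BP.swap {D : Finset V} (h : BP G w1 w2 t1 t2 α β D) : BP G t1 t2 w1 w2 β α D :=
  ⟨h.cl.swap, by rw [← lst_swap]; exact h.bad⟩

lemma BP.flipW {D : Finset V} (h : BP G w1 w2 t1 t2 α β D) : BP G w2 w1 t1 t2 α β D :=
  ⟨h.cl.flipW, by rw [← lst_flipW]; exact h.bad⟩

lemma EqP.flip {p q r s : V} (h : EqP G k p q r s) : EqP G k q p r s :=
  fun c c' hc hc' h1 h2 => h c c' hc hc' h1.symm h2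

lemma Cfg.swap [Fintype V] (c : Cfg G k w1 w2 v t1 t2 u α β) : Cfg G k t1 t2 u w1 w2 v β α :=
  ⟨c.gd, c.tne, c.tna, c.ut1, c.ut2, c.wne, c.wna, c.vw1, c.vw2, c.d11.symm, c.d21.symm, c.d12.symm,
    c.d22.symm, c.uv.symm, c.ab.symm, fun h => c.neq h.symm⟩

lemma Cfg.flipW [Fintype V] (c : Cfg G k w1 w2 v t1 t2 u α β) : Cfg G k w2 w1 v t1 t2 u α β :=
  ⟨c.gd, c.wne.symm, fun h => c.wna h.symm, c.vw2, c.vw1, c.tne, c.tna, c.ut1, c.ut2, c.d21, c.d22,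
    c.d11, c.d12, c.uv, c.ab, fun h => c.neq h.flip⟩

lemma Cfg.flipT [Fintype V] (c : Cfg G k w1 w2 v t1 t2 u α β) : Cfg G k w1 w2 v t2 t1 u α β :=
  c.swap.flipW.swap

lemma BP.flipT {D : Finset V} (h : BP G w1 w2 t1 t2 α β D) : BP G w1 w2 t2 t1 α β D :=
  h.swap.flipW.swap

lemma Cl.flipT {D : Finset V} (h : Cl G w1 w2 t1 t2 D) : Cl G w1 w2 t2 t1 D :=
  h.swap.flipW.swap

lemma Cfg.hk [Fintype V] (c : Cfg G k w1 w2 v t1 t2 u α β) : 0 < k := by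
  have := c.gd.four; omega

lemma Cfg.eligW [Fintype V] (c : Cfg G k w1 w2 v t1 t2 u α β) : Elig G w1 w2 :=
  ⟨c.wne, c.wna, v, c.vw1, c.vw2⟩

lemma Cfg.eligT [Fintype V] (c : Cfg G k w1 w2 v t1 t2 u α β) : Elig G t1 t2 := c.swap.eligW

lemma dg_insert {Y : Finset V} {x : V} (hx : x ∉ Y) (y : V) :
    dg G (insert x Y) y = dg G Y y + (if G.Adj y x then 1 else 0) := by
  have := dg_erase (G := G) (y := y) (Finset.mem_insert_self x Y)
  rw [Finset.erase_insert hx] at this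
  exact this.symm

lemma Cfg.cnt [Fintype V] (c : Cfg G k w1 w2 v t1 t2 u α β) {Z : Finset V} (hZ : Cl G w1 w2 t1 t2 Z)
    {y : V} (hy : y ∈ Z) : dg G Z y + (if G.Adj y w1 then 1 else 0) + (if G.Adj y w2 then 1 else 0) +
      (if G.Adj y t1 then 1 else 0) + (if G.Adj y t2 then 1 else 0) = k := by
  rw [← dg_insert hZ.nw1, ← dg_insert (by simp [hZ.nw2, c.wne.symm]),
    ← dg_insert (by simp [hZ.nt1, c.d11.symm, c.d21.symm]),
    ← dg_insert (by simp [hZ.nt2, c.d12.symm, c.d22.symm, c.tne.symm]), ← c.gd.reg y]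
  apply dg_congr
  intro b hb
  have := hZ.clo y hy b hb
  simp only [Finset.mem_insert, Finset.mem_univ, iff_true]
  tauto

lemma lst_card (hab : α ≠ β) (y : V) : (lst G w1 w2 t1 t2 α β y).card + (if aw G w1 w2 y then 1 else 0) +
    (if aw G t1 t2 y then 1 else 0) = k := by
  have hα := Finset.card_erase_add_one (Finset.mem_univ α)
  have hβ := Finset.card_erase_add_one (Finset.mem_univ β)
  have hαβ := Finset.card_erase_add_one (a := β) (s := Finset.univ.erase α) (by simp [hab.symm])
  simp only [Finset.card_univ, Fintype.card_fin] at hα hβ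
  by_cases h1 : aw G w1 w2 y <;> by_cases h2 : aw G t1 t2 y <;> simp only [h1, h2, if_true, if_false]
  · rw [show lst G w1 w2 t1 t2 α β y = (Finset.univ.erase α).erase β by
      ext c; simp [lst, h1, h2]; tauto]
    omega
  · rw [show lst G w1 w2 t1 t2 α β y = (Finset.univ.erase α) by ext c; simp [lst, h1, h2]]
    omega
  · rw [show lst G w1 w2 t1 t2 α β y = (Finset.univ.erase β) by ext c; simp [lst, h1, h2]]
    omega
  · rw [show lst G w1 w2 t1 t2 α β y = Finset.univ by ext c; simp [lst, h1, h2]]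
    simp

lemma mem_lst {y : V} {γ : Fin k} : γ ∈ lst G w1 w2 t1 t2 α β y ↔
    ¬ (γ = α ∧ aw G w1 w2 y) ∧ ¬ (γ = β ∧ aw G t1 t2 y) := by simp [lst]

lemma Cfg.mem_a [Fintype V] (c : Cfg G k w1 w2 v t1 t2 u α β) {y : V} :
    α ∈ lst G w1 w2 t1 t2 α β y ↔ ¬ aw G w1 w2 y := by
  rw [mem_lst]; have := c.ab; tauto

lemma Cfg.mem_b [Fintype V] (c : Cfg G k w1 w2 v t1 t2 u α β) {y : V} :
    β ∈ lst G w1 w2 t1 t2 α β y ↔ ¬ aw G t1 t2 y := by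
  rw [mem_lst]; have := c.ab.symm; tauto

lemma Cfg.deg_le [Fintype V] (c : Cfg G k w1 w2 v t1 t2 u α β) {Z : Finset V} (hZ : Cl G w1 w2 t1 t2 Z)
    {y : V} (hy : y ∈ Z) : dg G Z y ≤ (lst G w1 w2 t1 t2 α β y).card := by
  have h1 := c.cnt hZ hy
  have h2 := lst_card (G := G) (w1 := w1) (w2 := w2) (t1 := t1) (t2 := t2) c.ab y
  unfold aw at h2
  split_ifs at h1 h2 <;> first | omega | tauto

lemma Cfg.one [Fintype V] (c : Cfg G k w1 w2 v t1 t2 u α β) {D : Finset V} (hD : BP G w1 w2 t1 t2 α β D)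
    {y : V} (hy : y ∈ D) : ¬ (G.Adj y w1 ∧ G.Adj y w2) ∧ ¬ (G.Adj y t1 ∧ G.Adj y t2) := by
  have h1 := c.cnt hD.cl hy
  have h2 := lst_card (G := G) (w1 := w1) (w2 := w2) (t1 := t1) (t2 := t2) c.ab y
  have h3 := hD.bad.eq c.hk y hy
  unfold aw at h2
  split_ifs at h1 h2 <;> first | omega | tauto

lemma Cfg.vD [Fintype V] (c : Cfg G k w1 w2 v t1 t2 u α β) {D : Finset V} (hD : BP G w1 w2 t1 t2 α β D) :
    v ∉ D := fun h => (c.one hD h).1 ⟨c.vw1, c.vw2⟩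

lemma Cfg.uD [Fintype V] (c : Cfg G k w1 w2 v t1 t2 u α β) {D : Finset V} (hD : BP G w1 w2 t1 t2 α β D) :
    u ∉ D := c.swap.vD hD.swap

/-- a piece closed off the four special vertices which is not colourable is bad -/
lemma Cfg.mkBP [Fintype V] (c : Cfg G k w1 w2 v t1 t2 u α β) {E : Finset V} (hE : Conn G E)
    (hcl : Cl G w1 w2 t1 t2 E) (hn : ¬ Col G E (lst G w1 w2 t1 t2 α β)) : BP G w1 w2 t1 t2 α β E :=
  ⟨hcl, hE, fun _ hy => c.deg_le hcl hy, hn⟩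

lemma cl_of_closedIn [Fintype V] {E : Finset V}
    (h : ClosedIn G E (Finset.univ \ {w1, w2, t1, t2})) : Cl G w1 w2 t1 t2 E := by
  have hh : ∀ x ∈ E, ¬ (x = w1 ∨ x = w2 ∨ x = t1 ∨ x = t2) := by
    intro x hx
    have := h.1 hx
    simpa using this
  refine ⟨fun hx => hh _ hx (by simp), fun hx => hh _ hx (by simp), fun hx => hh _ hx (by simp),
    fun hx => hh _ hx (by simp), ?_⟩
  intro a ha b hab
  by_cases hb : b = w1 ∨ b = w2 ∨ b = t1 ∨ b = t2
  · exact Or.inr hb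
  · exact Or.inl (h.2 a ha b (by simpa using hb) hab)

lemma Cfg.exists_BP [Fintype V] (c : Cfg G k w1 w2 v t1 t2 u α β) : ∃ D, BP G w1 w2 t1 t2 α β D := by
  by_contra hcon
  push Not at hcon
  have hcol : Col G (Finset.univ \ {w1, w2, t1, t2}) (lst G w1 w2 t1 t2 α β) := by
    refine col_of_pieces _ c.hk _ _ rfl ?_
    intro E hE hc
    by_contra hn
    exact hcon E (c.mkBP hE (cl_of_closedIn hc) hn)
  set p : V → Fin k := fun x => if x = w1 ∨ x = w2 then α else β with hp
  have p1 : p w1 = α := by simp [hp]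
  have p2 : p w2 = α := by simp [hp]
  have p3 : p t1 = β := by simp [hp, c.d11.symm, c.d21.symm]
  have p4 : p t2 = β := by simp [hp, c.d12.symm, c.d22.symm]
  obtain ⟨e, he, hee⟩ := extend (G := G) {w1, w2, t1, t2} p (by
    intro y hy z hz hyz
    simp only [Finset.mem_insert, Finset.mem_singleton] at hy hz
    have := c.ab
    have := c.ab.symm
    have := c.wna
    have := c.tna
    rcases hy with rfl | rfl | rfl | rfl <;> rcases hz with rfl | rfl | rfl | rfl <;>
      first
      | exact absurd hyz (G.loopless.irrefl _)
      | exact absurd hyz ‹_›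
      | exact absurd hyz.symm ‹_›
      | (simp only [p1, p2, p3, p4]; assumption)) (hcol.mono (by
      intro y hy γ hγ
      rw [mem_lst] at hγ
      simp only [av, Finset.mem_filter, Finset.mem_univ, true_and]
      intro x hx hyx
      simp only [Finset.mem_insert, Finset.mem_singleton] at hx
      unfold aw at hγ
      rcases hx with rfl | rfl | rfl | rfl
      · rw [p1]; rintro rfl; tauto
      · rw [p2]; rintro rfl; tauto
      · rw [p3]; rintro rfl; tauto
      · rw [p4]; rintro rfl; tauto))
  refine c.neq (EqP.of_common c.gd c.eligW c.eligT he ?_ ?_)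
  · rw [hee w1 (by simp), hee w2 (by simp), p1, p2]
  · rw [hee t1 (by simp), hee t2 (by simp), p3, p4]

lemma out_le [Fintype V] (hG : Gd G k) {D S : Finset V} {x : V} (hS : ∀ s ∈ S, G.Adj x s ∧ s ∉ D) :
    dg G D x + S.card ≤ k := by
  have h : dg G S x = S.card := by
    unfold dg; rw [Finset.filter_true_of_mem (fun s hs => (hS s hs).1)]
  have hd : Disjoint D S := Finset.disjoint_right.2 (fun s hs => (hS s hs).2)
  rw [← h, ← dg_union hd, ← hG.reg x]
  exact dg_mono (Finset.subset_univ _) x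

lemma out_eq [Fintype V] (hG : Gd G k) {D S : Finset V} {x : V} (hS : ∀ s ∈ S, G.Adj x s ∧ s ∉ D)
    (hk : k ≤ dg G D x + S.card) : ∀ b, G.Adj x b → b ∈ D ∨ b ∈ S := by
  intro b hb
  by_contra hcon
  push Not at hcon
  have := out_le hG (D := D) (S := insert b S) (x := x) (by
    intro s hs
    rcases Finset.mem_insert.1 hs with rfl | h
    · exact ⟨hb, hcon.1⟩
    · exact hS s h)
  rw [Finset.card_insert_of_notMem hcon.2] at this
  omega

/-- total number of edges to the four special vertices -/
noncomputable def mm (G : SimpleGraph V) (w1 w2 t1 t2 : V) (Z : Finset V) : ℕ :=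
  dg G Z w1 + dg G Z w2 + dg G Z t1 + dg G Z t2

lemma deg_three [Fintype V] (hG : Gd G k) {x p q r : V} (h : ∀ b, G.Adj x b → b = p ∨ b = q ∨ b = r) : False := by
  have h1 := hG.reg x
  have h2 : dg G Finset.univ x ≤ ({p, q, r} : Finset V).card :=
    dg_le_of (fun b _ hb => by simpa using h b hb)
  have := Finset.card_le_three (a := p) (b := q) (c := r)
  have := hG.four
  omega

lemma Cfg.beta1 [Fintype V] (c : Cfg G k w1 w2 v t1 t2 u α β) {Z : Finset V} (hZ : Cl G w1 w2 t1 t2 Z)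
    (hu : u ∉ Z) (hv : v ∉ Z) : mm G w1 w2 t1 t2 Z + 5 ≤ 4 * k := by
  by_contra hcon
  have hS1 : ∀ s ∈ ({v} : Finset V), G.Adj w1 s ∧ s ∉ Z := by simp [c.vw1.symm, hv]
  have hS2 : ∀ s ∈ ({v} : Finset V), G.Adj w2 s ∧ s ∉ Z := by simp [c.vw2.symm, hv]
  have hS3 : ∀ s ∈ ({u} : Finset V), G.Adj t1 s ∧ s ∉ Z := by simp [c.ut1.symm, hu]
  have hS4 : ∀ s ∈ ({u} : Finset V), G.Adj t2 s ∧ s ∉ Z := by simp [c.ut2.symm, hu]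
  have a1 := out_le c.gd hS1
  have a2 := out_le c.gd hS2
  have a3 := out_le c.gd hS3
  have a4 := out_le c.gd hS4
  unfold mm at hcon
  simp only [Finset.card_singleton] at a1 a2 a3 a4
  have b1 := out_eq c.gd hS1 (by simp; omega)
  have b2 := out_eq c.gd hS2 (by simp; omega)
  have b3 := out_eq c.gd hS3 (by simp; omega)
  have b4 := out_eq c.gd hS4 (by simp; omega)
  simp only [Finset.mem_singleton] at b1 b2 b3 b4
  have hall : ∀ z, z ∈ insert w1 (insert w2 (insert t1 (insert t2 Z))) ∨ z = u ∨ z = v := by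
    refine c.gd.bdry ⟨w1, by simp⟩ ?_
    intro a ha b hab
    simp only [Finset.mem_insert] at ha ⊢
    rcases ha with rfl | rfl | rfl | rfl | ha
    · have := b1 b hab; tauto
    · have := b2 b hab; tauto
    · have := b3 b hab; tauto
    · have := b4 b hab; tauto
    · have := hZ.clo a ha b hab; tauto
  have huw1 : u ≠ w1 := by
    rintro rfl
    have e1 := b1 t1 c.ut1
    have e2 := b1 t2 c.ut2
    rcases e1 with e1 | e1
    · exact hZ.nt1 e1
    rcases e2 with e2 | e2
    · exact hZ.nt2 e2
    exact c.tne (e1.trans e2.symm)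
  have huw2 : u ≠ w2 := by
    rintro rfl
    have e1 := b2 t1 c.ut1
    have e2 := b2 t2 c.ut2
    rcases e1 with e1 | e1
    · exact hZ.nt1 e1
    rcases e2 with e2 | e2
    · exact hZ.nt2 e2
    exact c.tne (e1.trans e2.symm)
  have h1 := c.ut1.ne
  have h2 := c.ut2.ne
  refine deg_three c.gd (x := u) (p := t1) (q := t2) (r := v) ?_
  intro b hub
  have hbu := hub.ne.symm
  have hbZ : b ∉ Z := fun hb => by
    have := hZ.clo b hb u hub.symm
    tauto
  have hbw1 : b ≠ w1 := by
    rintro rfl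
    have := b1 u hub.symm
    have := c.uv
    tauto
  have hbw2 : b ≠ w2 := by
    rintro rfl
    have := b2 u hub.symm
    have := c.uv
    tauto
  have := hall b
  simp only [Finset.mem_insert] at this
  tauto

/-- a closed set sees at least three of the special vertices -/
lemma Cfg.three_bd [Fintype V] (c : Cfg G k w1 w2 v t1 t2 u α β) {Z : Finset V} (hZ : Cl G w1 w2 t1 t2 Z)
    (hne : Z.Nonempty) : 3 ≤ mm G w1 w2 t1 t2 Z := by
  have key : ∀ p q : V, ¬ (∀ a ∈ Z, ∀ b, G.Adj a b → b ∈ Z ∨ b = p ∨ b = q) := by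
    intro p q h
    have a1 := c.gd.bdry hne h w1
    have a2 := c.gd.bdry hne h w2
    have a3 := c.gd.bdry hne h t1
    have a4 := c.gd.bdry hne h t2
    have n1 := hZ.nw1
    have n2 := hZ.nw2
    have n3 := hZ.nt1
    have n4 := hZ.nt2
    have m1 := c.wne
    have m2 := c.tne
    have m3 := c.d11
    have m4 := c.d12
    have m5 := c.d21
    have m6 := c.d22
    simp only [n1, n2, n3, n4, false_or] at a1 a2 a3 a4
    rcases a1 with rfl | rfl <;> rcases a2 with h2 | h2 <;> rcases a3 with h3 | h3 <;>
      rcases a4 with h4 | h4 <;> simp_all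
  have hz : ∀ x, dg G Z x = 0 → ∀ a ∈ Z, ¬ G.Adj a x := by
    intro x hx a ha hax
    have := dg_pos ha hax.symm
    omega
  by_contra hcon
  unfold mm at hcon
  have hcases : (dg G Z w1 = 0 ∧ dg G Z w2 = 0) ∨ (dg G Z w1 = 0 ∧ dg G Z t1 = 0) ∨
    (dg G Z w1 = 0 ∧ dg G Z t2 = 0) ∨ (dg G Z w2 = 0 ∧ dg G Z t1 = 0) ∨
    (dg G Z w2 = 0 ∧ dg G Z t2 = 0) ∨ (dg G Z t1 = 0 ∧ dg G Z t2 = 0) := by omega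
  rcases hcases with ⟨h1, h2⟩ | ⟨h1, h2⟩ | ⟨h1, h2⟩ | ⟨h1, h2⟩ | ⟨h1, h2⟩ | ⟨h1, h2⟩
  · refine key t1 t2 (fun a ha b hab => ?_)
    rcases hZ.clo a ha b hab with h | rfl | rfl | rfl | rfl <;>
      tauto
  · refine key w2 t2 (fun a ha b hab => ?_)
    rcases hZ.clo a ha b hab with h | rfl | rfl | rfl | rfl <;>
      tauto
  · refine key w2 t1 (fun a ha b hab => ?_)
    rcases hZ.clo a ha b hab with h | rfl | rfl | rfl | rfl <;>
      tauto
  · refine key w1 t2 (fun a ha b hab => ?_)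
    rcases hZ.clo a ha b hab with h | rfl | rfl | rfl | rfl <;>
      tauto
  · refine key w1 t1 (fun a ha b hab => ?_)
    rcases hZ.clo a ha b hab with h | rfl | rfl | rfl | rfl <;>
      tauto
  · refine key w1 w2 (fun a ha b hab => ?_)
    rcases hZ.clo a ha b hab with h | rfl | rfl | rfl | rfl <;>
      tauto

lemma mm_union {A B : Finset V} (h : Disjoint A B) :
    mm G w1 w2 t1 t2 (A ∪ B) = mm G w1 w2 t1 t2 A + mm G w1 w2 t1 t2 B := by
  unfold mm; simp only [dg_union h]; ring

lemma mm_swap (Z : Finset V) : mm G w1 w2 t1 t2 Z = mm G t1 t2 w1 w2 Z := by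
  unfold mm; ring

lemma Cl.union {A B : Finset V} (hA : Cl G w1 w2 t1 t2 A) (hB : Cl G w1 w2 t1 t2 B) :
    Cl G w1 w2 t1 t2 (A ∪ B) := by
  refine ⟨by simp [hA.nw1, hB.nw1], by simp [hA.nw2, hB.nw2], by simp [hA.nt1, hB.nt1],
    by simp [hA.nt2, hB.nt2], ?_⟩
  intro a ha b hab
  rcases Finset.mem_union.1 ha with h | h
  · have := hA.clo a h b hab
    simp only [Finset.mem_union]; tauto
  · have := hB.clo a h b hab
    simp only [Finset.mem_union]; tauto

/-- two closed connected sets are equal or disjoint -/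
lemma Cl.eq_or_disjoint {A B : Finset V} (hA : Cl G w1 w2 t1 t2 A) (hB : Cl G w1 w2 t1 t2 B)
    (hAc : Conn G A) (hBc : Conn G B) : A = B ∨ Disjoint A B := by
  by_cases hd : Disjoint A B
  · exact Or.inr hd
  left
  obtain ⟨e, heA, heB⟩ := Finset.not_disjoint_iff.1 hd
  have key : ∀ {A B : Finset V}, Cl G w1 w2 t1 t2 A → Cl G w1 w2 t1 t2 B → Conn G A → e ∈ A → e ∈ B → A ⊆ B := by
    intro A B hA hB hAc heA heB
    refine conn_sub_closed (Y := A ∪ B) hAc Finset.subset_union_left ⟨Finset.subset_union_right, ?_⟩ heB heA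
    intro a ha b hb hab
    rcases hB.clo a ha b hab with h | rfl | rfl | rfl | rfl
    · exact h
    · simp [hA.nw1, hB.nw1] at hb
    · simp [hA.nw2, hB.nw2] at hb
    · simp [hA.nt1, hB.nt1] at hb
    · simp [hA.nt2, hB.nt2] at hb
  exact (key hA hB hAc heA heB).antisymm (key hB hA hBc heB heA)

end cfgs
end KJ

namespace KJ
section counts
variable {G : SimpleGraph V} {k : ℕ}
variable {w1 w2 v t1 t2 u : V} {α β : Fin k}

noncomputable def cA (G : SimpleGraph V) (p q : V) (N : Finset V) : ℕ := (N.filter (fun y => aw G p q y)).card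

lemma cA_mono {p q : V} {A B : Finset V} (h : A ⊆ B) : cA G p q A ≤ cA G p q B :=
  Finset.card_le_card (Finset.filter_subset_filter _ h)

lemma cA_union {p q : V} {A B : Finset V} (h : Disjoint A B) :
    cA G p q (A ∪ B) = cA G p q A + cA G p q B := by
  unfold cA
  rw [Finset.filter_union, Finset.card_union_of_disjoint (Finset.disjoint_filter_filter h)]

lemma cA_all {p q : V} {A : Finset V} (h : ∀ y ∈ A, aw G p q y) : cA G p q A = A.card := by
  unfold cA; rw [Finset.filter_true_of_mem h]

lemma cA_singleton {p q x : V} : cA G p q {x} = if aw G p q x then 1 else 0 := by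
  unfold cA
  rw [Finset.filter_singleton]; split_ifs <;> rfl

lemma Cfg.cA_eq [Fintype V] (c : Cfg G k w1 w2 v t1 t2 u α β) {D : Finset V} (hD : BP G w1 w2 t1 t2 α β D) :
    dg G D w1 + dg G D w2 = cA G w1 w2 D := by
  unfold dg cA
  rw [← Finset.card_union_of_disjoint]
  · congr 1
    ext y
    rw [Finset.mem_union, Finset.mem_filter, Finset.mem_filter, Finset.mem_filter, G.adj_comm w1, G.adj_comm w2]
    exact (and_or_left (a := y ∈ D)).symm
  · rw [Finset.disjoint_left]
    intro y hy hy'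
    simp only [Finset.mem_filter] at hy hy'
    exact (c.one hD hy.1).1 ⟨hy.2.symm, hy'.2.symm⟩

lemma Cfg.mm_eq [Fintype V] (c : Cfg G k w1 w2 v t1 t2 u α β) {D : Finset V} (hD : BP G w1 w2 t1 t2 α β D) :
    mm G w1 w2 t1 t2 D = cA G w1 w2 D + cA G t1 t2 D := by
  rw [← c.cA_eq hD, ← c.swap.cA_eq hD.swap]; unfold mm; ring

lemma Cfg.one_lt [Fintype V] (c : Cfg G k w1 w2 v t1 t2 u α β) {D : Finset V} (hD : BP G w1 w2 t1 t2 α β D) :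
    1 < D.card := by
  obtain ⟨y, hy⟩ := hD.bad.conn.1
  have h1 := hD.bad.eq c.hk y hy
  have h2 := dg_le_card (G := G) D y
  have h3 := lst_card (G := G) (w1 := w1) (w2 := w2) (t1 := t1) (t2 := t2) c.ab y
  have := c.gd.four
  split_ifs at h3 <;> omega

lemma Cfg.aw_of_eq [Fintype V] (c : Cfg G k w1 w2 v t1 t2 u α β) {y z : V}
    (h : lst G w1 w2 t1 t2 α β y = lst G w1 w2 t1 t2 α β z) :
    (aw G w1 w2 y ↔ aw G w1 w2 z) ∧ (aw G t1 t2 y ↔ aw G t1 t2 z) := by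
  refine ⟨?_, ?_⟩
  · have h1 := c.mem_a (y := y)
    have h2 := c.mem_a (y := z)
    rw [h] at h1
    exact not_iff_not.1 (h1.symm.trans h2)
  · have h1 := c.mem_b (y := y)
    have h2 := c.mem_b (y := z)
    rw [h] at h1
    exact not_iff_not.1 (h1.symm.trans h2)

lemma Cfg.leaf_const [Fintype V] (c : Cfg G k w1 w2 v t1 t2 u α β) {D : Finset V} (hD : BP G w1 w2 t1 t2 α β D)
    {x : V} {N : Finset V} (hl : Leaf G D x N) {y z : V} (hy : y ∈ N) (hz : z ∈ N) :
    (aw G w1 w2 y ↔ aw G w1 w2 z) ∧ (aw G t1 t2 y ↔ aw G t1 t2 z) :=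
  c.aw_of_eq (hl.const c.hk hD.bad y hy z hz)

/-- a subset of a bad piece hanging on two vertices has a special neighbour -/
lemma Cfg.hang [Fintype V] (c : Cfg G k w1 w2 v t1 t2 u α β) {D : Finset V} (hD : BP G w1 w2 t1 t2 α β D)
    {x x' : V} {N : Finset V} (hx : x ∈ D) (hx' : x' ∈ D) (hN : N ⊆ D) (hne : N.Nonempty)
    (hs : ∀ a ∈ N, ∀ b ∈ D, G.Adj a b → b ∈ N ∨ b = x ∨ b = x') :
    ∃ y ∈ N, aw G w1 w2 y ∨ aw G t1 t2 y := by
  by_contra hcon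
  push Not at hcon
  have := c.gd.bdry hne (p := x) (q := x') (by
    intro a ha b hab
    have hna := hcon a ha
    unfold aw at hna
    rcases hD.cl.clo a (hN ha) b hab with h | rfl | rfl | rfl | rfl
    · exact hs a ha b h hab
    all_goals tauto) w1
  rcases this with h | rfl | rfl
  · exact hD.cl.nw1 (hN h)
  · exact hD.cl.nw1 hx
  · exact hD.cl.nw1 hx'

lemma Cfg.leaf_ne [Fintype V] (c : Cfg G k w1 w2 v t1 t2 u α β) {D : Finset V} (hD : BP G w1 w2 t1 t2 α β D)
    {x : V} {N : Finset V} (hl : Leaf G D x N) {y : V} (hy : y ∈ N) : aw G w1 w2 y ∨ aw G t1 t2 y := by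
  obtain ⟨z, hz, h⟩ := c.hang hD hl.xD hl.xD hl.ND ⟨y, hy⟩ (fun a ha b hb hab => by
    have := hl.sep a ha b hb hab; tauto)
  have := c.leaf_const hD hl hy hz
  rcases h with h | h
  · exact Or.inl (this.1.2 h)
  · exact Or.inr (this.2.2 h)

lemma Cfg.leaf_m [Fintype V] (c : Cfg G k w1 w2 v t1 t2 u α β) {D : Finset V} (hD : BP G w1 w2 t1 t2 α β D)
    {x : V} {N : Finset V} (hl : Leaf G D x N) : k ≤ cA G w1 w2 N + cA G t1 t2 N + 1 := by
  obtain ⟨y, hy⟩ := hl.conn.1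
  have h1 := hl.card_le c.hk hD.bad hy
  have h2 := c.leaf_ne hD hl hy
  have h3 := lst_card (G := G) (w1 := w1) (w2 := w2) (t1 := t1) (t2 := t2) c.ab y
  have hA : aw G w1 w2 y → cA G w1 w2 N = N.card := fun h =>
    cA_all (fun z hz => (c.leaf_const hD hl hy hz).1.1 h)
  have hB : aw G t1 t2 y → cA G t1 t2 N = N.card := fun h =>
    cA_all (fun z hz => (c.leaf_const hD hl hy hz).2.1 h)
  have := c.gd.four
  by_cases a : aw G w1 w2 y <;> by_cases b : aw G t1 t2 y <;> simp only [a, b, if_true, if_false] at h3 h2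
  · have := hA a
    have := hB b
    omega
  · have := hA a
    omega
  · have := hB b
    omega
  · tauto

lemma Cfg.const_A [Fintype V] (c : Cfg G k w1 w2 v t1 t2 u α β) {D : Finset V} (hD : BP G w1 w2 t1 t2 α β D)
    (hc : ∀ y ∈ D, ∀ z ∈ D, lst G w1 w2 t1 t2 α β y = lst G w1 w2 t1 t2 α β z) {y : V} (hy : y ∈ D) :
    aw G w1 w2 y := by
  by_contra hcon
  have hno : ∀ z ∈ D, ¬ aw G w1 w2 z := fun z hz h => hcon ((c.aw_of_eq (hc y hy z hz)).1.2 h)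
  have := c.gd.bdry ⟨y, hy⟩ (p := t1) (q := t2) (by
    intro a ha b hab
    have hna := hno a ha
    unfold aw at hna
    rcases hD.cl.clo a ha b hab with h | rfl | rfl | rfl | rfl <;> tauto) w1
  rcases this with h | h | h
  · exact hD.cl.nw1 h
  · exact c.d11 h
  · exact c.d12 h

lemma Cfg.const_B [Fintype V] (c : Cfg G k w1 w2 v t1 t2 u α β) {D : Finset V} (hD : BP G w1 w2 t1 t2 α β D)
    (hc : ∀ y ∈ D, ∀ z ∈ D, lst G w1 w2 t1 t2 α β y = lst G w1 w2 t1 t2 α β z) {y : V} (hy : y ∈ D) :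
    aw G t1 t2 y :=
  c.swap.const_A hD.swap (by rw [← lst_swap]; exact hc) hy

lemma cA_two {p q : V} {D N N' : Finset V} (hN : N ⊆ D) (hN' : N' ⊆ D) (hd : Disjoint N N') :
    cA G p q N + cA G p q N' ≤ cA G p q D := by
  rw [← cA_union hd]; exact cA_mono (Finset.union_subset hN hN')

lemma Cfg.mm_ge [Fintype V] (c : Cfg G k w1 w2 v t1 t2 u α β) {D : Finset V} (hD : BP G w1 w2 t1 t2 α β D) :
    2 * k ≤ mm G w1 w2 t1 t2 D + 2 := by
  rw [c.mm_eq hD]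
  rcases structure_lemma c.hk hD.bad (c.one_lt hD) with hc | ⟨x, N, x', N', hl, hl', hd⟩
  · rw [cA_all (fun y hy => c.const_A hD hc hy), cA_all (fun y hy => c.const_B hD hc hy)]
    obtain ⟨y, hy⟩ := hD.bad.conn.1
    have h1 := hD.bad.eq c.hk y hy
    have h2 : dg G D y ≤ (D.erase y).card := dg_le_of (fun b hb hab => by simp [hb, hab.ne.symm])
    rw [Finset.card_erase_of_mem hy] at h2
    have h3 := lst_card (G := G) (w1 := w1) (w2 := w2) (t1 := t1) (t2 := t2) c.ab y
    have := c.one_lt hD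
    simp only [c.const_A hD hc hy, c.const_B hD hc hy, if_true] at h3
    omega
  · have h1 := c.leaf_m hD hl
    have h2 := c.leaf_m hD hl'
    have h3 := cA_two (G := G) (p := w1) (q := w2) hl.ND hl'.ND hd
    have h4 := cA_two (G := G) (p := t1) (q := t2) hl.ND hl'.ND hd
    omega

lemma Cfg.unique [Fintype V] (c : Cfg G k w1 w2 v t1 t2 u α β) {D E : Finset V} (hD : BP G w1 w2 t1 t2 α β D)
    (hE : BP G w1 w2 t1 t2 α β E) : D = E := by
  rcases hD.cl.eq_or_disjoint hE.cl hD.bad.conn hE.bad.conn with h | h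
  · exact h
  · exfalso
    have h1 := c.beta1 (hD.cl.union hE.cl) (by simp [c.uD hD, c.uD hE]) (by simp [c.vD hD, c.vD hE])
    rw [mm_union h] at h1
    have := c.mm_ge hD
    have := c.mm_ge hE
    omega

/-- the degenerate situation -/
def Dgn (G : SimpleGraph V) (k : ℕ) (w1 w2 t1 t2 : V) (D : Finset V) : Prop :=
  (∀ z, z ∈ D ∨ z = w1 ∨ z = w2 ∨ z = t1 ∨ z = t2) ∧
  ((dg G D w1 + 2 = k ∧ dg G D w2 + 1 = k) ∨ (dg G D w1 + 1 = k ∧ dg G D w2 + 2 = k)) ∧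
  ((dg G D t1 + 2 = k ∧ dg G D t2 + 1 = k) ∨ (dg G D t1 + 1 = k ∧ dg G D t2 + 2 = k))

lemma Dgn.flipW {D : Finset V} (h : Dgn G k w1 w2 t1 t2 D) : Dgn G k w2 w1 t1 t2 D := by
  obtain ⟨h1, h2, h3⟩ := h
  exact ⟨fun z => by have := h1 z; tauto, by tauto, h3⟩

lemma Dgn.flipT {D : Finset V} (h : Dgn G k w1 w2 t1 t2 D) : Dgn G k w1 w2 t2 t1 D := by
  obtain ⟨h1, h2, h3⟩ := h
  exact ⟨fun z => by have := h1 z; tauto, h2, by tauto⟩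

/-- case I: `u = w1`, `v = t1` -/
lemma Cfg.dgnI [Fintype V] (c : Cfg G k w1 w2 t1 t1 t2 w1 α β) {D : Finset V} (hD : BP G w1 w2 t1 t2 α β D)
    (hm : 4 * k ≤ mm G w1 w2 t1 t2 D + 6) : Dgn G k w1 w2 t1 t2 D := by
  have n1 := hD.cl.nw1
  have n2 := hD.cl.nw2
  have n3 := hD.cl.nt1
  have n4 := hD.cl.nt2
  have S1 : ∀ s ∈ ({t1, t2} : Finset V), G.Adj w1 s ∧ s ∉ D := by simp [c.ut1, c.ut2, n3, n4]
  have S2 : ∀ s ∈ ({t1} : Finset V), G.Adj w2 s ∧ s ∉ D := by simp [c.vw2.symm, n3]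
  have S3 : ∀ s ∈ ({w1, w2} : Finset V), G.Adj t1 s ∧ s ∉ D := by simp [c.vw1, c.vw2, n1, n2]
  have S4 : ∀ s ∈ ({w1} : Finset V), G.Adj t2 s ∧ s ∉ D := by simp [c.ut2.symm, n1]
  have a1 := out_le c.gd S1
  have a2 := out_le c.gd S2
  have a3 := out_le c.gd S3
  have a4 := out_le c.gd S4
  rw [Finset.card_pair c.tne] at a1
  rw [Finset.card_pair c.wne] at a3
  rw [Finset.card_singleton] at a2 a4
  unfold mm at hm
  have b1 := out_eq c.gd S1 (by rw [Finset.card_pair c.tne]; omega)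
  have b2 := out_eq c.gd S2 (by rw [Finset.card_singleton]; omega)
  have b3 := out_eq c.gd S3 (by rw [Finset.card_pair c.wne]; omega)
  have b4 := out_eq c.gd S4 (by rw [Finset.card_singleton]; omega)
  simp only [Finset.mem_insert, Finset.mem_singleton] at b1 b2 b3 b4
  refine ⟨?_, by omega, by omega⟩
  intro z
  have := c.gd.bdry (N := insert w1 (insert w2 (insert t1 (insert t2 D)))) ⟨w1, by simp⟩ (p := w1) (q := w1) (by
    intro a ha b hab
    simp only [Finset.mem_insert] at ha ⊢
    rcases ha with rfl | rfl | rfl | rfl | ha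
    · have := b1 b hab; tauto
    · have := b2 b hab; tauto
    · have := b3 b hab; tauto
    · have := b4 b hab; tauto
    · have := hD.cl.clo a ha b hab; tauto) z
  simp only [Finset.mem_insert] at this
  tauto

/-- case II: `v = t1`, `u ∉ W` -/
lemma Cfg.dgnII [Fintype V] (c : Cfg G k w1 w2 t1 t1 t2 u α β) {D : Finset V} (hD : BP G w1 w2 t1 t2 α β D)
    (hm : 4 * k ≤ mm G w1 w2 t1 t2 D + 6) (hu1 : u ≠ w1) (hu2 : u ≠ w2) : False := by
  have n1 := hD.cl.nw1
  have n2 := hD.cl.nw2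
  have n3 := hD.cl.nt1
  have n4 := hD.cl.nt2
  have n5 := c.uD hD
  have S1 : ∀ s ∈ ({t1} : Finset V), G.Adj w1 s ∧ s ∉ D := by simp [c.vw1.symm, n3]
  have S2 : ∀ s ∈ ({t1} : Finset V), G.Adj w2 s ∧ s ∉ D := by simp [c.vw2.symm, n3]
  have S3 : ∀ s ∈ ({w1, w2, u} : Finset V), G.Adj t1 s ∧ s ∉ D := by
    simp [c.vw1, c.vw2, n1, n2, n5, c.ut1.symm]
  have S4 : ∀ s ∈ ({u} : Finset V), G.Adj t2 s ∧ s ∉ D := by simp [c.ut2.symm, n5]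
  have hc3 : ({w1, w2, u} : Finset V).card = 3 := Finset.card_eq_three.2 ⟨w1, w2, u, c.wne, hu1.symm, hu2.symm, rfl⟩
  have a1 := out_le c.gd S1
  have a2 := out_le c.gd S2
  have a3 := out_le c.gd S3
  have a4 := out_le c.gd S4
  rw [hc3] at a3
  rw [Finset.card_singleton] at a1 a2 a4
  unfold mm at hm
  have b1 := out_eq c.gd S1 (by rw [Finset.card_singleton]; omega)
  have b2 := out_eq c.gd S2 (by rw [Finset.card_singleton]; omega)
  have b3 := out_eq c.gd S3 (by rw [hc3]; omega)
  have b4 := out_eq c.gd S4 (by rw [Finset.card_singleton]; omega)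
  simp only [Finset.mem_insert, Finset.mem_singleton] at b1 b2 b3 b4
  have hall := c.gd.bdry (N := insert w1 (insert w2 (insert t1 (insert t2 D)))) ⟨w1, by simp⟩ (p := u) (q := u) (by
    intro a ha b hab
    simp only [Finset.mem_insert] at ha ⊢
    rcases ha with rfl | rfl | rfl | rfl | ha
    · have := b1 b hab; tauto
    · have := b2 b hab; tauto
    · have := b3 b hab; tauto
    · have := b4 b hab; tauto
    · have := hD.cl.clo a ha b hab; tauto)
  have h1 := c.ut1.ne
  have h2 := c.ut2.ne
  refine deg_three c.gd (x := u) (p := t1) (q := t2) (r := t2) ?_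
  intro b hub
  have hbu := hub.ne.symm
  have hbZ : b ∉ D := fun hb => by
    have := hD.cl.clo b hb u hub.symm
    tauto
  have hbw1 : b ≠ w1 := by
    rintro rfl
    have := b1 u hub.symm
    tauto
  have hbw2 : b ≠ w2 := by
    rintro rfl
    have := b2 u hub.symm
    tauto
  have := hall b
  simp only [Finset.mem_insert] at this
  tauto

/-- case IV: `u ∉ W`, `v ∉ T`, `w1` adjacent to `t1` -/
lemma Cfg.dgnIV [Fintype V] (c : Cfg G k w1 w2 v t1 t2 u α β) {D : Finset V} (hD : BP G w1 w2 t1 t2 α β D)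
    (hm : 4 * k ≤ mm G w1 w2 t1 t2 D + 6) (hu1 : u ≠ w1) (hu2 : u ≠ w2) (hv1 : v ≠ t1)
    (hadj : G.Adj w1 t1) : False := by
  have n1 := hD.cl.nw1
  have n2 := hD.cl.nw2
  have n3 := hD.cl.nt1
  have n4 := hD.cl.nt2
  have n5 := c.uD hD
  have n6 := c.vD hD
  have S1 : ∀ s ∈ ({v, t1} : Finset V), G.Adj w1 s ∧ s ∉ D := by simp [c.vw1.symm, n3, n6, hadj]
  have S2 : ∀ s ∈ ({v} : Finset V), G.Adj w2 s ∧ s ∉ D := by simp [c.vw2.symm, n6]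
  have S3 : ∀ s ∈ ({u, w1} : Finset V), G.Adj t1 s ∧ s ∉ D := by
    simp [n1, n5, c.ut1.symm, hadj.symm]
  have S4 : ∀ s ∈ ({u} : Finset V), G.Adj t2 s ∧ s ∉ D := by simp [c.ut2.symm, n5]
  have a1 := out_le c.gd S1
  have a2 := out_le c.gd S2
  have a3 := out_le c.gd S3
  have a4 := out_le c.gd S4
  rw [Finset.card_pair hu1] at a3
  rw [Finset.card_pair hv1] at a1
  rw [Finset.card_singleton] at a2 a4
  unfold mm at hm
  have b1 := out_eq c.gd S1 (by rw [Finset.card_pair hv1]; omega)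
  have b2 := out_eq c.gd S2 (by rw [Finset.card_singleton]; omega)
  have b3 := out_eq c.gd S3 (by rw [Finset.card_pair hu1]; omega)
  have b4 := out_eq c.gd S4 (by rw [Finset.card_singleton]; omega)
  simp only [Finset.mem_insert, Finset.mem_singleton] at b1 b2 b3 b4
  have hall := c.gd.bdry (N := insert w1 (insert w2 (insert t1 (insert t2 D)))) ⟨w1, by simp⟩ (p := u) (q := v) (by
    intro a ha b hab
    simp only [Finset.mem_insert] at ha ⊢
    rcases ha with rfl | rfl | rfl | rfl | ha
    · have := b1 b hab; tauto
    · have := b2 b hab; tauto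
    · have := b3 b hab; tauto
    · have := b4 b hab; tauto
    · have := hD.cl.clo a ha b hab; tauto)
  have h1 := c.ut1.ne
  have h2 := c.ut2.ne
  have huv := c.uv
  refine deg_three c.gd (x := u) (p := t1) (q := t2) (r := v) ?_
  intro b hub
  have hbu := hub.ne.symm
  have hbZ : b ∉ D := fun hb => by
    have := hD.cl.clo b hb u hub.symm
    tauto
  have hbw1 : b ≠ w1 := by
    rintro rfl
    have := b1 u hub.symm
    tauto
  have hbw2 : b ≠ w2 := by
    rintro rfl
    have := b2 u hub.symm
    tauto
  have := hall b
  simp only [Finset.mem_insert] at this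
  tauto

lemma mm_flipW (Z : Finset V) : mm G w1 w2 t1 t2 Z = mm G w2 w1 t1 t2 Z := by
  unfold mm; ring
lemma mm_flipT (Z : Finset V) : mm G w1 w2 t1 t2 Z = mm G w1 w2 t2 t1 Z := by
  unfold mm; ring

/-- no edges between the two pairs -/
lemma Cfg.no_edges [Fintype V] (c : Cfg G k w1 w2 v t1 t2 u α β) {D : Finset V} (hD : BP G w1 w2 t1 t2 α β D)
    (hm : 4 * k ≤ mm G w1 w2 t1 t2 D + 6) (h11 : ¬ G.Adj w1 t1) (h12 : ¬ G.Adj w1 t2)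
    (h21 : ¬ G.Adj w2 t1) (h22 : ¬ G.Adj w2 t2) {y0 : V} (hy0 : y0 ∈ D) (ha : aw G w1 w2 y0)
    (hb : aw G t1 t2 y0) : False := by
  have hcol : Col G (Finset.univ \ {w1, w2, t1, t2}) (av G {w1, w2, t1, t2} (fun _ => α)) := by
    refine col_of_pieces _ c.hk _ _ rfl ?_
    intro E hE hc
    have hcl := cl_of_closedIn hc
    have hdis : Disjoint E {w1, w2, t1, t2} := by
      refine Finset.disjoint_left.2 (fun e he he' => ?_)
      exact (Finset.mem_sdiff.1 (hc.1 he)).2 he'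
    by_contra hn
    have hsl : ∀ y ∈ E, ∀ p ∈ ({w1, w2, t1, t2} : Finset V), ∀ q ∈ ({w1, w2, t1, t2} : Finset V),
        p ≠ q → G.Adj y p → G.Adj y q → False := by
      intro y hy p hp q hq hpq hyp hyq
      exact hn (greedy' c.hk hE (fun z _ => av_deg c.gd hdis _ z) hy
        (av_slack c.gd hdis _ hp hq hyp hyq hpq rfl))
    rcases hD.cl.eq_or_disjoint hcl hD.bad.conn hE with rfl | hd
    · have d1 := c.d11
      have d2 := c.d12
      have d3 := c.d21
      have d4 := c.d22
      rcases ha with ha | ha <;> rcases hb with hb | hb <;>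
        exact hsl y0 hy0 _ (by simp) _ (by simp) ‹_› ha hb
    · have hu : u ∉ E := fun h => hsl u h t1 (by simp) t2 (by simp) c.tne c.ut1 c.ut2
      have hv : v ∉ E := fun h => hsl v h w1 (by simp) w2 (by simp) c.wne c.vw1 c.vw2
      have h1 := c.beta1 (hD.cl.union hcl) (by simp [c.uD hD, hu]) (by simp [c.vD hD, hv])
      rw [mm_union hd] at h1
      have := c.three_bd hcl hE.1
      omega
  obtain ⟨e, he, hee⟩ := extend (G := G) {w1, w2, t1, t2} _ (by
    intro y hy z hz hyz
    simp only [Finset.mem_insert, Finset.mem_singleton] at hy hz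
    have := c.wna
    have := c.tna
    exfalso
    rcases hy with rfl | rfl | rfl | rfl <;> rcases hz with rfl | rfl | rfl | rfl <;>
      first
      | exact absurd hyz (G.loopless.irrefl _)
      | exact absurd hyz ‹_›
      | exact absurd hyz.symm ‹_›) hcol
  refine c.neq (EqP.of_common c.gd c.eligW c.eligT he ?_ ?_)
  · rw [hee w1 (by simp), hee w2 (by simp)]
  · rw [hee t1 (by simp), hee t2 (by simp)]

lemma Cfg.beta2 [Fintype V] (c : Cfg G k w1 w2 v t1 t2 u α β) {D : Finset V} (hD : BP G w1 w2 t1 t2 α β D)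
    (hm : 4 * k ≤ mm G w1 w2 t1 t2 D + 6) {y0 : V} (hy0 : y0 ∈ D) (ha : aw G w1 w2 y0)
    (hb : aw G t1 t2 y0) : Dgn G k w1 w2 t1 t2 D := by
  by_cases hv1 : v = t1
  · subst hv1
    by_cases hu1 : u = w1
    · subst hu1; exact c.dgnI hD hm
    by_cases hu2 : u = w2
    · subst hu2; exact (c.flipW.dgnI hD.flipW (by rwa [← mm_flipW])).flipW
    exact (c.dgnII hD hm hu1 hu2).elim
  by_cases hv2 : v = t2
  · subst hv2
    by_cases hu1 : u = w1
    · subst hu1; exact (c.flipT.dgnI hD.flipT (by rwa [← mm_flipT])).flipT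
    by_cases hu2 : u = w2
    · subst hu2; exact (c.flipW.flipT.dgnI hD.flipW.flipT (by rwa [← mm_flipT, ← mm_flipW])).flipT.flipW
    exact (c.flipT.dgnII hD.flipT (by rwa [← mm_flipT]) hu1 hu2).elim
  by_cases hu1 : u = w1
  · subst hu1
    exact (c.swap.dgnII hD.swap (by rwa [← mm_swap]) hv1 hv2).elim
  by_cases hu2 : u = w2
  · subst hu2
    exact (c.flipW.swap.dgnII hD.flipW.swap (by rwa [← mm_swap, ← mm_flipW]) hv1 hv2).elim
  exfalso
  by_cases h11 : G.Adj w1 t1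
  · exact c.dgnIV hD hm hu1 hu2 hv1 h11
  by_cases h12 : G.Adj w1 t2
  · exact c.flipT.dgnIV hD.flipT (by rwa [← mm_flipT]) hu1 hu2 hv2 h12
  by_cases h21 : G.Adj w2 t1
  · exact c.flipW.dgnIV hD.flipW (by rwa [← mm_flipW]) hu2 hu1 hv1 h21
  by_cases h22 : G.Adj w2 t2
  · exact c.flipW.flipT.dgnIV hD.flipW.flipT (by rwa [← mm_flipT, ← mm_flipW]) hu2 hu1 hv2 h22
  exact c.no_edges hD hm h11 h12 h21 h22 hy0 ha hb

end counts
end KJ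

namespace KJ
section aleaf
variable {G : SimpleGraph V} {k : ℕ}
variable {w1 w2 v t1 t2 u : V} {α β : Fin k}

lemma mem_av {X : Finset V} {p : V → Fin k} {y : V} {γ : Fin k} :
    γ ∈ av G X p y ↔ ∀ x ∈ X, G.Adj y x → p x ≠ γ := by
  unfold av; simp

lemma lst_ge (hab : α ≠ β) (y : V) : k ≤ (lst G w1 w2 t1 t2 α β y).card + 2 := by
  have := lst_card (G := G) (w1 := w1) (w2 := w2) (t1 := t1) (t2 := t2) hab y
  split_ifs at this <;> omega

lemma uniq_nbr {Y : Finset V} {x : V} (h : dg G Y x = 1) :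
    ∃ z ∈ Y, G.Adj x z ∧ ∀ b ∈ Y, G.Adj x b → b = z := by
  unfold dg at h
  obtain ⟨z, hz⟩ := Finset.card_eq_one.1 h
  have hm : ∀ b, b ∈ Y ∧ G.Adj x b ↔ b = z := fun b => by
    have : b ∈ Finset.filter (fun z => G.Adj x z) Y ↔ b ∈ ({z} : Finset V) := by rw [hz]
    simpa using this
  exact ⟨z, ((hm z).2 rfl).1, ((hm z).2 rfl).2, fun b hb hxb => (hm b).1 ⟨hb, hxb⟩⟩

lemma conn_erase_one {Y : Finset V} {x : V} (hY : Conn G Y) (hx : x ∈ Y) (h : dg G Y x = 1) :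
    Conn G (Y.erase x) := by
  obtain ⟨z, hz, hxz, hu⟩ := uniq_nbr h
  refine conn_of_pivot (x := z) (Finset.mem_erase.2 ⟨hxz.ne.symm, hz⟩) ?_
  intro T hT hTn hzT
  have hxT : x ∉ T := fun h => by simpa using hT h
  obtain ⟨a, ha, b, hb, hab⟩ := hY.2 T (hT.trans (Finset.erase_subset _ _)) hTn ⟨x, by simp [hx, hxT]⟩
  refine ⟨a, ha, b, ?_, hab⟩
  simp only [Finset.mem_sdiff, Finset.mem_erase] at hb ⊢
  refine ⟨⟨?_, hb.1⟩, hb.2⟩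
  rintro rfl
  have := hu a (Finset.mem_of_mem_erase (hT ha)) hab.symm
  exact hzT (this ▸ ha)

lemma Cfg.aleaf [Fintype V] (c : Cfg G k w1 w2 v t1 t2 u α β) {D : Finset V} (hD : BP G w1 w2 t1 t2 α β D)
    {x : V} {N : Finset V} (hl : Leaf G D x N) (hA : ∀ y ∈ N, aw G w1 w2 y) (hB : ∀ y ∈ N, ¬ aw G t1 t2 y) :
    ¬ aw G w1 w2 x ∧ ¬ aw G t1 t2 x ∧ dg G N x + 1 = k ∧
    (¬ Col G (insert x N) (fun _ => (Finset.univ : Finset (Fin k)).erase α)) ∧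
    Bad G (D \ N) (Function.update (lst G w1 w2 t1 t2 α β) x {α}) ∧ dg G (D \ N) x = 1 := by
  obtain ⟨y0, hy0⟩ := hl.conn.1
  obtain ⟨r1, r2, r3, r4⟩ := hl.reduce c.hk hD.bad hy0
  have hcard := lst_card (G := G) (w1 := w1) (w2 := w2) (t1 := t1) (t2 := t2) c.ab y0
  simp only [hA y0 hy0, hB y0 hy0, if_true, if_false] at hcard
  have hl0 : lst G w1 w2 t1 t2 α β y0 = Finset.univ.erase α := by
    ext γ; rw [mem_lst]; simp [hA y0 hy0, hB y0 hy0]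
  have hxm : x ∈ D \ N := by simp [hl.xD, hl.xN]
  have hgt : 1 < (D \ N).card := by
    obtain ⟨b, hb, hbN, hbx⟩ := hl.other
    exact Finset.one_lt_card.2 ⟨x, hxm, b, by simp [hb, hbN], hbx.symm⟩
  obtain ⟨z, hz, hzx, hxz⟩ := conn_nbr r4.conn hgt hxm
  have hpos := dg_pos hz hxz
  have heq := r4.eq c.hk x hxm
  rw [Function.update_self] at heq
  have hne : (lst G w1 w2 t1 t2 α β x \ lst G w1 w2 t1 t2 α β y0).Nonempty := by
    rw [← Finset.card_pos]; omega
  have hsub : ∀ γ ∈ lst G w1 w2 t1 t2 α β x \ lst G w1 w2 t1 t2 α β y0, γ = α := by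
    intro γ hγ
    rw [hl0] at hγ
    by_contra hh
    simp [hh] at hγ
  have hsing : lst G w1 w2 t1 t2 α β x \ lst G w1 w2 t1 t2 α β y0 = {α} :=
    Finset.eq_singleton_iff_nonempty_unique_mem.2 ⟨hne, hsub⟩
  have hax : α ∈ lst G w1 w2 t1 t2 α β x := by
    have : α ∈ lst G w1 w2 t1 t2 α β x \ lst G w1 w2 t1 t2 α β y0 := by rw [hsing]; simp
    exact (Finset.mem_sdiff.1 this).1
  have hbx := r1 (c.mem_b.2 (hB y0 hy0))
  rw [hsing] at r4 heq
  rw [hl0] at r3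
  refine ⟨c.mem_a.1 hax, c.mem_b.1 hbx, by omega, r3, r4, by simpa using heq⟩

lemma Cfg.lemA2 [Fintype V] (c : Cfg G k w1 w2 v t1 t2 u α β) {D : Finset V} (hD : BP G w1 w2 t1 t2 α β D)
    {x : V} {N : Finset V} (hl : Leaf G D x N) (hA : ∀ y ∈ N, aw G w1 w2 y) (hB : ∀ y ∈ N, ¬ aw G t1 t2 y)
    {y : V} (hy : y ∈ D) (hyN : y ∉ N) (hyx : y ≠ x) : ¬ G.Adj y w2 := by
  intro hyw
  obtain ⟨f1, f2, f3, f4, f5, f6⟩ := c.aleaf hD hl hA hB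
  have nw1 := hD.cl.nw1
  have nw2 := hD.cl.nw2
  have nt1 := hD.cl.nt1
  have nt2 := hD.cl.nt2
  have hxD := hl.xD
  have hn0 : ∃ n ∈ N, G.Adj x n ∧ G.Adj n w1 := by
    by_contra hcon
    push Not at hcon
    have h1 : (insert v (insert y (N.filter (fun z => G.Adj x z)))).card ≤ dg G Finset.univ w2 := by
      refine Finset.card_le_card ?_
      intro z hz
      simp only [Finset.mem_insert, Finset.mem_filter, Finset.mem_univ, true_and] at hz ⊢
      rcases hz with rfl | rfl | ⟨hz, hxz⟩
      · exact c.vw2.symm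
      · exact hyw.symm
      · rcases hA z hz with h | h
        · exact absurd h (hcon z hz hxz)
        · exact h.symm
    have hvD := c.vD hD
    rw [Finset.card_insert_of_notMem, Finset.card_insert_of_notMem, c.gd.reg] at h1
    · unfold dg at f3; omega
    · simp [hyN]
    · simp only [Finset.mem_insert, Finset.mem_filter, not_or, not_and]
      exact ⟨fun h => hvD (h ▸ hy), fun h => absurd (hl.ND h) hvD⟩
  obtain ⟨n0, hn0N, hxn0, hn0w⟩ := hn0
  have hxw1 : x ≠ w1 := fun h => nw1 (h ▸ hxD)
  have hxw2 : x ≠ w2 := fun h => nw2 (h ▸ hxD)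
  have hxt1 : x ≠ t1 := fun h => nt1 (h ▸ hxD)
  have hxt2 : x ≠ t2 := fun h => nt2 (h ▸ hxD)
  have hel : Elig G x w1 := ⟨hxw1, fun h => f1 (Or.inl h), n0, hxn0.symm, hn0w⟩
  obtain ⟨e0, he0, h01, h02⟩ := exists_alike c.gd c.eligW α
  have he0x : e0 x = α := by
    by_contra hcon
    refine f4 ⟨e0, ?_, fun a _ b _ hab => he0 hab⟩
    intro a ha
    simp only [Finset.mem_erase, Finset.mem_univ, and_true]
    rcases Finset.mem_insert.1 ha with rfl | ha
    · exact hcon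
    · rcases hA a ha with h | h
      · rw [← h01]; exact he0 h
      · rw [← h02]; exact he0 h
  have E1 : EqP G k w1 w2 x w1 := EqP.of_common c.gd c.eligW hel he0 (h01.trans h02.symm) (he0x.trans h01.symm)
  set p : V → Fin k := fun z => if z = t1 ∨ z = t2 then β else α with hp
  have px : p x = α := by simp [hp, hxt1, hxt2]
  have pw : p w1 = α := by simp [hp, c.d11, c.d12]
  have pt1 : p t1 = β := by simp [hp]
  have pt2 : p t2 = β := by simp [hp]
  have hND : N ⊆ Finset.univ \ {x, w1, t1, t2} := by
    intro a ha
    have haD := hl.ND ha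
    simp only [Finset.mem_sdiff, Finset.mem_univ, true_and, Finset.mem_insert, Finset.mem_singleton, not_or]
    exact ⟨fun h => hl.xN (h ▸ ha), fun h => nw1 (h ▸ haD), fun h => nt1 (h ▸ haD), fun h => nt2 (h ▸ haD)⟩
  have hD2 : (D \ N).erase x ⊆ Finset.univ \ {x, w1, t1, t2} := by
    intro a ha
    simp only [Finset.mem_erase, Finset.mem_sdiff] at ha
    have haD := ha.2.1
    simp only [Finset.mem_sdiff, Finset.mem_univ, true_and, Finset.mem_insert, Finset.mem_singleton, not_or]
    exact ⟨ha.1, fun h => nw1 (h ▸ haD), fun h => nt1 (h ▸ haD), fun h => nt2 (h ▸ haD)⟩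
  have hconn2 : Conn G ((D \ N).erase x) := conn_erase_one f5.conn (by simp [hl.xD, hl.xN]) f6
  have hcol : Col G (Finset.univ \ {x, w1, t1, t2}) (av G {x, w1, t1, t2} p) := by
    refine col_of_pieces _ c.hk _ _ rfl ?_
    intro E hE hc
    by_contra hn
    have hdis : Disjoint E {x, w1, t1, t2} := by
      refine Finset.disjoint_left.2 (fun e he he' => ?_)
      exact (Finset.mem_sdiff.1 (hc.1 he)).2 he'
    have hEx : ∀ a ∈ E, a ≠ x ∧ a ≠ w1 ∧ a ≠ t1 ∧ a ≠ t2 := by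
      intro a ha
      have := Finset.disjoint_left.1 hdis ha
      simpa using this
    have hEN : ∀ a ∈ E, a ∉ N := by
      intro a ha haN
      have hsub := conn_sub_closed hl.conn hND hc ha haN
      exact hn (greedy' c.hk hE (fun z _ => av_deg c.gd hdis _ z) (hsub hn0N)
        (av_slack c.gd hdis _ (a := x) (b := w1) (by simp) (by simp) hxn0.symm hn0w hxw1 (px.trans pw.symm)))
    have hEw : w2 ∉ E := by
      intro hw
      have : ∃ n ∈ N, G.Adj n w2 := by
        by_contra hcon
        push Not at hcon
        have := c.gd.bdry hl.conn.1 (p := x) (q := w1) (by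
          intro a ha b hab
          rcases hD.cl.clo a (hl.ND ha) b hab with h | rfl | rfl | rfl | rfl
          · rcases hl.sep a ha b h hab with h | h
            · exact Or.inl h
            · exact Or.inr (Or.inl h)
          · exact Or.inr (Or.inr rfl)
          · exact absurd hab (hcon a ha)
          · exact absurd (Or.inl hab) (hB a ha)
          · exact absurd (Or.inr hab) (hB a ha)) w2
        rcases this with h | h | h
        · exact nw2 (hl.ND h)
        · exact hxw2 h.symm
        · exact c.wne h.symm
      obtain ⟨n, hn, hnw⟩ := this
      exact hEN n (hc.2 w2 hw n (hND hn) hnw.symm) hn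
    have hED2 : ∀ a ∈ E, a ∉ (D \ N).erase x := by
      intro a ha haD
      have hsub := conn_sub_closed hconn2 hD2 hc ha haD
      have hyE : y ∈ E := hsub (by simp [hy, hyN, hyx])
      refine hEw (hc.2 y hyE w2 ?_ hyw)
      simp [hxw2.symm, c.wne.symm, c.d21, c.d22]
    have hED : ∀ a ∈ E, a ∉ D := by
      intro a ha haD
      refine hED2 a ha ?_
      simp [haD, hEN a ha, (hEx a ha).1]
    have hEx' : ∀ a ∈ E, ¬ G.Adj a x := by
      intro a ha hax
      obtain ⟨h1, h2, h3, h4⟩ := hEx a ha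
      rcases hD.cl.clo x hxD a hax.symm with h | h | h | h | h
      · exact hED a ha h
      · exact h2 h
      · exact hEw (h ▸ ha)
      · exact h3 h
      · exact h4 h
    have hcl : Cl G w1 w2 t1 t2 E := by
      refine ⟨fun h => (hEx _ h).2.1 rfl, hEw, fun h => (hEx _ h).2.2.1 rfl, fun h => (hEx _ h).2.2.2 rfl, ?_⟩
      intro a ha b hab
      by_cases hb : b ∈ ({x, w1, t1, t2} : Finset V)
      · simp only [Finset.mem_insert, Finset.mem_singleton] at hb
        rcases hb with rfl | hb
        · exact absurd hab (hEx' a ha)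
        · tauto
      · exact Or.inl (hc.2 a ha b (by simpa using hb) hab)
    have hbp := c.mkBP hE hcl (by
      intro hcol
      refine hn (hcol.mono ?_)
      intro z hz γ hγ
      rw [mem_lst] at hγ
      rw [mem_av]
      intro s hs hzs
      simp only [Finset.mem_insert, Finset.mem_singleton] at hs
      rcases hs with rfl | rfl | rfl | rfl
      · exact absurd hzs (hEx' z hz)
      · rw [pw]; exact fun h => hγ.1 ⟨h.symm, Or.inl hzs⟩
      · rw [pt1]; exact fun h => hγ.2 ⟨h.symm, Or.inl hzs⟩
      · rw [pt2]; exact fun h => hγ.2 ⟨h.symm, Or.inr hzs⟩)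
    have := c.unique hD hbp
    exact (hEx x (this ▸ hxD)).1 rfl
  have hxw1n : ¬ G.Adj x w1 := hel.2.1
  have hxt1n : ¬ G.Adj x t1 := fun h => f2 (Or.inl h)
  have hxt2n : ¬ G.Adj x t2 := fun h => f2 (Or.inr h)
  obtain ⟨e, he, hee⟩ := extend (G := G) {x, w1, t1, t2} p (by
    intro y hy z hz hyz
    have hab := c.ab
    have htn := c.tna
    simp only [Finset.mem_insert, Finset.mem_singleton] at hy hz
    rcases hy with rfl | rfl | rfl | rfl <;> rcases hz with rfl | rfl | rfl | rfl <;>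
      first
      | exact absurd hyz (G.loopless.irrefl _)
      | exact absurd hyz ‹_›
      | exact absurd hyz.symm ‹_›
      | (simp only [pw, pt1, pt2]; exact hab)
      | (simp only [pw, pt1, pt2]; exact hab.symm)) hcol
  have q1 : e x = e w1 := by rw [hee x (by simp), hee w1 (by simp), px, pw]
  have q2 : e t1 = e t2 := by rw [hee t1 (by simp), hee t2 (by simp), pt1, pt2]
  exact c.neq (EqP.trans E1 (EqP.of_common c.gd hel c.eligT he q1 q2) he q1)

lemma Cfg.lemA [Fintype V] (c : Cfg G k w1 w2 v t1 t2 u α β) {D : Finset V} (hD : BP G w1 w2 t1 t2 α β D)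
    {x : V} {N : Finset V} (hl : Leaf G D x N) (hA : ∀ y ∈ N, aw G w1 w2 y) (hB : ∀ y ∈ N, ¬ aw G t1 t2 y)
    {y : V} (hy : y ∈ D) (hyN : y ∉ N) (hyx : y ≠ x) : ¬ aw G w1 w2 y := by
  rintro (h | h)
  · exact c.flipW.lemA2 hD.flipW hl (fun y hy => aw_comm.1 (hA y hy)) hB hy hyN hyx h
  · exact c.lemA2 hD hl hA hB hy hyN hyx h

lemma Cfg.no_A' [Fintype V] (c : Cfg G k w1 w2 v t1 t2 u α β) {D : Finset V} (hD : BP G w1 w2 t1 t2 α β D)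
    {x : V} {N : Finset V} (hl : Leaf G D x N) (hA : ∀ y ∈ N, aw G w1 w2 y) (hB : ∀ y ∈ N, ¬ aw G t1 t2 y) :
    False := by
  obtain ⟨f1, f2, f3, f4, f5, f6⟩ := c.aleaf hD hl hA hB
  have hxm : x ∈ D \ N := by simp [hl.xD, hl.xN]
  obtain ⟨z, hz, hxz, hzu⟩ := uniq_nbr f6
  have hconn2 : Conn G ((D \ N).erase x) := conn_erase_one f5.conn hxm f6
  have k4 := c.gd.four
  set D2 := (D \ N).erase x with hD2
  have mD2 : ∀ a, a ∈ D2 ↔ a ≠ x ∧ a ∈ D ∧ a ∉ N := by intro a; simp [hD2]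
  have hzD2 : z ∈ D2 := by rw [mD2]; simp at hz; exact ⟨hxz.ne.symm, hz⟩
  set L2 := rem G (Function.update (lst G w1 w2 t1 t2 α β) x {α}) x α with hL2
  have hbad : Bad G D2 L2 := ⟨hconn2, fun y hy => rem_card _ _ _ _ hxm _ (f5.deg y (Finset.mem_of_mem_erase hy)),
    fun h => f5.ncol (col_of_rem (by simp) h)⟩
  have hL2z : L2 z = (lst G w1 w2 t1 t2 α β z).erase α := by
    simp [hL2, rem, hxz.symm, Function.update_of_ne hxz.ne.symm]
  have hL2y : ∀ y ∈ D2, y ≠ z → L2 y = lst G w1 w2 t1 t2 α β y := by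
    intro y hy hyz
    have h1 : y ≠ x := ((mD2 y).1 hy).1
    have h2 : ¬ G.Adj y x := fun h => hyz (hzu y (Finset.mem_of_mem_erase hy) h.symm)
    simp [hL2, rem, h2, Function.update_of_ne h1]
  have hna : ∀ y ∈ D2, ¬ aw G w1 w2 y := fun y hy =>
    c.lemA hD hl hA hB ((mD2 y).1 hy).2.1 ((mD2 y).1 hy).2.2 ((mD2 y).1 hy).1
  have hne : ∀ y ∈ D2, y ≠ z → L2 y ≠ L2 z := by
    intro y hy hyz heq
    have h1 := c.mem_a.2 (hna y hy)
    rw [← hL2y y hy hyz, heq, hL2z] at h1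
    simp at h1
  have hdz : 2 ≤ dg G D2 z := by
    rw [hbad.eq c.hk z hzD2, hL2z, Finset.card_erase_of_mem (c.mem_a.2 (hna z hzD2))]
    have := lst_card (G := G) (w1 := w1) (w2 := w2) (t1 := t1) (t2 := t2) c.ab z
    simp only [hna z hzD2, if_false] at this
    split_ifs at this <;> omega
  have hgt : 1 < D2.card := by
    have := dg_le_card (G := G) D2 z
    omega
  rcases structure_lemma c.hk hbad hgt with hc | ⟨x1, N1, x2, N2, hl1, hl2, hd⟩
  · obtain ⟨y, hy, hyz⟩ := Finset.exists_mem_ne hgt z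
    exact hne y hy hyz (hc y hy z hzD2)
  · have hzN : ∀ x1 N1, Leaf G D2 x1 N1 → z ∉ N1 := by
      intro x1 N1 hl1 hz1
      have hall : ∀ y ∈ N1, y = z := by
        intro y hy
        by_contra hyz
        exact hne y (hl1.ND hy) hyz (hl1.const c.hk hbad y hy z hz1)
      have : dg G D2 z ≤ ({x1} : Finset V).card := dg_le_of (fun b hb hzb => by
        rcases hl1.sep z hz1 b hb hzb with h | h
        · exact absurd (hall b h).symm hzb.ne
        · simp [h])
      simp at this
      omega
    have hun : D2 ∪ insert x N = D := by
      ext a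
      rw [Finset.mem_union, mD2, Finset.mem_insert]
      have := @hl.ND a
      have := hl.xD
      by_cases h1 : a = x
      · subst h1; tauto
      · tauto
    have hext : ∀ x1 N1, Leaf G D2 x1 N1 → Leaf G D x1 N1 := by
      intro x1 N1 hl1
      have := hl1.extend (M := insert x N) (z := z) (hl.conn_insert hD.bad.conn) hzD2 (hzN x1 N1 hl1) ?_
        ⟨x, by simp, hxz.symm⟩ ?_
      · rwa [hun] at this
      · rw [Finset.disjoint_left]
        intro a ha ha'
        rw [mD2] at ha
        rw [Finset.mem_insert] at ha'
        tauto
      · intro a ha m hm ham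
        rcases Finset.mem_insert.1 hm with rfl | hm
        · exact hzu a (Finset.mem_of_mem_erase ha) ham.symm
        · rw [mD2] at ha
          rcases hl.sep m hm a ha.2.1 ham.symm with h | h
          · exact absurd h ha.2.2
          · exact absurd h ha.1
    have g1 := hext _ _ hl1
    have g2 := hext _ _ hl2
    have b1 : ∀ y ∈ N1, aw G t1 t2 y := fun y hy =>
      (c.leaf_ne hD g1 hy).resolve_left (hna y (hl1.ND hy))
    have b2 : ∀ y ∈ N2, aw G t1 t2 y := fun y hy =>
      (c.leaf_ne hD g2 hy).resolve_left (hna y (hl2.ND hy))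
    have hsub : N2 ⊆ {x1} := by
      intro y hy
      by_contra hyx
      simp only [Finset.mem_singleton] at hyx
      exact c.swap.lemA hD.swap g1 b1 (fun y hy => hna y (hl1.ND hy)) (g2.ND hy)
        (fun h => Finset.disjoint_left.1 hd h hy) hyx (b2 y hy)
    obtain ⟨y, hy⟩ := hl2.conn.1
    have h1 := g2.card_le c.hk hD.bad hy
    have h2 := Finset.card_le_card hsub
    have h3 := lst_ge (G := G) (w1 := w1) (w2 := w2) (t1 := t1) (t2 := t2) c.ab y
    simp at h2
    omega

/-- every leaf is of type C -/
lemma Cfg.leaf_C [Fintype V] (c : Cfg G k w1 w2 v t1 t2 u α β) {D : Finset V} (hD : BP G w1 w2 t1 t2 α β D)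
    {x : V} {N : Finset V} (hl : Leaf G D x N) : ∀ y ∈ N, aw G w1 w2 y ∧ aw G t1 t2 y := by
  intro y hy
  have h0 := c.leaf_ne hD hl hy
  by_cases ha : aw G w1 w2 y
  · by_cases hb : aw G t1 t2 y
    · exact ⟨ha, hb⟩
    · exact (c.no_A' hD hl (fun z hz => (c.leaf_const hD hl hy hz).1.1 ha)
        (fun z hz h => hb ((c.leaf_const hD hl hy hz).2.2 h))).elim
  · exact (c.swap.no_A' hD.swap hl (fun z hz => (c.leaf_const hD hl hy hz).2.1 (h0.resolve_left ha))
        (fun z hz h => ha ((c.leaf_const hD hl hy hz).1.2 h))).elim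
end aleaf
end KJ

namespace KJ
section cleaf
variable {G : SimpleGraph V} {k : ℕ}
variable {w1 w2 v t1 t2 u : V} {α β : Fin k}

lemma Cfg.exact [Fintype V] (c : Cfg G k w1 w2 v t1 t2 u α β) {D : Finset V} (hD : BP G w1 w2 t1 t2 α β D)
    (h : 4 * k ≤ cA G w1 w2 D + cA G t1 t2 D + 6) {y0 : V} (hy0 : y0 ∈ D) (ha : aw G w1 w2 y0)
    (hb : aw G t1 t2 y0) :
    Dgn G k w1 w2 t1 t2 D ∧ cA G w1 w2 D + 3 = 2 * k ∧ cA G t1 t2 D + 3 = 2 * k := by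
  have hd := c.beta2 hD (by rw [c.mm_eq hD]; exact h) hy0 ha hb
  refine ⟨hd, ?_, ?_⟩
  · rw [← c.cA_eq hD]
    have := hd.2.1
    omega
  · rw [← c.swap.cA_eq hD.swap]
    have := hd.2.2
    omega

lemma Cfg.cleaf [Fintype V] (c : Cfg G k w1 w2 v t1 t2 u α β) {D : Finset V} (hD : BP G w1 w2 t1 t2 α β D)
    {x : V} {N : Finset V} (hl : Leaf G D x N) {y0 : V} (hy0 : y0 ∈ N) :
    (∀ γ, γ ∈ lst G w1 w2 t1 t2 α β y0 ↔ γ ≠ α ∧ γ ≠ β) ∧ dg G N x + 2 = k ∧ k ≤ N.card + 2 ∧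
      (lst G w1 w2 t1 t2 α β y0).Nonempty ∧
      cA G w1 w2 N = N.card ∧ cA G t1 t2 N = N.card := by
  have hC := c.leaf_C hD hl
  obtain ⟨r1, r2, r3, r4⟩ := hl.reduce c.hk hD.bad hy0
  have h1 := hl.card_le c.hk hD.bad hy0
  have hcard := lst_card (G := G) (w1 := w1) (w2 := w2) (t1 := t1) (t2 := t2) c.ab y0
  simp only [(hC y0 hy0).1, (hC y0 hy0).2, if_true] at hcard
  have := c.gd.four
  refine ⟨?_, by omega, by omega, Finset.card_pos.1 (by omega), cA_all fun y hy => (hC y hy).1,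
    cA_all fun y hy => (hC y hy).2⟩
  intro γ; rw [mem_lst]; simp [(hC y0 hy0).1, (hC y0 hy0).2]

lemma Cfg.cleaf_ne [Fintype V] (c : Cfg G k w1 w2 v t1 t2 u α β) {D : Finset V} (hD : BP G w1 w2 t1 t2 α β D)
    {x : V} {N : Finset V} (hl : Leaf G D x N) : aw G w1 w2 x ∨ aw G t1 t2 x := by
  by_contra hcon
  push Not at hcon
  obtain ⟨ha, hb⟩ := hcon
  have k4 := c.gd.four
  obtain ⟨y0, hy0⟩ := hl.conn.1
  obtain ⟨f1, f2, f3, ⟨γ, hγ⟩, f4, f5⟩ := c.cleaf hD hl hy0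
  obtain ⟨-, -, -, r4⟩ := hl.reduce c.hk hD.bad hy0
  have hlx : lst G w1 w2 t1 t2 α β x \ lst G w1 w2 t1 t2 α β y0 = {α, β} := by
    ext δ
    rw [Finset.mem_sdiff, f1, mem_lst]
    simp only [ha, hb, and_false, not_false_eq_true, true_and, Finset.mem_insert, Finset.mem_singleton]
    tauto
  rw [hlx] at r4
  set L := Function.update (lst G w1 w2 t1 t2 α β) x {α, β} with hL
  have hLx : L x = {α, β} := by simp [hL]
  have hLy : ∀ y, y ≠ x → γ ∈ L y := by
    intro y hy
    rw [hL, Function.update_of_ne hy, mem_lst]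
    have := (f1 γ).1 hγ
    tauto
  have hne : ∀ y, y ≠ x → L y ≠ L x := by
    intro y hy heq
    have h1 := hLy y hy
    rw [heq, hLx] at h1
    have := (f1 γ).1 hγ
    simp at h1
    tauto
  have hxm : x ∈ D \ N := by simp [hl.xD, hl.xN]
  have hdx : dg G (D \ N) x = 2 := by
    rw [r4.eq c.hk x hxm, hLx, Finset.card_pair c.ab]
  obtain ⟨b, hb', hbN, hbx⟩ := hl.other
  have hbm : b ∈ D \ N := by simp [hb', hbN]
  have hgt : 1 < (D \ N).card := Finset.one_lt_card.2 ⟨x, hxm, b, hbm, hbx.symm⟩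
  rcases structure_lemma c.hk r4 hgt with hc | ⟨x1, N1, x2, N2, hl1, hl2, hd⟩
  · exact hne b hbx (hc b hbm x hxm)
  · have hzN : ∀ x1 N1, Leaf G (D \ N) x1 N1 → x ∉ N1 := by
      intro x1 N1 hl1 hz1
      have hall : ∀ y ∈ N1, y = x := by
        intro y hy
        by_contra hyz
        exact hne y hyz (hl1.const c.hk r4 y hy x hz1)
      have : dg G (D \ N) x ≤ ({x1} : Finset V).card := dg_le_of (fun b hb hzb => by
        rcases hl1.sep x hz1 b hb hzb with h | h
        · exact absurd (hall b h).symm hzb.ne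
        · simp [h])
      simp at this
      omega
    have hext : ∀ x1 N1, Leaf G (D \ N) x1 N1 → Leaf G D x1 N1 := by
      intro x1 N1 hl1
      have := hl1.extend (M := N) (z := x) hl.conn hxm (hzN x1 N1 hl1) Finset.sdiff_disjoint
        (hl.nbr hD.bad.conn) ?_
      · rwa [Finset.sdiff_union_of_subset hl.ND] at this
      · intro a ha m hm ham
        rw [Finset.mem_sdiff] at ha
        rcases hl.sep m hm a ha.1 ham.symm with h | h
        · exact absurd h ha.2
        · exact h
    have g1 := hext _ _ hl1
    have g2 := hext _ _ hl2
    obtain ⟨y1, hy1⟩ := hl1.conn.1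
    obtain ⟨y2, hy2⟩ := hl2.conn.1
    obtain ⟨-, -, a1, -, a2, a3⟩ := c.cleaf hD g1 hy1
    obtain ⟨-, -, b1, -, b2, b3⟩ := c.cleaf hD g2 hy2
    have hdd : Disjoint N (N1 ∪ N2) := by
      rw [Finset.disjoint_left]
      intro a haN ha'
      have : a ∈ D \ N := by
        rcases Finset.mem_union.1 ha' with h | h
        · exact hl1.ND h
        · exact hl2.ND h
      exact (Finset.mem_sdiff.1 this).2 haN
    have q1 := cA_two (G := G) (p := w1) (q := w2) hl.ND (Finset.union_subset g1.ND g2.ND) hdd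
    have q2 := cA_two (G := G) (p := t1) (q := t2) hl.ND (Finset.union_subset g1.ND g2.ND) hdd
    rw [cA_union hd] at q1 q2
    have := c.beta1 hD.cl (c.uD hD) (c.vD hD)
    rw [c.mm_eq hD] at this
    omega

/-- the colouring in the last leaf case -/
lemma Cfg.two_col [Fintype V] (c : Cfg G k w1 w2 v t1 t2 u α β) {D : Finset V} (hD : BP G w1 w2 t1 t2 α β D)
    {x x' : V} {N N' : Finset V} (hl : Leaf G D x N) (hl' : Leaf G D x' N') (hd : Disjoint N N')
    (hx : x ∉ N') (hx' : x' ∉ N) (hxx : x ≠ x')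
    (hQ : ∀ y ∈ D, y ∈ N ∨ y ∈ N' ∨ y = x ∨ y = x') (ha : ¬ aw G w1 w2 x) (hb : ¬ aw G t1 t2 x') : False := by
  have hcol : ∀ x N, Leaf G D x N → Col G N (lst G w1 w2 t1 t2 α β) := by
    intro x N hl
    obtain ⟨y, hy, hxy⟩ := hl.nbr hD.bad.conn
    refine greedy' c.hk hl.conn (fun z hz => (dg_mono hl.ND z).trans (hD.bad.deg z (hl.ND hz))) hy ?_
    have h1 : dg G (insert x N) y ≤ dg G D y := dg_mono (by
      intro a ha'
      rcases Finset.mem_insert.1 ha' with rfl | h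
      · exact hl.xD
      · exact hl.ND h) y
    rw [dg_insert hl.xN, if_pos hxy.symm] at h1
    have := hD.bad.deg y (hl.ND hy)
    omega
  obtain ⟨g, g1, g2⟩ := hcol _ _ hl
  obtain ⟨g', g1', g2'⟩ := hcol _ _ hl'
  have hC := c.leaf_C hD hl
  have hC' := c.leaf_C hD hl'
  have na : ∀ y ∈ N, g y ≠ α ∧ g y ≠ β := fun y hy => by
    have := g1 y hy
    rw [mem_lst] at this
    simp only [(hC y hy).1, (hC y hy).2, and_true] at this
    exact this
  have na' : ∀ y ∈ N', g' y ≠ α ∧ g' y ≠ β := fun y hy => by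
    have := g1' y hy
    rw [mem_lst] at this
    simp only [(hC' y hy).1, (hC' y hy).2, and_true] at this
    exact this
  have hab := c.ab
  set f : V → Fin k := fun y => if y = x then α else if y = x' then β else if y ∈ N then g y else g' y with hf
  have fx : f x = α := by simp [hf]
  have fx' : f x' = β := by simp [hf, hxx.symm]
  have fN : ∀ y ∈ N, f y = g y := by
    intro y hy
    have h1 : y ≠ x := fun h => hl.xN (h ▸ hy)
    have h2 : y ≠ x' := fun h => hx' (h ▸ hy)
    simp [hf, h1, h2, hy]
  have fN' : ∀ y ∈ N', f y = g' y := by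
    intro y hy
    have h1 : y ≠ x' := fun h => hl'.xN (h ▸ hy)
    have h2 : y ≠ x := fun h => hx (h ▸ hy)
    have h3 : y ∉ N := fun h => Finset.disjoint_left.1 hd h hy
    simp [hf, h1, h2, h3]
  refine hD.bad.ncol ⟨f, ?_, ?_⟩
  · intro y hy
    rcases hQ y hy with h | h | rfl | rfl
    · rw [fN y h]; exact g1 y h
    · rw [fN' y h]; exact g1' y h
    · rw [fx]; exact c.mem_a.2 ha
    · rw [fx']; exact c.mem_b.2 hb
  · intro y hy z hz hyz
    have hsep : ∀ a ∈ N, ∀ b ∈ N', ¬ G.Adj a b := by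
      intro a ha' b hb' hab'
      rcases hl.sep a ha' b (hl'.ND hb') hab' with h | h
      · exact Finset.disjoint_left.1 hd h hb'
      · exact hx (h ▸ hb')
    rcases hQ y hy with h | h | rfl | rfl <;> rcases hQ z hz with h' | h' | rfl | rfl
    · rw [fN y h, fN z h']; exact g2 y h z h' hyz
    · exact absurd hyz (hsep y h z h')
    · rw [fN y h, fx]; exact (na y h).1
    · rw [fN y h, fx']; exact (na y h).2
    · exact absurd hyz.symm (hsep z h' y h)
    · rw [fN' y h, fN' z h']; exact g2' y h z h' hyz
    · rw [fN' y h, fx]; exact (na' y h).1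
    · rw [fN' y h, fx']; exact (na' y h).2
    · rw [fN z h', fx]; exact (na z h').1.symm
    · rw [fN' z h', fx]; exact (na' z h').1.symm
    · exact absurd hyz (G.loopless.irrefl _)
    · rw [fx, fx']; exact hab
    · rw [fN z h', fx']; exact (na z h').2.symm
    · rw [fN' z h', fx']; exact (na' z h').2.symm
    · rw [fx, fx']; exact hab.symm
    · exact absurd hyz (G.loopless.irrefl _)

lemma Cfg.cleaf_xN [Fintype V] (c : Cfg G k w1 w2 v t1 t2 u α β) {D : Finset V} (hD : BP G w1 w2 t1 t2 α β D)
    {x x' : V} {N N' : Finset V} (hl : Leaf G D x N) (hl' : Leaf G D x' N') (hd : Disjoint N N') : x ∉ N' := by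
  intro hx
  obtain ⟨y, hy⟩ := hl.conn.1
  obtain ⟨-, h2, -⟩ := c.cleaf hD hl hy
  have : dg G N x ≤ ({x'} : Finset V).card := dg_le_of (fun b hb hxb => by
    rcases hl'.sep x hx b (hl.ND hb) hxb with h | h
    · exact absurd h (Finset.disjoint_left.1 hd hb)
    · simp [h])
  have := c.gd.four
  simp at *
  omega

lemma Cfg.no_leaves [Fintype V] (c : Cfg G k w1 w2 v t1 t2 u α β) {D : Finset V} (hD : BP G w1 w2 t1 t2 α β D)
    {x x' : V} {N N' : Finset V} (hl : Leaf G D x N) (hl' : Leaf G D x' N') (hd : Disjoint N N') : False := by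
  have k4 := c.gd.four
  obtain ⟨y, hy⟩ := hl.conn.1
  obtain ⟨y', hy'⟩ := hl'.conn.1
  have hC := c.leaf_C hD hl
  obtain ⟨-, a1, a2, -, a3, a4⟩ := c.cleaf hD hl hy
  obtain ⟨-, b1, b2, -, b3, b4⟩ := c.cleaf hD hl' hy'
  have hx := c.cleaf_xN hD hl hl' hd
  have hx' := c.cleaf_xN hD hl' hl hd.symm
  have s := c.cleaf_ne hD hl
  have s' := c.cleaf_ne hD hl'
  have hxx : x ≠ x' := by
    rintro rfl
    have h1 : dg G (N ∪ N') x ≤ dg G D x := dg_mono (Finset.union_subset hl.ND hl'.ND) x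
    rw [dg_union hd, hD.bad.eq c.hk x hl.xD] at h1
    have h3 := lst_card (G := G) (w1 := w1) (w2 := w2) (t1 := t1) (t2 := t2) c.ab x
    rcases s with s | s <;> simp only [s, if_true] at h3 <;> omega
  have part : ∀ p q : V, cA G p q D = cA G p q N + cA G p q N' + cA G p q {x} + cA G p q {x'} +
      cA G p q (D \ (((N ∪ N') ∪ {x}) ∪ {x'})) := by
    intro p q
    rw [← cA_union hd, ← cA_union, ← cA_union, ← cA_union]
    · congr 1
      rw [Finset.union_sdiff_of_subset]
      refine Finset.union_subset (Finset.union_subset (Finset.union_subset hl.ND hl'.ND) ?_) ?_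
      · simp [hl.xD]
      · simp [hl'.xD]
    · exact Finset.disjoint_sdiff
    · simp [hx', hl'.xN, hxx.symm]
    · simp [hx, hl.xN]
  have hpw := part w1 w2
  have hpt := part t1 t2
  have sx := cA_singleton (G := G) (p := w1) (q := w2) (x := x)
  have sx' := cA_singleton (G := G) (p := w1) (q := w2) (x := x')
  have rx := cA_singleton (G := G) (p := t1) (q := t2) (x := x)
  have rx' := cA_singleton (G := G) (p := t1) (q := t2) (x := x')
  have e1 : 1 ≤ cA G w1 w2 {x} + cA G t1 t2 {x} := by
    rw [sx, rx]; rcases s with s | s <;> simp [s]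
  have e2 : 1 ≤ cA G w1 w2 {x'} + cA G t1 t2 {x'} := by
    rw [sx', rx']; rcases s' with s | s <;> simp [s]
  obtain ⟨-, q1, q2⟩ := c.exact hD (by omega) (hl.ND hy) (hC y hy).1 (hC y hy).2
  have z1 : cA G w1 w2 (D \ (((N ∪ N') ∪ {x}) ∪ {x'})) = 0 := by omega
  have z2 : cA G t1 t2 (D \ (((N ∪ N') ∪ {x}) ∪ {x'})) = 0 := by omega
  have m1 : cA G w1 w2 {x} + cA G w1 w2 {x'} = 1 := by omega
  have m2 : cA G t1 t2 {x} + cA G t1 t2 {x'} = 1 := by omega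
  have mQ : ∀ a, a ∈ D \ (((N ∪ N') ∪ {x}) ∪ {x'}) ↔ a ∈ D ∧ a ∉ N ∧ a ∉ N' ∧ a ≠ x ∧ a ≠ x' := by
    intro a; simp only [Finset.mem_sdiff, Finset.mem_union, Finset.mem_singleton, not_or, and_assoc, ne_eq]
  have hQ : D \ (((N ∪ N') ∪ {x}) ∪ {x'}) = ∅ := by
    by_contra hne
    obtain ⟨a, ha, hh⟩ := c.hang hD hl.xD hl'.xD (Finset.sdiff_subset) (Finset.nonempty_iff_ne_empty.2 hne) (by
      intro a ha b hb hab
      rw [mQ] at ha ⊢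
      by_cases h1 : b = x
      · tauto
      by_cases h2 : b = x'
      · tauto
      left
      refine ⟨hb, ?_, ?_, h1, h2⟩
      · intro h
        rcases hl.sep b h a ha.1 hab.symm with h | h <;> tauto
      · intro h
        rcases hl'.sep b h a ha.1 hab.symm with h | h <;> tauto)
    unfold cA at z1 z2
    rw [Finset.card_eq_zero] at z1 z2
    rcases hh with h | h
    · exact Finset.notMem_empty a (z1 ▸ Finset.mem_filter.2 ⟨ha, h⟩)
    · exact Finset.notMem_empty a (z2 ▸ Finset.mem_filter.2 ⟨ha, h⟩)
  have hall : ∀ y ∈ D, y ∈ N ∨ y ∈ N' ∨ y = x ∨ y = x' := by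
    intro y hy
    by_contra hcon
    push Not at hcon
    have := (mQ y).2 ⟨hy, hcon⟩
    rw [hQ] at this
    exact Finset.notMem_empty _ this
  rw [sx, sx'] at m1
  rw [rx, rx'] at m2
  by_cases i1 : aw G w1 w2 x
  · have i2 : ¬ aw G w1 w2 x' := fun h => by simp [i1, h] at m1
    have i3 : aw G t1 t2 x' := s'.resolve_left i2
    have i4 : ¬ aw G t1 t2 x := fun h => by simp [i3, h] at m2
    exact c.two_col hD hl' hl hd.symm hx' hx hxx.symm (fun y hy => by have := hall y hy; tauto) i2 i4
  · have i3 : aw G t1 t2 x := s.resolve_left i1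
    have i4 : ¬ aw G t1 t2 x' := fun h => by simp [i3, h] at m2
    exact c.two_col hD hl hl' hd hx hx' hxx hall i1 i4

lemma Cfg.all_C [Fintype V] (c : Cfg G k w1 w2 v t1 t2 u α β) {D : Finset V} (hD : BP G w1 w2 t1 t2 α β D) :
    ∀ y ∈ D, aw G w1 w2 y ∧ aw G t1 t2 y := by
  rcases structure_lemma c.hk hD.bad (c.one_lt hD) with hc | ⟨x, N, x', N', hl, hl', hd⟩
  · exact fun y hy => ⟨c.const_A hD hc hy, c.const_B hD hc hy⟩
  · exact (c.no_leaves hD hl hl' hd).elim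
end cleaf
end KJ

namespace KJ
section five
variable {G : SimpleGraph V}
variable {w1 w2 v t1 t2 u : V} {α β : Fin 4}

/-- a set of vertices inducing a five-cycle -/
structure Cyc (G : SimpleGraph V) (D : Finset V) (a m b e h : V) : Prop where
  mem : ∀ z, z ∈ D ↔ z = a ∨ z = m ∨ z = b ∨ z = e ∨ z = h
  am : G.Adj a m
  mb : G.Adj m b
  be : G.Adj b e
  eh : G.Adj e h
  ha : G.Adj h a
  nab : ¬ G.Adj a b
  nme : ¬ G.Adj m e
  nbh : ¬ G.Adj b h
  nea : ¬ G.Adj e a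
  nhm : ¬ G.Adj h m

lemma Cyc.rot {D : Finset V} {a m b e h : V} (c : Cyc G D a m b e h) : Cyc G D m b e h a :=
  ⟨fun z => by rw [c.mem z]; tauto, c.mb, c.be, c.eh, c.ha, c.am, c.nme, c.nbh, c.nea, c.nhm, c.nab⟩

lemma Cyc.nd {D : Finset V} {a m b e h : V} (c : Cyc G D a m b e h) : a ≠ b := by
  rintro rfl; exact c.nbh c.ha.symm

lemma Cyc.edge {D : Finset V} {a m b e h : V} (c : Cyc G D a m b e h) (P : V → V → Prop)
    (hs : ∀ y z, P y z → P z y) (h1 : P a m) (h2 : P m b) (h3 : P b e) (h4 : P e h) (h5 : P h a) :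
    ∀ y ∈ D, ∀ z ∈ D, G.Adj y z → P y z := by
  have nab := c.nab
  have nme := c.nme
  have nbh := c.nbh
  have nea := c.nea
  have nhm := c.nhm
  intro y hy z hz hyz
  rw [c.mem] at hy hz
  rcases hy with rfl | rfl | rfl | rfl | rfl <;> rcases hz with rfl | rfl | rfl | rfl | rfl <;>
    first
    | assumption
    | exact absurd hyz (G.loopless.irrefl _)
    | exact absurd hyz ‹_›
    | exact absurd hyz.symm ‹_›
    | (apply hs; assumption)

lemma Cyc.dg_eq {D : Finset V} {a m b e h : V} (c : Cyc G D a m b e h) (w : V) :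
    dg G D w = (if G.Adj w a then 1 else 0) + (if G.Adj w m then 1 else 0) + (if G.Adj w b then 1 else 0) +
      (if G.Adj w e then 1 else 0) + (if G.Adj w h then 1 else 0) := by
  have hD : D = insert a (insert m (insert b (insert e (insert h ∅)))) := by
    ext z; rw [c.mem]; simp
  have n1 := c.nd
  have n2 := c.rot.nd
  have n3 := c.rot.rot.nd
  have n4 := c.rot.rot.rot.nd
  have n5 := c.rot.rot.rot.rot.nd
  have e1 := c.am.ne
  have e2 := c.mb.ne
  have e3 := c.be.ne
  have e4 := c.eh.ne
  have e5 := c.ha.ne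
  rw [hD, dg_insert, dg_insert, dg_insert, dg_insert, dg_insert]
  · have : dg G ∅ w = 0 := by unfold dg; simp
    rw [this]; ring
  · simp
  · simp [e4]
  · simp [e3, n3]
  · simp [e2, n2, n5.symm]
  · simp [e1, n1, n4.symm, e5.symm]

lemma Cfg.role [Fintype V] (c : Cfg G 4 w1 w2 v t1 t2 u α β) {D : Finset V} (hD : BP G w1 w2 t1 t2 α β D)
    (hV : ∀ z, z ∈ D ∨ z = w1 ∨ z = w2 ∨ z = t1 ∨ z = t2) (T : Finset V)
    (hT : ∀ y ∈ D, ∀ z ∈ D, G.Adj y z → ¬ (y ∈ T ∧ z ∈ T) ∧ (y ∉ T → z ∉ T → (G.Adj y t1 ↔ ¬ G.Adj z t1))) :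
    ∃ e : V → Fin 4, IsProperColoring G 4 e ∧ e w1 = e w2 ∧
      ∀ z ∈ D, e z = if z ∈ T then 3 else if G.Adj z t1 then 2 else 1 := by
  have nw1 := hD.cl.nw1
  have nw2 := hD.cl.nw2
  have nt1 := hD.cl.nt1
  have nt2 := hD.cl.nt2
  set g : V → Fin 4 := fun z => if z ∈ T then 3 else if G.Adj z t1 then 2 else 1 with hg
  set f : V → Fin 4 := fun z => if z = w1 ∨ z = w2 then 0 else if z = t1 then 1 else if z = t2 then 2 else g z with hf
  have f1 : f w1 = 0 := by simp [hf]
  have f2 : f w2 = 0 := by simp [hf]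
  have f3 : f t1 = 1 := by simp [hf, c.d11.symm, c.d21.symm]
  have f4 : f t2 = 2 := by simp [hf, c.d12.symm, c.d22.symm, c.tne.symm]
  have fD : ∀ z ∈ D, f z = g z := by
    intro z hz
    have h1 : z ≠ w1 := fun h => nw1 (h ▸ hz)
    have h2 : z ≠ w2 := fun h => nw2 (h ▸ hz)
    have h3 : z ≠ t1 := fun h => nt1 (h ▸ hz)
    have h4 : z ≠ t2 := fun h => nt2 (h ▸ hz)
    simp [hf, h1, h2, h3, h4]
  have g0 : ∀ z ∈ D, f z ≠ 0 := by
    intro z hz; rw [fD z hz, hg]; simp only; split_ifs <;> decide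
  have g1 : ∀ z ∈ D, G.Adj z t1 → f z ≠ 1 := by
    intro z hz h; rw [fD z hz, hg]; simp only [h, if_true]; split_ifs <;> decide
  have g2 : ∀ z ∈ D, G.Adj z t2 → f z ≠ 2 := by
    intro z hz h
    have h' : ¬ G.Adj z t1 := fun h' => (c.one hD hz).2 ⟨h', h⟩
    rw [fD z hz, hg]; simp only [h', if_false]; split_ifs <;> decide
  have gp : ∀ y ∈ D, ∀ z ∈ D, G.Adj y z → f y ≠ f z := by
    intro y hy z hz hyz
    obtain ⟨p1, p2⟩ := hT y hy z hz hyz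
    rw [fD y hy, fD z hz, hg]
    simp only
    by_cases i1 : y ∈ T
    · have i2 : z ∉ T := fun h => p1 ⟨i1, h⟩
      simp only [i1, i2, if_true, if_false]; split_ifs <;> decide
    · by_cases i2 : z ∈ T
      · simp only [i1, i2, if_true, if_false]; split_ifs <;> decide
      · have := p2 i1 i2
        by_cases i3 : G.Adj z t1
        · have i4 : ¬ G.Adj y t1 := fun h => this.1 h i3
          simp only [i1, i2, i3, i4, if_true, if_false]; decide
        · have i4 := this.2 i3
          simp only [i1, i2, i3, i4, if_true, if_false]; decide
  refine ⟨f, ?_, by rw [f1, f2], fD⟩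
  intro y z hyz
  have wna := c.wna
  have tna := c.tna
  rcases hV y with hy | rfl | rfl | rfl | rfl <;> rcases hV z with hz | rfl | rfl | rfl | rfl <;>
    first
    | exact gp y hy z hz hyz
    | exact absurd hyz (G.loopless.irrefl _)
    | exact absurd hyz ‹_›
    | exact absurd hyz.symm ‹_›
    | (simp only [f1, f2, f3, f4]; decide)
    | (rw [f1]; exact g0 _ ‹_›)
    | (rw [f2]; exact g0 _ ‹_›)
    | (rw [f3]; exact g1 _ ‹_› hyz)
    | (rw [f4]; exact g2 _ ‹_› hyz)
    | (rw [f1]; exact (g0 _ ‹_›).symm)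
    | (rw [f2]; exact (g0 _ ‹_›).symm)
    | (rw [f3]; exact (g1 _ ‹_› hyz.symm).symm)
    | (rw [f4]; exact (g2 _ ‹_› hyz.symm).symm)

/-- the condition for using the pair of opposite vertices -/
def good (a b e h : Bool) : Bool := (e != h) || (a == b && !(e == a && h == a))

lemma Cfg.role' [Fintype V] (c : Cfg G 4 w1 w2 v t1 t2 u α β) {D : Finset V} (hD : BP G w1 w2 t1 t2 α β D)
    (hV : ∀ z, z ∈ D ∨ z = w1 ∨ z = w2 ∨ z = t1 ∨ z = t2) {a m b e h : V} (hc : Cyc G D a m b e h)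
    (hg : good (decide (G.Adj a t1)) (decide (G.Adj b t1)) (decide (G.Adj e t1)) (decide (G.Adj h t1)) = true) :
    ∃ f : V → Fin 4, IsProperColoring G 4 f ∧ f w1 = f w2 ∧ f a = f b := by
  have n1 := hc.nd
  have n2 := hc.rot.nd
  have n3 := hc.rot.rot.nd
  have n4 := hc.rot.rot.rot.nd
  have n5 := hc.rot.rot.rot.rot.nd
  have e1 := hc.am.ne
  have e2 := hc.mb.ne
  have e3 := hc.be.ne
  have e4 := hc.eh.ne
  have e5 := hc.ha.ne
  have aD : a ∈ D := by rw [hc.mem]; simp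
  have bD : b ∈ D := by rw [hc.mem]; simp
  have key : ∀ T : Finset V,
      (∀ y ∈ D, ∀ z ∈ D, G.Adj y z → ¬ (y ∈ T ∧ z ∈ T) ∧ (y ∉ T → z ∉ T → (G.Adj y t1 ↔ ¬ G.Adj z t1))) →
      ((a ∈ T ∧ b ∈ T) ∨ (a ∉ T ∧ b ∉ T ∧ (G.Adj a t1 ↔ G.Adj b t1))) →
      ∃ f : V → Fin 4, IsProperColoring G 4 f ∧ f w1 = f w2 ∧ f a = f b := by
    intro T hT hab
    obtain ⟨f, h1, h2, h3⟩ := c.role hD hV T hT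
    refine ⟨f, h1, h2, ?_⟩
    rw [h3 a aD, h3 b bD]
    rcases hab with ⟨i, j⟩ | ⟨i, j, l⟩
    · simp [i, j]
    · simp [i, j, l]
  have hs : ∀ T : Finset V, ∀ y z,
      (¬ (y ∈ T ∧ z ∈ T) ∧ (y ∉ T → z ∉ T → (G.Adj y t1 ↔ ¬ G.Adj z t1))) →
      (¬ (z ∈ T ∧ y ∈ T) ∧ (z ∉ T → y ∉ T → (G.Adj z t1 ↔ ¬ G.Adj y t1))) := by
    intro T y z ⟨i, j⟩
    refine ⟨fun h => i h.symm, fun p q => ?_⟩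
    have := j q p
    tauto
  by_cases heh : G.Adj e t1 ↔ ¬ G.Adj h t1
  · refine key {a, b} ?_ (Or.inl (by simp))
    refine hc.edge (fun y z => ¬ (y ∈ ({a, b} : Finset V) ∧ z ∈ ({a, b} : Finset V)) ∧
      (y ∉ ({a, b} : Finset V) → z ∉ ({a, b} : Finset V) → (G.Adj y t1 ↔ ¬ G.Adj z t1))) (hs _) ?_ ?_ ?_ ?_ ?_
    · simp [e1.symm, e2]
    · simp [e1.symm, e2]
    · simp [n4, e3.symm]
    · simp [n4, e3.symm, n3.symm, e5, heh]
    · simp [n3.symm, e5]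
  · have hab : (G.Adj a t1 ↔ G.Adj b t1) ∧ (¬ (G.Adj e t1 ↔ G.Adj a t1) ∨ ¬ (G.Adj h t1 ↔ G.Adj a t1)) := by
      unfold good at hg
      by_cases j1 : G.Adj a t1 <;> by_cases j2 : G.Adj b t1 <;> by_cases j3 : G.Adj e t1 <;>
        by_cases j4 : G.Adj h t1 <;> simp [j1, j2, j3, j4] at hg heh ⊢
    obtain ⟨hab, hh⟩ := hab
    have hh' : G.Adj h t1 ↔ ¬ G.Adj a t1 := by
      by_cases j1 : G.Adj a t1 <;> by_cases j3 : G.Adj e t1 <;>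
        by_cases j4 : G.Adj h t1 <;> simp [j1, j3, j4] at hh heh ⊢
    refine key {m, e} ?_ (Or.inr ⟨by simp [e1, n4.symm], by simp [e2.symm, e3], hab⟩)
    refine hc.edge (fun y z => ¬ (y ∈ ({m, e} : Finset V) ∧ z ∈ ({m, e} : Finset V)) ∧
      (y ∉ ({m, e} : Finset V) → z ∉ ({m, e} : Finset V) → (G.Adj y t1 ↔ ¬ G.Adj z t1))) (hs _) ?_ ?_ ?_ ?_ ?_
    · simp [e1, n4.symm]
    · simp [e2.symm, e3]
    · simp [e2.symm, e3]
    · simp [e4.symm, n5]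
    · simp [e4.symm, n5, e1, n4.symm, hh']

lemma Cfg.fin5 [Fintype V] (c : Cfg G 4 w1 w2 v t1 t2 u α β) {D : Finset V} (hD : BP G w1 w2 t1 t2 α β D)
    (hV : ∀ z, z ∈ D ∨ z = w1 ∨ z = w2 ∨ z = t1 ∨ z = t2) {a m b e h : V} (hc : Cyc G D a m b e h)
    (hg : good (decide (G.Adj a w1)) (decide (G.Adj b w1)) (decide (G.Adj e w1)) (decide (G.Adj h w1)) = true ∧
     good (decide (G.Adj a t1)) (decide (G.Adj b t1)) (decide (G.Adj e t1)) (decide (G.Adj h t1)) = true) :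
    False := by
  obtain ⟨f, f1, f2, f3⟩ := c.role' hD hV hc hg.2
  obtain ⟨g, g1, g2, g3⟩ := c.swap.role' hD.swap (fun z => by have := hV z; tauto) hc hg.1
  have hel : Elig G a b := ⟨hc.nd, hc.nab, m, hc.am.symm, hc.mb⟩
  exact c.neq (EqP.trans (EqP.of_common c.gd c.eligW hel f1 f2 f3)
    (EqP.of_common c.gd hel c.eligT g1 g3 g2) f1 f3)

set_option maxRecDepth 100000 in
lemma bools : ∀ a0 a1 a2 a3 a4 : Bool, (a0.toNat + a1.toNat + a2.toNat + a3.toNat + a4.toNat = 2 ∨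
      a0.toNat + a1.toNat + a2.toNat + a3.toNat + a4.toNat = 3) → ∀ b0 b1 b2 b3 b4 : Bool,
    (b0.toNat + b1.toNat + b2.toNat + b3.toNat + b4.toNat = 2 ∨
      b0.toNat + b1.toNat + b2.toNat + b3.toNat + b4.toNat = 3) →
    (good a0 a2 a3 a4 = true ∧ good b0 b2 b3 b4 = true) ∨ (good a1 a3 a4 a0 = true ∧ good b1 b3 b4 b0 = true) ∨
    (good a2 a4 a0 a1 = true ∧ good b2 b4 b0 b1 = true) ∨ (good a3 a0 a1 a2 = true ∧ good b3 b0 b1 b2 = true) ∨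
    (good a4 a1 a2 a3 = true ∧ good b4 b1 b2 b3 = true) := by
  decide

lemma Cfg.no5 [Fintype V] (c : Cfg G 4 w1 w2 v t1 t2 u α β) {D : Finset V} (hD : BP G w1 w2 t1 t2 α β D)
    (hd : Dgn G 4 w1 w2 t1 t2 D) {a m b e h : V} (hc : Cyc G D a m b e h) : False := by
  have tn : ∀ y w : V, (decide (G.Adj y w)).toNat = if G.Adj w y then 1 else 0 := by
    intro y w
    by_cases h : G.Adj w y
    · simp [h, h.symm]
    · have : ¬ G.Adj y w := fun h' => h h'.symm
      simp [h, this]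
  have q1 := hc.dg_eq w1
  have q2 := hc.dg_eq t1
  have d1 := hd.2.1
  have d2 := hd.2.2
  have hV := hd.1
  have := bools (decide (G.Adj a w1)) (decide (G.Adj m w1)) (decide (G.Adj b w1)) (decide (G.Adj e w1))
    (decide (G.Adj h w1)) (by simp only [tn]; omega) (decide (G.Adj a t1)) (decide (G.Adj m t1)) (decide (G.Adj b t1))
    (decide (G.Adj e t1)) (decide (G.Adj h t1)) (by simp only [tn]; omega)
  rcases this with h | h | h | h | h
  · exact c.fin5 hD hV hc h
  · exact c.fin5 hD hV hc.rot h
  · exact c.fin5 hD hV hc.rot.rot h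
  · exact c.fin5 hD hV hc.rot.rot.rot h
  · exact c.fin5 hD hV hc.rot.rot.rot.rot h
end five
end KJ

namespace KJ
section clique
variable {G : SimpleGraph V} {k : ℕ}
variable {w1 w2 v t1 t2 u : V} {α β : Fin k}

lemma exists_cherry {D : Finset V} (hD : Conn G D) (h : ¬ ∀ x ∈ D, ∀ y ∈ D, x ≠ y → G.Adj x y) :
    ∃ x ∈ D, ∃ y ∈ D, ∃ z ∈ D, G.Adj x y ∧ G.Adj x z ∧ y ≠ z ∧ ¬ G.Adj y z := by
  by_contra hcon
  push Not at hcon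
  refine h ?_
  intro a ha b hb hab
  by_contra hnab
  obtain ⟨s, hs, r, hr, hsr⟩ := hD.2 (D.filter (fun z => z = a ∨ G.Adj a z)) (Finset.filter_subset _ _)
    ⟨a, by simp [ha]⟩ ⟨b, by simp [hb, hnab, hab.symm]⟩
  simp only [Finset.mem_sdiff, Finset.mem_filter, not_and, not_or] at hs hr
  have hr2 := hr.2 hr.1
  rcases hs.2 with rfl | h1
  · exact hr2.2 hsr
  · exact hr2.2 (hcon s hs.1 a ha r hr.1 h1.symm hsr (Ne.symm hr2.1))

lemma dg_lt_card {Y : Finset V} {a : V} (ha : a ∈ Y) : dg G Y a + 1 ≤ Y.card := by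
  have h2 : dg G Y a ≤ (Y.erase a).card := dg_le_of (fun b hb hab => by simp [hb, hab.ne.symm])
  rw [Finset.card_erase_of_mem ha] at h2
  have := Finset.card_pos.2 ⟨a, ha⟩
  omega

lemma dg_full {Y : Finset V} {a : V} (h : ∀ b ∈ Y, G.Adj a b) : dg G Y a = Y.card := by
  unfold dg; rw [Finset.filter_true_of_mem h]

lemma dg_zero {Y : Finset V} {a : V} (h : ∀ b ∈ Y, ¬ G.Adj a b) : dg G Y a = 0 := by
  unfold dg; rw [Finset.filter_false_of_mem h]; rfl

/-- the colouring part -/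
lemma bad_piece (hk : 0 < k) {D : Finset V} {L : V → Finset (Fin k)} (hdeg : ∀ a ∈ D, dg G D a ≤ (L a).card)
    (hn : ¬ Col G D L) {y z : V} (hy : y ∈ D) (hz : z ∈ D) (hyz : y ≠ z) (hna : ¬ G.Adj y z) {γ : Fin k}
    (hγy : γ ∈ L y) (hγz : γ ∈ L z) :
    ∃ E, Conn G E ∧ ClosedIn G E ((D.erase y).erase z) ∧ ∀ a ∈ E, ¬ (G.Adj a y ∧ G.Adj a z) := by
  by_contra hcon
  push Not at hcon
  set L' : V → Finset (Fin k) := fun a => if G.Adj a y ∨ G.Adj a z then (L a).erase γ else L a with hL'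
  have hzm : z ∈ D.erase y := by simp [hz, hyz.symm]
  have hcol : Col G ((D.erase y).erase z) L' := by
    refine col_of_pieces _ hk _ _ rfl ?_
    intro E hE hc
    obtain ⟨b, hb, hby, hbz⟩ := hcon E hE hc
    have hle : ∀ a ∈ E, dg G E a ≤ (L' a).card ∧ (G.Adj a y → G.Adj a z → dg G E a < (L' a).card) := by
      intro a ha
      have h1 := dg_mono (G := G) hc.1 a
      have h2 := dg_erase (G := G) (y := a) hzm
      have h3 := dg_erase (G := G) (y := a) hy
      have h4 := hdeg a (Finset.mem_of_mem_erase (Finset.mem_of_mem_erase (hc.1 ha)))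
      have h5 := Finset.pred_card_le_card_erase (s := L a) (a := γ)
      by_cases i1 : G.Adj a y <;> by_cases i2 : G.Adj a z <;>
        simp only [hL', i1, i2, if_true, if_false, or_true, true_or, or_false, or_self] at h2 h3 ⊢
      · exact ⟨by omega, fun _ _ => by omega⟩
      · exact ⟨by omega, fun _ h => h.elim⟩
      · exact ⟨by omega, fun h => h.elim⟩
      · exact ⟨by omega, fun h => h.elim⟩
    exact greedy' hk hE (fun a ha => (hle a ha).1) hb ((hle b hb).2 hby hbz)
  obtain ⟨f, f1, f2⟩ := hcol
  have hnew : ∀ a ∈ D, a ≠ y → a ≠ z → f a ∈ L a ∧ (G.Adj a y ∨ G.Adj a z → f a ≠ γ) := by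
    intro a ha h1 h2
    have := f1 a (by simp [ha, h1, h2])
    rw [hL'] at this
    simp only at this
    split_ifs at this with h
    · exact ⟨Finset.mem_of_mem_erase this, fun _ => Finset.ne_of_mem_erase this⟩
    · exact ⟨this, fun h' => absurd h' h⟩
  refine hn ⟨fun a => if a = y ∨ a = z then γ else f a, ?_, ?_⟩
  · intro a ha
    simp only
    split_ifs with h
    · rcases h with rfl | rfl <;> assumption
    · push Not at h
      exact (hnew a ha h.1 h.2).1
  · intro a ha b hb hab
    simp only
    split_ifs with h h' h'
    · exfalso
      rcases h with rfl | rfl <;> rcases h' with rfl | rfl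
      · exact G.loopless.irrefl _ hab
      · exact hna hab
      · exact hna hab.symm
      · exact G.loopless.irrefl _ hab
    · push Not at h'
      refine ((hnew b hb h'.1 h'.2).2 ?_).symm
      rcases h with rfl | rfl
      · exact Or.inl hab.symm
      · exact Or.inr hab.symm
    · push Not at h
      refine (hnew a ha h.1 h.2).2 ?_
      rcases h' with rfl | rfl
      · exact Or.inl hab
      · exact Or.inr hab
    · push Not at h h'
      exact f2 a (by simp [ha, h.1, h.2]) b (by simp [hb, h'.1, h'.2]) hab

lemma Cfg.cycle [Fintype V] (c : Cfg G k w1 w2 v t1 t2 u α β) {D : Finset V} (hD : BP G w1 w2 t1 t2 α β D)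
    (hcl : ¬ ∀ x ∈ D, ∀ y ∈ D, x ≠ y → G.Adj x y) :
    k = 4 ∧ Dgn G k w1 w2 t1 t2 D ∧ ∃ a m b e h, Cyc G D a m b e h := by
  have k4 := c.gd.four
  have hC := c.all_C hD
  obtain ⟨x, hx, y, hy, z, hz, hxy, hxz, hyz, hna⟩ := exists_cherry hD.bad.conn hcl
  have hcard : ∀ a ∈ D, (lst G w1 w2 t1 t2 α β a).card + 2 = k := by
    intro a ha
    have := lst_card (G := G) (w1 := w1) (w2 := w2) (t1 := t1) (t2 := t2) c.ab a
    simp only [(hC a ha).1, (hC a ha).2, if_true] at this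
    omega
  have hdeg : ∀ a ∈ D, dg G D a + 2 = k := fun a ha => by rw [hD.bad.eq c.hk a ha]; exact hcard a ha
  obtain ⟨γ, hγ⟩ : (lst G w1 w2 t1 t2 α β y).Nonempty := Finset.card_pos.1 (by have := hcard y hy; omega)
  have hγz : γ ∈ lst G w1 w2 t1 t2 α β z := by
    rw [mem_lst] at hγ ⊢
    simpa [hC y hy, hC z hz] using hγ
  obtain ⟨E, hE, hcE, hno⟩ := bad_piece c.hk hD.bad.deg hD.bad.ncol hy hz hyz hna hγ hγz
  set R := ((D.erase y).erase z) \ E with hR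
  have mR : ∀ a, a ∈ R ↔ a ∈ D ∧ a ≠ y ∧ a ≠ z ∧ a ∉ E := by
    intro a; simp only [hR, Finset.mem_sdiff, Finset.mem_erase]; tauto
  have mE : ∀ a ∈ E, a ∈ D ∧ a ≠ y ∧ a ≠ z := by
    intro a ha
    have := hcE.1 ha
    simp only [Finset.mem_erase] at this
    tauto
  have hER : E ∪ R = (D.erase y).erase z := Finset.union_sdiff_of_subset hcE.1
  have hdis : Disjoint E R := Finset.disjoint_sdiff
  have hzm : z ∈ D.erase y := by simp [hz, hyz.symm]
  have hpart : ∀ a, dg G E a + dg G R a + (if G.Adj a z then 1 else 0) + (if G.Adj a y then 1 else 0) = dg G D a := by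
    intro a
    rw [← dg_union hdis, hER, dg_erase hzm, dg_erase hy]
  have hcd : E.card + R.card + 2 = D.card := by
    rw [← Finset.card_union_of_disjoint hdis, hER, Finset.card_erase_of_mem hzm, Finset.card_erase_of_mem hy]
    have : 1 < D.card := Finset.one_lt_card.2 ⟨y, hy, z, hz, hyz⟩
    omega
  have hER0 : ∀ a ∈ E, ∀ b ∈ R, ¬ G.Adj a b := by
    intro a ha b hb hab
    have := Finset.mem_sdiff.1 hb
    exact this.2 (hcE.2 a ha b this.1 hab)
  have xR : x ∈ R := by
    rw [mR]
    exact ⟨hx, hxy.ne, hxz.ne, fun h => hno x h ⟨hxy, hxz⟩⟩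
  have r0 : ∀ a ∈ R, dg G E a = 0 := fun a ha => dg_zero fun b hb hab => hER0 b hb a ha hab.symm
  have e0 : ∀ a ∈ E, dg G R a = 0 := fun a ha => dg_zero fun b hb hab => hER0 a ha b hb hab
  -- sizes
  have hE1 : ∀ a ∈ E, k ≤ dg G E a + 3 ∧ (dg G E a + 3 = k → (G.Adj a y ∨ G.Adj a z)) := by
    intro a ha
    have h1 := hpart a
    rw [e0 a ha] at h1
    have h2 := hdeg a (mE a ha).1
    have h3 := hno a ha
    by_cases i1 : G.Adj a y <;> by_cases i2 : G.Adj a z <;> simp only [i1, i2, if_true, if_false] at h1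
    · exact absurd ⟨i1, i2⟩ h3
    · exact ⟨by omega, fun _ => Or.inl i1⟩
    · exact ⟨by omega, fun _ => Or.inr i2⟩
    · exact ⟨by omega, fun h => by omega⟩
  have hR1 : ∀ a ∈ R, k ≤ dg G R a + 4 ∧ (dg G R a + 4 = k → (G.Adj a y ∧ G.Adj a z)) := by
    intro a ha
    have h1 := hpart a
    rw [r0 a ha] at h1
    have h2 := hdeg a ((mR a).1 ha).1
    by_cases i1 : G.Adj a y <;> by_cases i2 : G.Adj a z <;> simp only [i1, i2, if_true, if_false] at h1
    · exact ⟨by omega, fun _ => ⟨i1, i2⟩⟩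
    · exact ⟨by omega, fun h => by omega⟩
    · exact ⟨by omega, fun h => by omega⟩
    · exact ⟨by omega, fun h => by omega⟩
  obtain ⟨e, he⟩ := hE.1
  have s1 := dg_lt_card (G := G) he
  have s2 := dg_lt_card (G := G) xR
  have s3 := (hE1 e he).1
  have s4 := (hR1 x xR).1
  have cw : cA G w1 w2 D = D.card := cA_all fun a ha => (hC a ha).1
  have ct : cA G t1 t2 D = D.card := cA_all fun a ha => (hC a ha).2
  obtain ⟨hdgn, q1, -⟩ := c.exact hD (by omega) hy (hC y hy).1 (hC y hy).2
  rw [cw] at q1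
  have hEc : E.card + 2 = k := by omega
  have hRc : R.card + 3 = k := by omega
  have hRadj : ∀ a ∈ R, G.Adj a y ∧ G.Adj a z := by
    intro a ha
    have := dg_lt_card (G := G) ha
    exact (hR1 a ha).2 (by have := (hR1 a ha).1; omega)
  have hEadj : ∀ a ∈ E, G.Adj a y ∨ G.Adj a z := by
    intro a ha
    have := dg_lt_card (G := G) ha
    exact (hE1 a ha).2 (by have := (hE1 a ha).1; omega)
  have hEy : dg G E y = 1 := by
    have h1 := hpart y
    rw [dg_full (Y := R) (fun b hb => (hRadj b hb).1.symm), if_neg hna, if_neg (G.loopless.irrefl _)] at h1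
    have := hdeg y hy
    omega
  have hEz : dg G E z = 1 := by
    have h1 := hpart z
    rw [dg_full (Y := R) (fun b hb => (hRadj b hb).2.symm), if_neg (G.loopless.irrefl z),
      if_neg (fun h => hna h.symm)] at h1
    have := hdeg z hz
    omega
  obtain ⟨c1, hc1, yc1, uc1⟩ := uniq_nbr hEy
  obtain ⟨c2, hc2, zc2, uc2⟩ := uniq_nbr hEz
  have hEm : ∀ a, a ∈ E ↔ a = c1 ∨ a = c2 := by
    intro a
    refine ⟨fun ha => ?_, ?_⟩
    · rcases hEadj a ha with h | h
      · exact Or.inl (uc1 a ha h.symm)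
      · exact Or.inr (uc2 a ha h.symm)
    · rintro (rfl | rfl) <;> assumption
  have hEsub : E ⊆ {c1, c2} := fun a ha => by simpa using (hEm a).1 ha
  have hE2 := (Finset.card_le_card hEsub).trans Finset.card_le_two
  have hk4 : k = 4 := by omega
  have hR2 : R.card = 1 := by omega
  have hRm : ∀ a ∈ R, a = x := fun a ha => by
    obtain ⟨r, hr⟩ := Finset.card_eq_one.1 hR2
    rw [hr] at ha xR
    simp at ha xR
    rw [ha, xR]
  have hne : c1 ≠ c2 := by
    rintro rfl
    have : E ⊆ {c1} := fun a ha => by simpa using (hEm a).1 ha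
    have := Finset.card_le_card this
    simp at this
    omega
  have hc12 : G.Adj c1 c2 := by
    obtain ⟨b, hb, hb1, hb2⟩ := conn_nbr hE (by omega) hc1
    rcases (hEm b).1 hb with rfl | rfl
    · exact absurd rfl hb1
    · exact hb2
  refine ⟨hk4, hdgn, y, x, z, c2, c1, ?_, hxy.symm, hxz, zc2, hc12.symm, yc1.symm, hna, ?_, ?_, ?_, ?_⟩
  · intro a
    constructor
    · intro ha
      by_cases i1 : a = y
      · exact Or.inl i1
      by_cases i2 : a = z
      · tauto
      by_cases i3 : a ∈ E
      · have := (hEm a).1 i3; tauto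
      · have := hRm a ((mR a).2 ⟨ha, i1, i2, i3⟩); tauto
    · rintro (rfl | rfl | rfl | rfl | rfl)
      · exact hy
      · exact hx
      · exact hz
      · exact (mE _ hc2).1
      · exact (mE _ hc1).1
  · exact fun h => hER0 c2 hc2 x xR h.symm
  · exact fun h => hne (uc2 c1 hc1 h)
  · exact fun h => hne (uc1 c2 hc2 h.symm).symm
  · exact fun h => hER0 c1 hc1 x xR h

lemma Cfg.clique [Fintype V] (c : Cfg G k w1 w2 v t1 t2 u α β) {D : Finset V} (hD : BP G w1 w2 t1 t2 α β D) :
    ∀ x ∈ D, ∀ y ∈ D, x ≠ y → G.Adj x y := by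
  by_contra hcl
  obtain ⟨rfl, hd, a, m, b, e, h, hc⟩ := c.cycle hD hcl
  exact c.no5 hD hd hc

lemma Cfg.final [Fintype V] (c : Cfg G k w1 w2 v t1 t2 u α β) :
    ∃ C : Finset V, C.card = k - 1 ∧ (∀ x ∈ C, ∀ y ∈ C, x ≠ y → G.Adj x y) ∧
        (∀ x ∈ C, Xor' (G.Adj t1 x) (G.Adj t2 x)) ∧
        (∀ x ∈ C, Xor' (G.Adj w1 x) (G.Adj w2 x)) := by
  obtain ⟨D, hD⟩ := c.exists_BP
  have hC := c.all_C hD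
  have hcl := c.clique hD
  refine ⟨D, ?_, hcl, ?_, ?_⟩
  · obtain ⟨y, hy⟩ := hD.bad.conn.1
    have h1 := hD.bad.eq c.hk y hy
    have h2 := lst_card (G := G) (w1 := w1) (w2 := w2) (t1 := t1) (t2 := t2) c.ab y
    simp only [(hC y hy).1, (hC y hy).2, if_true] at h2
    have h3 := dg_erase (G := G) (y := y) hy
    rw [if_neg (G.loopless.irrefl _), dg_full (fun b hb => hcl y hy b (Finset.mem_of_mem_erase hb)
      (Finset.ne_of_mem_erase hb).symm), Finset.card_erase_of_mem hy] at h3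
    have := c.gd.four
    omega
  · intro y hy
    have h1 := (hC y hy).2
    have h2 := (c.one hD hy).2
    unfold aw at h1
    rw [G.adj_comm t1, G.adj_comm t2]
    change (_ ∧ ¬ _) ∨ (_ ∧ ¬ _)
    tauto
  · intro y hy
    have h1 := (hC y hy).1
    have h2 := (c.one hD hy).1
    unfold aw at h1
    rw [G.adj_comm w1, G.adj_comm w2]
    change (_ ∧ ¬ _) ∨ (_ ∧ ¬ _)
    tauto

/-- in a proper colouring the neighbourhood of `u` contains a repeated colour -/
lemma exists_pair [Fintype V] (hG : Gd G k) {e : V → Fin k} (he : IsProperColoring G k e) (u : V) :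
    ∃ t1 t2, G.Adj u t1 ∧ G.Adj u t2 ∧ t1 ≠ t2 ∧ e t1 = e t2 := by
  have hr := hG.reg u
  unfold dg at hr
  have h4 := hG.four
  obtain ⟨x, hx, y, hy, hxy, hxye⟩ := Finset.exists_ne_map_eq_of_card_lt_of_maps_to
    (s := Finset.univ.filter (fun z => G.Adj u z)) (t := (Finset.univ : Finset (Fin k)).erase (e u)) (f := e)
    (by rw [Finset.card_erase_of_mem (Finset.mem_univ _), Finset.card_univ, Fintype.card_fin]; omega)
    (by
      intro z hz
      have hz' : G.Adj u z := by simpa using hz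
      simpa using (he hz').symm)
  exact ⟨x, y, by simpa using hx, by simpa using hy, hxy, hxye⟩

lemma main [Fintype V] (hG : Gd G k) (hn : ¬ KempeClass G k) {u v w1 w2 : V} (hw1 : G.Adj v w1)
    (hw2 : G.Adj v w2) (hwne : w1 ≠ w2) (hwna : ¬ G.Adj w1 w2) (h1 : ¬ G.Adj u w1) (h2 : ¬ G.Adj u w2) :
    ∃ t1 t2 : V, G.Adj u t1 ∧ G.Adj u t2 ∧ t1 ≠ t2 ∧ ¬ G.Adj t1 t2 ∧
      ∃ C : Finset V, C.card = k - 1 ∧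
        (∀ x ∈ C, ∀ y ∈ C, x ≠ y → G.Adj x y) ∧
        (∀ x ∈ C, Xor' (G.Adj t1 x) (G.Adj t2 x)) ∧
        (∀ x ∈ C, Xor' (G.Adj w1 x) (G.Adj w2 x)) := by
  have k4 := hG.four
  have hel : Elig G w1 w2 := ⟨hwne, hwna, v, hw1, hw2⟩
  have key : ∃ t1 t2 : V, G.Adj u t1 ∧ G.Adj u t2 ∧ t1 ≠ t2 ∧ ¬ G.Adj t1 t2 ∧ ¬ EqP G k w1 w2 t1 t2 := by
    by_contra hcon
    push Not at hcon
    refine hn ?_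
    intro c c' hc hc'
    obtain ⟨e, he, he1, he2⟩ := exists_alike hG hel (⟨0, by omega⟩ : Fin k)
    have aux : ∀ c : V → Fin k, IsProperColoring G k c → KempeEquiv G k e c ∧ KempeEquiv G k c e := by
      intro c hc
      obtain ⟨t1, t2, a1, a2, a3, a4⟩ := exists_pair hG hc u
      exact hcon t1 t2 a1 a2 a3 (fun h => hc h a4) e c he hc (he1.trans he2.symm) a4
    exact Relation.ReflTransGen.trans (aux c hc).2 (aux c' hc').1
  obtain ⟨t1, t2, a1, a2, a3, a4, a5⟩ := key
  refine ⟨t1, t2, a1, a2, a3, a4, ?_⟩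
  have cfg : Cfg G k w1 w2 v t1 t2 u (⟨0, by omega⟩ : Fin k) (⟨1, by omega⟩ : Fin k) :=
    { gd := hG, wne := hwne, wna := hwna, vw1 := hw1, vw2 := hw2, tne := a3, tna := a4, ut1 := a1, ut2 := a2
      d11 := fun h => h1 (h ▸ a1), d12 := fun h => h1 (h ▸ a2), d21 := fun h => h2 (h ▸ a1)
      d22 := fun h => h2 (h ▸ a2), uv := fun h => h1 (h ▸ hw1), ab := by simp, neq := a5 }
  exact cfg.final

lemma gd_of [Fintype V] (k : ℕ) (hk : 4 ≤ k) (G : SimpleGraph V)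
    [DecidableRel G.Adj] (hreg : G.IsRegularOfDegree k) (h3c : ThreeConnected G) : Gd G k := by
  refine ⟨hk, ?_, ?_⟩
  · intro y
    rw [← hreg y, ← SimpleGraph.card_neighborFinset_eq_degree]
    unfold dg
    congr 1
    ext z
    simp
  · intro p q
    have hc := h3c.2 ({p, q} : Set V) ((Set.ncard_insert_le p {q}).trans (by rw [Set.ncard_singleton]))
    have mm : ∀ a : V, a ∈ (({p, q} : Set V)ᶜ) ↔ a ∈ Finset.univ \ ({p, q} : Finset V) := by intro a; simp
    refine ⟨?_, ?_⟩
    · obtain ⟨a⟩ := hc.nonempty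
      exact ⟨a.1, (mm _).1 a.2⟩
    · rintro T hT ⟨a, ha⟩ ⟨b, hb⟩
      have hbm := Finset.mem_sdiff.1 hb
      obtain ⟨w⟩ := hc.preconnected ⟨a, (mm a).2 (hT ha)⟩ ⟨b, (mm b).2 hbm.1⟩
      obtain ⟨d, hd, hd1, hd2⟩ := w.exists_boundary_dart {x | x.1 ∈ T} ha hbm.2
      exact ⟨d.fst.1, hd1, d.snd.1, Finset.mem_sdiff.2 ⟨(mm _).1 d.snd.2, hd2⟩, d.adj⟩
end clique
end KJ

theorem stmt10 {V : Type*} [Fintype V] (k : ℕ) (hk : 4 ≤ k) (G : SimpleGraph V)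
    [DecidableRel G.Adj] (hreg : G.IsRegularOfDegree k) (h3c : ThreeConnected G)
    (hnKC : ¬ KempeClass G k)
    (u v w1 w2 : V) (hw1 : G.Adj v w1) (hw2 : G.Adj v w2)
    (hwne : w1 ≠ w2) (hwnadj : ¬ G.Adj w1 w2)
    (hw1u : ¬ G.Adj u w1) (hw2u : ¬ G.Adj u w2) :
    ∃ t1 t2 : V, G.Adj u t1 ∧ G.Adj u t2 ∧ t1 ≠ t2 ∧ ¬ G.Adj t1 t2 ∧
      ∃ C : Set V, C.ncard = k - 1 ∧
        (∀ x ∈ C, ∀ y ∈ C, x ≠ y → G.Adj x y) ∧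
        (∀ x ∈ C, Xor' (G.Adj t1 x) (G.Adj t2 x)) ∧
        (∀ x ∈ C, Xor' (G.Adj w1 x) (G.Adj w2 x)) := by
  obtain ⟨t1, t2, a1, a2, a3, a4, C, c1, c2, c3, c4⟩ :=
    KJ.main (KJ.gd_of k hk G hreg h3c) hnKC hw1 hw2 hwne hwnadj hw1u hw2u
  refine ⟨t1, t2, a1, a2, a3, a4, (C : Set V), ?_, ?_, ?_, ?_⟩
  · rw [Set.ncard_coe_finset]; exact c1
  · intro x hx y hy; exact c2 x (by simpa using hx) y (by simpa using hy)
  · intro x hx; exact c3 x (by simpa using hx)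
  · intro x hx; exact c4 x (by simpa using hx)
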